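/- Let n ≥ m ≥ 1, ρ > 0, k ∈ ℝ and ν > 0 with ν/2 − k > 0, and τ = (t₁, …, t_m) ∈ ℝ^m with n/2 − t_i − (m−i)/2 > 0 for all i. Suppose the random n×m real matrix T has the matrix multivariate T-Riesz type II distribution MTR^{II}(ν, k, τ, ρ, 0, I_n, I_m). Then the random vector (α₁, …, α_m) of singular values of T (which almost surely satisfies α₁ > ⋯ > α_m > 0) has, with respect to Lebesgue measure on the region {α₁ > ⋯ > α_m > 0} ⊂ ℝ^m, the joint density c · ∏_{i=1}^m α_i^{n−m} · (1 + ρ Σ_{i=1}^m α_i²)^{−[(ν+mn)/2 − k − Σᵢtᵢ]} · ∏_{i<j}(α_i² − α_j²) · ∫_{O(m)} q_τ((H D_α² Hᵀ)^{−1}) dνₕ(H), where D_α = diag(α₁, …, α_m), νₕ is the normalized Haar probability measure on the orthogonal group O(m), and c = 2^m π^{m²/2} Γ((ν+mn)/2 − k − Σᵢtᵢ) ρ^{mn/2 − Σᵢtᵢ} / (Γ_m(m/2) Γ_m(n/2, −τ) Γ(ν/2−k)). -/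

import Mathlib

open MeasureTheory Matrix Real

/-- Lebesgue (product) measure on `n × m` real matrices, via the identification with `ℝ^{nm}`. -/
noncomputable instance matMeasureSpace (n m : ℕ) : MeasureSpace (Matrix (Fin n) (Fin m) ℝ) :=
  (inferInstance : MeasureSpace (Fin n → Fin m → ℝ))

/-- Determinant of the leading principal `(i+1) × (i+1)` submatrix. -/
noncomputable def princMinor {m : ℕ} (A : Matrix (Fin m) (Fin m) ℝ) (i : Fin m) : ℝ :=
  (A.submatrix (fun j : Fin (i.1 + 1) => Fin.castLE i.isLt j)
    (fun j : Fin (i.1 + 1) => Fin.castLE i.isLt j)).det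

/-- The highest weight vector (generalized power)
`q_κ(A) = det(A)^{k_m} ∏_{i=1}^{m-1} det(A_i)^{k_i - k_{i+1}}`. -/
noncomputable def hwv {m : ℕ} (κ : Fin m → ℝ) (A : Matrix (Fin m) (Fin m) ℝ) : ℝ :=
  ∏ i : Fin m, princMinor A i ^ (if h : i.1 + 1 < m then κ i - κ ⟨i.1 + 1, h⟩ else κ i)

/-- The real multivariate gamma function `Γ_m(a) = π^{m(m-1)/4} ∏ Γ(a - (i-1)/2)`. -/
noncomputable def mvGamma (m : ℕ) (a : ℝ) : ℝ :=
  Real.pi ^ (((m * (m - 1) : ℕ) : ℝ) / 4) * ∏ i : Fin m, Real.Gamma (a - (i : ℝ) / 2)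

/-- The generalized gamma function of weight `τ`:
`Γ_m(a, τ) = π^{m(m-1)/4} ∏ Γ(a + t_i - (i-1)/2)`. -/
noncomputable def mvGammaI (m : ℕ) (a : ℝ) (τ : Fin m → ℝ) : ℝ :=
  Real.pi ^ (((m * (m - 1) : ℕ) : ℝ) / 4) * ∏ i : Fin m, Real.Gamma (a + τ i - (i : ℝ) / 2)

/-- The generalized gamma function of weight `-τ`:
`Γ_m(a, -τ) = π^{m(m-1)/4} ∏ Γ(a - t_i - (m-i)/2)`. -/
noncomputable def mvGammaII (m : ℕ) (a : ℝ) (τ : Fin m → ℝ) : ℝ :=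
  Real.pi ^ (((m * (m - 1) : ℕ) : ℝ) / 4) *
    ∏ i : Fin m, Real.Gamma (a - τ i - ((m : ℝ) - 1 - (i : ℝ)) / 2)

/-- Lebesgue measure on `m × m` real symmetric matrices: the pushforward of the product
Lebesgue measure in the coordinates `(x_{ij})_{i ≤ j}` under the obvious parametrization. -/
noncomputable def symmVol (m : ℕ) : Measure (Matrix (Fin m) (Fin m) ℝ) :=
  Measure.map (fun f : {p : Fin m × Fin m // p.1 ≤ p.2} → ℝ =>
    Matrix.of fun i j => if h : i ≤ j then f ⟨(i, j), h⟩ else f ⟨(j, i), le_of_not_ge h⟩) volume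

/-- The eigenvalues of `XᵀX`, arranged in decreasing order. -/
noncomputable def sortedEigs {n m : ℕ} (X : Matrix (Fin n) (Fin m) ℝ) : Fin m → ℝ :=
  fun i =>
    ((Matrix.isHermitian_conjTranspose_mul_self X).eigenvalues ∘
      Tuple.sort (Matrix.isHermitian_conjTranspose_mul_self X).eigenvalues) (Fin.rev i)

/-- The singular values of an `n × m` real matrix, in decreasing order. -/
noncomputable def svalues {n m : ℕ} (X : Matrix (Fin n) (Fin m) ℝ) : Fin m → ℝ :=
  fun i => Real.sqrt (sortedEigs X i)

/-- The Kotz-Riesz type I density `KR^I_{n×m}(τ, μ, Θ, Σ)` (with `U = u(Σ)` the upper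
triangular Cholesky factor of `Σ`, supplied explicitly). -/
noncomputable def kotzRieszIDen (n m : ℕ) (τ : Fin m → ℝ) (μ : Matrix (Fin n) (Fin m) ℝ)
    (Θ : Matrix (Fin n) (Fin n) ℝ) (Sig U : Matrix (Fin m) (Fin m) ℝ)
    (y : Matrix (Fin n) (Fin m) ℝ) : ℝ :=
  mvGamma m ((n : ℝ) / 2) /
      (Real.pi ^ (((m * n : ℕ) : ℝ) / 2) * mvGammaI m ((n : ℝ) / 2) τ *
        Sig.det ^ ((n : ℝ) / 2) * Θ.det ^ ((m : ℝ) / 2)) *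
    Real.exp (-(Sig⁻¹ * (y - μ)ᵀ * Θ⁻¹ * (y - μ)).trace) *
    hwv τ ((Uᵀ)⁻¹ * (y - μ)ᵀ * Θ⁻¹ * (y - μ) * U⁻¹)

/-- The Kotz-Riesz type II density `KR^{II}_{n×m}(τ, μ, Θ, Σ)` (with `U = u(Σ)` the upper
triangular Cholesky factor of `Σ`, supplied explicitly). -/
noncomputable def kotzRieszIIDen (n m : ℕ) (τ : Fin m → ℝ) (μ : Matrix (Fin n) (Fin m) ℝ)
    (Θ : Matrix (Fin n) (Fin n) ℝ) (Sig U : Matrix (Fin m) (Fin m) ℝ)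
    (y : Matrix (Fin n) (Fin m) ℝ) : ℝ :=
  mvGamma m ((n : ℝ) / 2) /
      (Real.pi ^ (((m * n : ℕ) : ℝ) / 2) * mvGammaII m ((n : ℝ) / 2) τ *
        Sig.det ^ ((n : ℝ) / 2) * Θ.det ^ ((m : ℝ) / 2)) *
    Real.exp (-(Sig⁻¹ * (y - μ)ᵀ * Θ⁻¹ * (y - μ)).trace) *
    hwv τ (((Uᵀ)⁻¹ * (y - μ)ᵀ * Θ⁻¹ * (y - μ) * U⁻¹)⁻¹)

/-- The matrix multivariate T-Riesz type I density
`MTR^I(ν, k, τ, ρ, μ, Θ, Σ)` (with `U = u(Σ)` supplied explicitly). -/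
noncomputable def tRieszIDen (n m : ℕ) (ν k ρ : ℝ) (τ : Fin m → ℝ)
    (μ : Matrix (Fin n) (Fin m) ℝ) (Θ : Matrix (Fin n) (Fin n) ℝ)
    (Sig U : Matrix (Fin m) (Fin m) ℝ) (t : Matrix (Fin n) (Fin m) ℝ) : ℝ :=
  mvGamma m ((n : ℝ) / 2) * Real.Gamma ((ν + (m * n : ℕ)) / 2 + k + ∑ i, τ i) *
      ρ ^ (((m * n : ℕ) : ℝ) / 2 + ∑ i, τ i) /
      (Real.pi ^ (((m * n : ℕ) : ℝ) / 2) * mvGammaI m ((n : ℝ) / 2) τ *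
        Real.Gamma (ν / 2 + k) * Sig.det ^ ((n : ℝ) / 2) * Θ.det ^ ((m : ℝ) / 2)) *
    (1 + ρ * (Sig⁻¹ * (t - μ)ᵀ * Θ⁻¹ * (t - μ)).trace) ^
      (-((ν + (m * n : ℕ)) / 2 + k + ∑ i, τ i)) *
    hwv τ ((Uᵀ)⁻¹ * (t - μ)ᵀ * Θ⁻¹ * (t - μ) * U⁻¹)

/-- The matrix multivariate T-Riesz type II density
`MTR^{II}(ν, k, τ, ρ, μ, Θ, Σ)` (with `U = u(Σ)` supplied explicitly). -/
noncomputable def tRieszIIDen (n m : ℕ) (ν k ρ : ℝ) (τ : Fin m → ℝ)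
    (μ : Matrix (Fin n) (Fin m) ℝ) (Θ : Matrix (Fin n) (Fin n) ℝ)
    (Sig U : Matrix (Fin m) (Fin m) ℝ) (t : Matrix (Fin n) (Fin m) ℝ) : ℝ :=
  mvGamma m ((n : ℝ) / 2) * Real.Gamma ((ν + (m * n : ℕ)) / 2 - k - ∑ i, τ i) *
      ρ ^ (((m * n : ℕ) : ℝ) / 2 - ∑ i, τ i) /
      (Real.pi ^ (((m * n : ℕ) : ℝ) / 2) * mvGammaII m ((n : ℝ) / 2) τ *
        Real.Gamma (ν / 2 - k) * Sig.det ^ ((n : ℝ) / 2) * Θ.det ^ ((m : ℝ) / 2)) *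
    (1 + ρ * (Sig⁻¹ * (t - μ)ᵀ * Θ⁻¹ * (t - μ)).trace) ^
      (-((ν + (m * n : ℕ)) / 2 - k - ∑ i, τ i)) *
    hwv τ (((Uᵀ)⁻¹ * (t - μ)ᵀ * Θ⁻¹ * (t - μ) * U⁻¹)⁻¹)

/-! ### Lebesgue measure on spaces of matrices -/

abbrev RMat (n m : ℕ) := Matrix (Fin n) (Fin m) ℝ

theorem isAddHaarMeasure_volume_pi_pi (n m : ℕ) :
    (volume : Measure (Fin n → Fin m → ℝ)).IsAddHaarMeasure :=
  @Measure.pi.isAddHaarMeasure (Fin n) (fun _ => Fin m → ℝ) _ _ (fun _ => volume) _ _ _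
    (fun _ => isAddHaarMeasure_volume_pi (Fin m)) _

instance instBorelSpaceRealMatrix (n m : ℕ) : BorelSpace (Matrix (Fin n) (Fin m) ℝ) :=
  inferInstanceAs (BorelSpace (Fin n → Fin m → ℝ))

instance instSecondCountableTopologyRealMatrix (n m : ℕ) :
    SecondCountableTopology (Matrix (Fin n) (Fin m) ℝ) :=
  inferInstanceAs (SecondCountableTopology (Fin n → Fin m → ℝ))

instance instSigmaFiniteVolumeMatrix (n m : ℕ) :
    SigmaFinite (volume : Measure (Matrix (Fin n) (Fin m) ℝ)) :=
  inferInstanceAs (SigmaFinite (volume : Measure (Fin n → Fin m → ℝ)))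

instance instIsAddHaarMeasureVolumeMatrix (n m : ℕ) :
    (volume : Measure (Matrix (Fin n) (Fin m) ℝ)).IsAddHaarMeasure :=
  isAddHaarMeasure_volume_pi_pi n m

theorem lintegral_comp_linearMap {E : Type*} [NormedAddCommGroup E] [NormedSpace ℝ E]
    [MeasurableSpace E] [BorelSpace E] [FiniteDimensional ℝ E] (μ : Measure E) [μ.IsAddHaarMeasure]
    (f : E →ₗ[ℝ] E) (hf : LinearMap.det f ≠ 0) {G : E → ENNReal} (hG : Measurable G) :
    ENNReal.ofReal |LinearMap.det f| * ∫⁻ X, G (f X) ∂μ = ∫⁻ X, G X ∂μ := by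
  have h := Measure.map_linearMap_addHaar_eq_smul_addHaar (μ := μ) hf
  have hm : Measurable f := f.continuous_of_finiteDimensional.measurable
  rw [← lintegral_map hG hm, h, lintegral_smul_measure, smul_eq_mul, ← mul_assoc,
    ← ENNReal.ofReal_mul (abs_nonneg _), ← abs_mul, mul_inv_cancel₀ hf]
  simp

theorem lintegral_comp_linearMap_matrix {n m : ℕ} (f : RMat n m →ₗ[ℝ] RMat n m)
    (hf : LinearMap.det f ≠ 0) {G : RMat n m → ENNReal} (hG : Measurable G) :
    ENNReal.ofReal |LinearMap.det f| * ∫⁻ X : RMat n m, G (f X) = ∫⁻ X, G X :=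
  have := isAddHaarMeasure_volume_pi_pi n m
  lintegral_comp_linearMap (E := Fin n → Fin m → ℝ) volume f hf hG

theorem det_mulRightLinearMap {n m : ℕ} (g : RMat m m) :
    LinearMap.det (mulRightLinearMap (Fin n) ℝ g) = g.det ^ n := by
  rw [← LinearMap.det_toMatrix (Matrix.stdBasis ℝ (Fin n) (Fin m))]
  have : LinearMap.toMatrix (Matrix.stdBasis ℝ (Fin n) (Fin m))
      (Matrix.stdBasis ℝ (Fin n) (Fin m)) (mulRightLinearMap (Fin n) ℝ g) =
      kroneckerMap (· * ·) (1 : RMat n n) gᵀ := by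
    ext ⟨i, j⟩ ⟨k, l⟩
    by_cases h : i = k <;>
      simp [LinearMap.toMatrix_apply, Matrix.stdBasis, mul_apply, Pi.single_apply, h]
  rw [this, det_kronecker]
  simp

theorem det_mulLeftLinearMap {n m : ℕ} (g : RMat n n) :
    LinearMap.det (mulLeftLinearMap (Fin m) ℝ g) = g.det ^ m := by
  rw [← LinearMap.det_toMatrix (Matrix.stdBasis ℝ (Fin n) (Fin m))]
  have : LinearMap.toMatrix (Matrix.stdBasis ℝ (Fin n) (Fin m))
      (Matrix.stdBasis ℝ (Fin n) (Fin m)) (mulLeftLinearMap (Fin m) ℝ g) =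
      kroneckerMap (· * ·) g (1 : RMat m m) := by
    ext ⟨i, j⟩ ⟨k, l⟩
    by_cases h : j = l <;>
      simp [LinearMap.toMatrix_apply, Matrix.stdBasis, mul_apply, Pi.single_apply, ite_apply, h]
  rw [this, det_kronecker]
  simp

theorem lintegral_mul_right {n m : ℕ} (g : RMat m m) (hg : g.det ≠ 0)
    {G : RMat n m → ENNReal} (hG : Measurable G) :
    ENNReal.ofReal |g.det| ^ n * ∫⁻ X : RMat n m, G (X * g) = ∫⁻ X, G X := by
  have := lintegral_comp_linearMap_matrix (mulRightLinearMap (Fin n) ℝ g)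
    (by rw [det_mulRightLinearMap]; exact pow_ne_zero _ hg) hG
  simpa [det_mulRightLinearMap, abs_pow, ENNReal.ofReal_pow] using this

theorem lintegral_mul_left {n m : ℕ} (g : RMat n n) (hg : g.det ≠ 0)
    {G : RMat n m → ENNReal} (hG : Measurable G) :
    ENNReal.ofReal |g.det| ^ m * ∫⁻ X : RMat n m, G (g * X) = ∫⁻ X, G X := by
  have := lintegral_comp_linearMap_matrix (mulLeftLinearMap (Fin m) ℝ g)
    (by rw [det_mulLeftLinearMap]; exact pow_ne_zero _ hg) hG
  simpa [det_mulLeftLinearMap, abs_pow, ENNReal.ofReal_pow] using this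

/-- A measurable set of matrices that meets every line in a fixed direction in a countable set is
negligible. -/
theorem volume_eq_zero_of_countable_lines {n m : ℕ} {s : Set (RMat n m)}
    (hs : MeasurableSet s) (v : RMat n m)
    (h : ∀ Y : RMat n m, {t : ℝ | Y + t • v ∈ s}.Countable) : volume s = 0 := by
  let χ : RMat n m → ENNReal := s.indicator fun _ => 1
  have hχ : Measurable χ := measurable_const.indicator hs
  have hmeas : Measurable fun p : ℝ × RMat n m => χ (p.2 + p.1 • v) :=
    hχ.comp (by fun_prop : Continuous fun p : ℝ × RMat n m => p.2 + p.1 • v).measurable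
  have h0 : ∫⁻ Y, χ Y = volume s := by simp [χ, lintegral_indicator hs]
  have h1 : ∫⁻ t in Set.Icc (0 : ℝ) 1, ∫⁻ Y, χ (Y + t • v) = volume s := by
    have : ∀ t : ℝ, ∫⁻ Y, χ (Y + t • v) = volume s := fun t => by
      rw [lintegral_add_right_eq_self χ, h0]
    simp [this]
  rw [← h1, lintegral_lintegral_swap hmeas.aemeasurable]
  refine (lintegral_congr fun Y => ?_).trans lintegral_zero
  have hm : MeasurableSet {t : ℝ | Y + t • v ∈ s} :=
    hs.preimage (by fun_prop : Continuous fun t : ℝ => Y + t • v).measurable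
  have : (fun t : ℝ => χ (Y + t • v)) = {t : ℝ | Y + t • v ∈ s}.indicator fun _ => 1 := by
    ext t; simp [Set.indicator, χ]
  rw [this, lintegral_indicator hm]
  simp [(h Y).measure_zero]

/-! ### The orthogonal group -/

abbrev OrthGrp (m : ℕ) : Type := Matrix.orthogonalGroup (Fin m) ℝ

section OrthogonalGroup

variable {m : ℕ}

theorem mem_orthogonalGroup_iff_transpose_mul {h : RMat m m} :
    h ∈ Matrix.orthogonalGroup (Fin m) ℝ ↔ hᵀ * h = 1 := by
  rw [mem_orthogonalGroup_iff']

theorem OrthGrp.transpose_mul_self (h : OrthGrp m) : (h : RMat m m)ᵀ * (h : RMat m m) = 1 :=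
  mem_orthogonalGroup_iff_transpose_mul.1 h.2

theorem OrthGrp.mul_transpose_self (h : OrthGrp m) : (h : RMat m m) * (h : RMat m m)ᵀ = 1 :=
  mul_eq_one_comm.1 h.transpose_mul_self

theorem OrthGrp.coe_inv (h : OrthGrp m) : ((h⁻¹ : OrthGrp m) : RMat m m) = (h : RMat m m)ᵀ := by
  have : ((h⁻¹ : OrthGrp m) : RMat m m) = star (h : RMat m m) := rfl
  rw [this, star_eq_conjTranspose, conjTranspose_eq_transpose_of_trivial]

theorem OrthGrp.det_sq (h : OrthGrp m) : (h : RMat m m).det ^ 2 = 1 := by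
  have := congrArg Matrix.det h.transpose_mul_self
  rwa [det_mul, det_transpose, det_one, ← sq] at this

theorem OrthGrp.abs_det (h : OrthGrp m) : |(h : RMat m m).det| = 1 := by
  rw [← sq_eq_sq₀ (abs_nonneg _) zero_le_one, sq_abs, h.det_sq, one_pow]

theorem OrthGrp.det_ne_zero (h : OrthGrp m) : (h : RMat m m).det ≠ 0 := fun h0 => by
  have := h.abs_det
  simp [h0] at this

instance instSecondCountableTopologyOrthGrp : SecondCountableTopology (OrthGrp m) :=
  TopologicalSpace.Subtype.secondCountableTopology _

instance instCompactSpaceOrthGrp : CompactSpace (OrthGrp m) := by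
  refine isCompact_iff_compactSpace (s := {h | h ∈ Matrix.orthogonalGroup (Fin m) ℝ}).1 ?_
  have hc : IsClosed {h : RMat m m | h ∈ Matrix.orthogonalGroup (Fin m) ℝ} := by
    have : {h : RMat m m | h ∈ Matrix.orthogonalGroup (Fin m) ℝ} = {h | hᵀ * h = 1} :=
      Set.ext fun _ => mem_orthogonalGroup_iff_transpose_mul
    rw [this]
    exact isClosed_eq (by fun_prop) continuous_const
  have hp : IsCompact (Set.pi Set.univ fun _ : Fin m => Set.pi Set.univ fun _ : Fin m =>
      Set.Icc (-1 : ℝ) 1) :=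
    isCompact_univ_pi fun _ => isCompact_univ_pi fun _ => isCompact_Icc
  refine IsCompact.of_isClosed_subset hp hc fun h hh i _ j _ => ?_
  have := entry_norm_bound_of_unitary (𝕜 := ℝ) hh i j
  rw [Real.norm_eq_abs] at this
  exact abs_le.1 this

theorem isMulRightInvariant_orthGrp (νH : Measure (OrthGrp m)) [νH.IsHaarMeasure]
    [IsProbabilityMeasure νH] : νH.IsMulRightInvariant := by
  refine ⟨fun g => ?_⟩
  have h1 : (Measure.map (· * g) νH).IsHaarMeasure := inferInstance
  have h2 : IsProbabilityMeasure (Measure.map (· * g) νH) :=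
    Measure.isProbabilityMeasure_map (measurable_mul_const g).aemeasurable
  exact Measure.isHaarMeasure_eq_of_isProbabilityMeasure _ _

end OrthogonalGroup

/-! ### Triangular and skew parts of a square matrix -/

section Parts

variable {m : ℕ}

/-- The skew-symmetric matrix with the same strictly lower triangular part. -/
def skewOf (m : ℕ) : RMat m m →ₗ[ℝ] RMat m m where
  toFun Z := of fun i j => if j < i then Z i j else if i < j then -Z j i else 0
  map_add' X Y := by ext i j; simp only [of_apply, Matrix.add_apply]; split_ifs <;> ring
  map_smul' c X := by
    ext i j; simp only [of_apply, Matrix.smul_apply, smul_eq_mul, RingHom.id_apply]; split_ifs <;> ring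

/-- The strictly lower triangular part. -/
def strictLow (m : ℕ) : RMat m m →ₗ[ℝ] RMat m m where
  toFun Z := of fun i j => if j < i then Z i j else 0
  map_add' X Y := by ext i j; simp only [of_apply, Matrix.add_apply]; split_ifs <;> ring
  map_smul' c X := by
    ext i j; simp only [of_apply, Matrix.smul_apply, smul_eq_mul, RingHom.id_apply]; split_ifs <;> ring

/-- The upper triangular part, diagonal included. -/
def upTri (m : ℕ) : RMat m m →ₗ[ℝ] RMat m m where
  toFun Z := of fun i j => if i ≤ j then Z i j else 0
  map_add' X Y := by ext i j; simp only [of_apply, Matrix.add_apply]; split_ifs <;> ring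
  map_smul' c X := by
    ext i j; simp only [of_apply, Matrix.smul_apply, smul_eq_mul, RingHom.id_apply]; split_ifs <;> ring

/-- The diagonal part. -/
def diagPart (m : ℕ) : RMat m m →ₗ[ℝ] RMat m m where
  toFun Z := diagonal fun i => Z i i
  map_add' X Y := by simp [← diagonal_add]
  map_smul' c X := by simp [← diagonal_smul, Pi.smul_def]

theorem skewOf_apply (Z : RMat m m) (i j : Fin m) :
    skewOf m Z i j = if j < i then Z i j else if i < j then -Z j i else 0 := rfl

theorem strictLow_apply (Z : RMat m m) (i j : Fin m) :
    strictLow m Z i j = if j < i then Z i j else 0 := rfl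

theorem upTri_apply (Z : RMat m m) (i j : Fin m) :
    upTri m Z i j = if i ≤ j then Z i j else 0 := rfl

theorem diagPart_apply (Z : RMat m m) : diagPart m Z = diagonal fun i => Z i i := rfl

theorem strictLow_add_upTri (Z : RMat m m) : strictLow m Z + upTri m Z = Z := by
  ext i j
  rw [Matrix.add_apply, strictLow_apply, upTri_apply]
  split_ifs <;> first | (exfalso; omega) | simp

theorem skewOf_transpose (Z : RMat m m) : (skewOf m Z)ᵀ = -skewOf m Z := by
  ext i j
  rw [transpose_apply, Matrix.neg_apply, skewOf_apply, skewOf_apply]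
  split_ifs <;> first | (exfalso; omega) | simp

theorem skewOf_eq_self {X : RMat m m} (hX : Xᵀ = -X) : skewOf m X = X := by
  ext i j
  have h : ∀ i j, X j i = -X i j := fun i j => congrFun (congrFun hX i) j
  rw [skewOf_apply]
  split_ifs with h1 h2
  · rfl
  · rw [h]; simp
  · obtain rfl : i = j := by omega
    linarith [h i i]

theorem skewOf_strictLow (Z : RMat m m) : skewOf m (strictLow m Z) = skewOf m Z := by
  ext i j
  simp only [skewOf_apply, strictLow_apply]
  split_ifs <;> rfl

theorem skewOf_upTri (Z : RMat m m) : skewOf m (upTri m Z) = 0 := by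
  ext i j
  simp only [skewOf_apply, upTri_apply, Matrix.zero_apply]
  split_ifs <;> first | (exfalso; omega) | simp

theorem upTri_strictLow (Z : RMat m m) : upTri m (strictLow m Z) = 0 := by
  ext i j
  simp only [upTri_apply, strictLow_apply, Matrix.zero_apply]
  split_ifs <;> first | rfl | (exfalso; omega)

theorem upTri_upTri (Z : RMat m m) : upTri m (upTri m Z) = upTri m Z := by
  ext i j
  simp only [upTri_apply]
  split_ifs <;> rfl

theorem strictLow_skewOf (Z : RMat m m) : strictLow m (skewOf m Z) = strictLow m Z := by
  ext i j
  simp only [strictLow_apply, skewOf_apply]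
  split_ifs <;> rfl

end Parts

/-! ### The Cayley transform -/

section Cayley

variable {m : ℕ}

theorem det_one_sub_ne_zero_of_skew {A : RMat m m} (hA : Aᵀ = -A) : (1 - A).det ≠ 0 := by
  intro h0
  obtain ⟨x, hx, hx0⟩ := exists_mulVec_eq_zero_iff.2 h0
  have h1 : A *ᵥ x = x := by
    rw [sub_mulVec, one_mulVec, sub_eq_zero] at hx0
    exact hx0.symm
  have h2 : x ⬝ᵥ A *ᵥ x = -(x ⬝ᵥ A *ᵥ x) := by
    conv_lhs => rw [dotProduct_mulVec, ← mulVec_transpose, hA, neg_mulVec, neg_dotProduct,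
      dotProduct_comm]
  rw [h1] at h2
  exact hx (dotProduct_self_eq_zero.1 (by linarith))

/-- The Cayley transform. -/
noncomputable def cayley (A : RMat m m) : RMat m m := (2 : ℝ) • (1 - A)⁻¹ - 1

theorem cayley_mul_one_sub {A : RMat m m} (hA : Aᵀ = -A) : cayley A * (1 - A) = 1 + A := by
  have h := nonsing_inv_mul (1 - A) (det_one_sub_ne_zero_of_skew hA).isUnit
  rw [cayley, sub_mul, smul_mul_assoc, h, one_mul, two_smul]
  abel

theorem one_add_cayley (A : RMat m m) : 1 + cayley A = (2 : ℝ) • (1 - A)⁻¹ := by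
  rw [cayley]; abel

theorem det_one_add_cayley_ne_zero {A : RMat m m} (hA : Aᵀ = -A) : (1 + cayley A).det ≠ 0 := by
  rw [one_add_cayley, det_smul]
  refine mul_ne_zero (by positivity) ?_
  rw [det_nonsing_inv, Ring.inverse_eq_inv']
  exact inv_ne_zero (det_one_sub_ne_zero_of_skew hA)

theorem cayley_injOn : Set.InjOn (cayley (m := m)) {A | Aᵀ = -A} := by
  intro A hA B hB h
  have h1 : (1 - A)⁻¹ = (1 - B)⁻¹ := by
    have : (2 : ℝ) • (1 - A)⁻¹ = (2 : ℝ) • (1 - B)⁻¹ := by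
      rw [← one_add_cayley, ← one_add_cayley, h]
    exact smul_right_injective _ (two_ne_zero' ℝ) this
  have h2 := nonsing_inv_nonsing_inv (1 - A) (det_one_sub_ne_zero_of_skew hA).isUnit
  rw [h1, nonsing_inv_nonsing_inv _ (det_one_sub_ne_zero_of_skew hB).isUnit] at h2
  exact (sub_right_injective h2).symm

theorem transpose_inv_one_sub {A : RMat m m} (hA : Aᵀ = -A) : ((1 - A)⁻¹)ᵀ = (1 + A)⁻¹ := by
  rw [transpose_nonsing_inv, transpose_sub, transpose_one, hA, sub_neg_eq_add]

theorem cayley_orth {A : RMat m m} (hA : Aᵀ = -A) : (cayley A)ᵀ * cayley A = 1 := by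
  have hA' : (-A)ᵀ = -(-A) := by rw [transpose_neg, hA]
  have hd := det_one_sub_ne_zero_of_skew hA
  have hd' : (1 + A).det ≠ 0 := by
    simpa using det_one_sub_ne_zero_of_skew hA'
  have h1 := cayley_mul_one_sub hA
  have h2 := congrArg transpose h1
  rw [transpose_mul, transpose_sub, transpose_add, transpose_one, hA, sub_neg_eq_add,
    ← sub_eq_add_neg] at h2
  have hu : IsUnit (1 - A) := (isUnit_iff_isUnit_det _).2 hd.isUnit
  have hu' : IsUnit (1 + A) := (isUnit_iff_isUnit_det _).2 hd'.isUnit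
  apply hu.mul_right_cancel
  apply hu'.mul_left_cancel
  rw [mul_assoc, h1, ← mul_assoc, h2]
  noncomm_ring

/-- Every orthogonal matrix without eigenvalue `-1` is a Cayley transform. -/
theorem exists_cayley_eq {h : RMat m m} (hh : hᵀ * h = 1) (hd : (1 + h).det ≠ 0) :
    ∃ A : RMat m m, Aᵀ = -A ∧ cayley A = h := by
  have hdu : IsUnit (1 + h).det := hd.isUnit
  have hcancel := mul_nonsing_inv (1 + h) hdu
  have hcancel' := nonsing_inv_mul (1 + h) hdu
  have hu : IsUnit (1 + h) := (isUnit_iff_isUnit_det _).2 hdu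
  refine ⟨1 - (2 : ℝ) • (1 + h)⁻¹, ?_, ?_⟩
  · have hh' : h * hᵀ = 1 := mul_eq_one_comm.1 hh
    have h3 : ((1 + h)⁻¹)ᵀ + (1 + h)⁻¹ = 1 := by
      have hut : IsUnit (1 + h)ᵀ := by
        rw [isUnit_iff_isUnit_det, det_transpose]; exact hdu
      apply hu.mul_right_cancel
      apply hut.mul_left_cancel
      have e1 : (1 + h)ᵀ * ((1 + h)⁻¹)ᵀ = 1 := by
        rw [← transpose_mul, hcancel', transpose_one]
      rw [add_mul, hcancel', mul_add, ← mul_assoc, e1, one_mul, mul_one, transpose_add,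
        transpose_one, add_mul, mul_add, mul_add, hh]
      simp; abel
    rw [transpose_sub, transpose_smul, transpose_one, eq_sub_of_add_eq h3, smul_sub, two_smul]
    abel
  · rw [cayley, sub_sub_cancel]
    have : ((2 : ℝ) • (1 + h)⁻¹)⁻¹ = (2⁻¹ : ℝ) • (1 + h) := by
      apply inv_eq_left_inv
      rw [smul_mul_smul_comm, hcancel]
      norm_num
    rw [this, smul_smul]
    norm_num

end Cayley

/-! ### Derivatives of matrix-valued maps and change of variables -/

section Derivatives

variable {m : ℕ}

theorem exists_hasFDerivAt_matrix_mul {f g : RMat m m → RMat m m}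
    {f' g' : RMat m m →L[ℝ] RMat m m} {x : RMat m m}
    (hf : HasFDerivAt f f' x) (hg : HasFDerivAt g g' x) :
    ∃ L : RMat m m →L[ℝ] RMat m m, (∀ V, L V = f x * g' V + f' V * g x) ∧
      HasFDerivAt (fun y => f y * g y) L x := by
  let _ := Matrix.linftyOpNormedRing (n := Fin m) (α := ℝ)
  let _ := Matrix.linftyOpNormedAlgebra (n := Fin m) (R := ℝ) (α := ℝ)
  exact ⟨_, fun V => rfl, HasFDerivAt.mul' (𝕜 := ℝ) hf hg⟩

theorem exists_hasFDerivAt_inv {x : RMat m m} (hx : x.det ≠ 0) :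
    ∃ L : RMat m m →L[ℝ] RMat m m, (∀ V, L V = -(x⁻¹ * V * x⁻¹)) ∧
      HasFDerivAt (fun y : RMat m m => y⁻¹) L x := by
  let _ := Matrix.linftyOpNormedRing (n := Fin m) (α := ℝ)
  let _ := Matrix.linftyOpNormedAlgebra (n := Fin m) (R := ℝ) (α := ℝ)
  have hu : IsUnit x := (isUnit_iff_isUnit_det _).2 hx.isUnit
  have h := hasFDerivAt_ringInverse (𝕜 := ℝ) hu.unit
  have e : (fun y : RMat m m => y⁻¹) = Ring.inverse := by
    ext1 y; exact nonsing_inv_eq_ringInverse y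
  have e2 : ((hu.unit⁻¹ : (RMat m m)ˣ) : RMat m m) = x⁻¹ := by
    rw [coe_units_inv]; rfl
  refine ⟨-ContinuousLinearMap.mulLeftRight ℝ (RMat m m) ↑(hu.unit⁻¹) ↑(hu.unit⁻¹),
    fun V => ?_, ?_⟩
  · change -(((hu.unit⁻¹ : (RMat m m)ˣ) : RMat m m) * V * ((hu.unit⁻¹ : (RMat m m)ˣ) : RMat m m)) = _
    rw [e2]
  · rw [e]; exact h

theorem hasFDerivAt_matrix_linearMap (f : RMat m m →ₗ[ℝ] RMat m m) (x : RMat m m) :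
    HasFDerivAt f (LinearMap.toContinuousLinearMap f) x :=
  ContinuousLinearMap.hasFDerivAt (LinearMap.toContinuousLinearMap f)

theorem lintegral_image_matrix {s : Set (RMat m m)} (hs : MeasurableSet s)
    {f : RMat m m → RMat m m} {f' : RMat m m → RMat m m →L[ℝ] RMat m m}
    (hf' : ∀ x ∈ s, HasFDerivAt f (f' x) x) (hf : Set.InjOn f s) (g : RMat m m → ENNReal) :
    ∫⁻ x in f '' s, g x = ∫⁻ x in s, ENNReal.ofReal |LinearMap.det (f' x : RMat m m →ₗ[ℝ] RMat m m)| * g (f x) :=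
  have := isAddHaarMeasure_volume_pi_pi m m
  lintegral_image_eq_lintegral_abs_det_fderiv_mul (E := Fin m → Fin m → ℝ) volume hs
    (fun x hx => (hf' x hx).hasFDerivWithinAt) hf g

theorem measurableSet_image_matrix {s : Set (RMat m m)} (hs : MeasurableSet s)
    {f : RMat m m → RMat m m} {f' : RMat m m → RMat m m →L[ℝ] RMat m m}
    (hf' : ∀ x ∈ s, HasFDerivAt f (f' x) x) (hf : Set.InjOn f s) : MeasurableSet (f '' s) :=
  measurable_image_of_fderivWithin (E := Fin m → Fin m → ℝ) hs
    (fun x hx => (hf' x hx).hasFDerivWithinAt) hf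

/-- The derivative of the Cayley transform at `A`, left-translated to the identity. -/
noncomputable def cayleyForm (A : RMat m m) : RMat m m →ₗ[ℝ] RMat m m where
  toFun H := (2 : ℝ) • (((1 - A)⁻¹)ᵀ * H * (1 - A)⁻¹)
  map_add' X Y := by rw [mul_add, add_mul, smul_add]
  map_smul' c X := by
    rw [mul_smul_comm, smul_mul_assoc, smul_comm]; rfl

theorem cayleyForm_apply (A H : RMat m m) :
    cayleyForm A H = (2 : ℝ) • (((1 - A)⁻¹)ᵀ * H * (1 - A)⁻¹) := rfl

theorem cayleyForm_skew (A : RMat m m) {H : RMat m m} (hH : Hᵀ = -H) :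
    (cayleyForm A H)ᵀ = -cayleyForm A H := by
  rw [cayleyForm_apply, transpose_smul, transpose_mul, transpose_mul, hH, transpose_transpose,
    neg_mul, mul_neg, smul_neg, mul_assoc]

theorem exists_hasFDerivAt_cayley {A : RMat m m} (hA : Aᵀ = -A) :
    ∃ L : RMat m m →L[ℝ] RMat m m, (∀ V, L V = cayley A * cayleyForm A V) ∧
      HasFDerivAt cayley L A := by
  have hd := det_one_sub_ne_zero_of_skew hA
  obtain ⟨L, hL, hD⟩ := exists_hasFDerivAt_inv hd
  have h1 : HasFDerivAt (fun A : RMat m m => 1 - A) (-ContinuousLinearMap.id ℝ (RMat m m)) A := by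
    let _ := Matrix.linftyOpNormedRing (n := Fin m) (α := ℝ)
    let _ := Matrix.linftyOpNormedAlgebra (n := Fin m) (R := ℝ) (α := ℝ)
    exact (hasFDerivAt_id (𝕜 := ℝ) A).const_sub (1 : RMat m m)
  have h2 : HasFDerivAt cayley ((2 : ℝ) • L.comp (-ContinuousLinearMap.id ℝ (RMat m m))) A := by
    let _ := Matrix.linftyOpNormedRing (n := Fin m) (α := ℝ)
    let _ := Matrix.linftyOpNormedAlgebra (n := Fin m) (R := ℝ) (α := ℝ)
    exact ((HasFDerivAt.comp (𝕜 := ℝ) A hD h1).const_smul (2 : ℝ)).sub_const (1 : RMat m m)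
  refine ⟨_, fun V => ?_, h2⟩
  have h3 : cayley A * ((1 - A)⁻¹)ᵀ = (1 - A)⁻¹ := by
    have hA' : (-A)ᵀ = -(-A) := by rw [transpose_neg, hA]
    have hd' : (1 + A).det ≠ 0 := by simpa using det_one_sub_ne_zero_of_skew hA'
    have h4 : cayley A = (1 - A)⁻¹ * (1 + A) := by
      have : (1 + A) = (2 : ℝ) • (1 : RMat m m) - (1 - A) := by rw [two_smul]; abel
      rw [this, mul_sub, nonsing_inv_mul _ hd.isUnit, mul_smul_comm, mul_one, cayley]
    rw [transpose_inv_one_sub hA, h4, mul_assoc, mul_nonsing_inv _ hd'.isUnit, mul_one]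
  change (2 : ℝ) • L (-V) = _
  rw [hL, cayleyForm_apply, mul_smul_comm, ← mul_assoc, ← mul_assoc, h3, mul_neg, neg_mul, neg_neg]

end Derivatives

/-! ### Determinants of triangular linear maps on matrices -/

section Determinants

variable {m : ℕ}

/-- A linear endomorphism that is triangular for the ranking `b` of the entries has determinant the
product of its diagonal coefficients. -/
theorem det_of_triangular (f : RMat m m →ₗ[ℝ] RMat m m) (b : Fin m × Fin m → ℕ)
    (d : Fin m × Fin m → ℝ)
    (h : ∀ V p, (∀ q : Fin m × Fin m, b q < b p → V q.1 q.2 = 0) → f V p.1 p.2 = d p * V p.1 p.2) :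
    LinearMap.det f = ∏ p, d p := by
  rw [← LinearMap.det_toMatrix (Matrix.stdBasis ℝ (Fin m) (Fin m))]
  set M := LinearMap.toMatrix (Matrix.stdBasis ℝ (Fin m) (Fin m))
      (Matrix.stdBasis ℝ (Fin m) (Fin m)) f with hM
  have hent : ∀ p q, M p q = f (Matrix.single q.1 q.2 1) p.1 p.2 := by
    rintro ⟨i, j⟩ ⟨k, l⟩
    simp only [hM, LinearMap.toMatrix_apply, stdBasis_eq_single]
    simp [Matrix.stdBasis]
  have hle : ∀ p q, b p ≤ b q → M p q = if p = q then d p else 0 := by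
    intro p q hpq
    rw [hent, h _ p]
    · by_cases e : p = q
      · subst e; simp
      · have : ¬ (q.1 = p.1 ∧ q.2 = p.2) := fun hh => e (Prod.ext hh.1.symm hh.2.symm)
        simp [e, this]
    · intro r hr
      have : ¬ (q.1 = r.1 ∧ q.2 = r.2) := fun hh => by
        have : q = r := Prod.ext hh.1 hh.2
        subst this; omega
      simp [this]
  have hT : BlockTriangular Mᵀ b := fun p q hqp => by
    rw [transpose_apply, hle q p hqp.le, if_neg]
    rintro rfl; omega
  rw [← det_transpose, hT.det]
  have hblock : ∀ a, (Mᵀ.toSquareBlock b a).det = ∏ p : {p // b p = a}, d p := by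
    intro a
    have : Mᵀ.toSquareBlock b a = diagonal fun p : {p // b p = a} => d p := by
      ext p q
      rw [toSquareBlock_def, of_apply, transpose_apply, hle _ _ (by rw [p.2, q.2]), diagonal_apply]
      by_cases e : p = q
      · subst e; simp
      · have : (q : Fin m × Fin m) ≠ p := fun hh => e (Subtype.ext hh.symm)
        simp [e, this]
    rw [this, det_diagonal]
  simp_rw [hblock]
  rw [← Finset.prod_fiberwise_of_maps_to (g := b) (t := Finset.univ.image b)
    (fun p _ => Finset.mem_image_of_mem b (Finset.mem_univ p))]
  refine Finset.prod_congr rfl fun a _ => ?_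
  rw [Finset.prod_subtype (Finset.univ.filter fun p => b p = a) (p := fun p => b p = a) (by simp)]

/-- The strictly lower part of the linearised Cayley transform, completed by the identity. -/
noncomputable def cayleyLow (A : RMat m m) : RMat m m →ₗ[ℝ] RMat m m :=
  strictLow m ∘ₗ cayleyForm A ∘ₗ skewOf m + upTri m

theorem cayleyLow_apply (A V : RMat m m) :
    cayleyLow A V = strictLow m (cayleyForm A (skewOf m V)) + upTri m V := rfl

theorem skewOf_cayleyLow (A V : RMat m m) :
    skewOf m (cayleyLow A V) = cayleyForm A (skewOf m V) := by
  rw [cayleyLow_apply, map_add, skewOf_strictLow, skewOf_upTri, add_zero,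
    skewOf_eq_self (cayleyForm_skew A (skewOf_transpose V))]

theorem upTri_cayleyLow (A V : RMat m m) : upTri m (cayleyLow A V) = upTri m V := by
  rw [cayleyLow_apply, map_add, upTri_strictLow, upTri_upTri, zero_add]

/-- Linearisation of `(h, R) ↦ h R` at the identity in the first variable. -/
noncomputable def qrForm (R : RMat m m) : RMat m m →ₗ[ℝ] RMat m m :=
  mulRightLinearMap (Fin m) ℝ R ∘ₗ skewOf m + upTri m

theorem qrForm_apply (R V : RMat m m) : qrForm R V = skewOf m V * R + upTri m V := rfl

theorem det_qrForm {R : RMat m m} (hR : ∀ i j, j < i → R i j = 0) :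
    LinearMap.det (qrForm R) = ∏ j : Fin m, R j j ^ (m - 1 - (j : ℕ)) := by
  rw [det_of_triangular (qrForm R) (fun p => if p.2 < p.1 then (p.2 : ℕ) else m)
    (fun p => if p.2 < p.1 then R p.2 p.2 else 1)]
  · rw [Fintype.prod_prod_type_right]
    refine Finset.prod_congr rfl fun j _ => ?_
    simp only [Finset.prod_ite, Finset.prod_const, one_pow, mul_one]
    congr 1
    have : (Finset.univ.filter fun i : Fin m => j < i) = Finset.Ioi j := by ext; simp
    rw [this, Fin.card_Ioi]
  · rintro V ⟨i, j⟩ hV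
    simp only at hV ⊢
    rw [qrForm_apply, Matrix.add_apply, mul_apply]
    by_cases hij : j < i
    · have hup : upTri m V i j = 0 := by rw [upTri_apply, if_neg (not_le.2 hij)]
      rw [hup, add_zero, if_pos hij, Finset.sum_eq_single j, skewOf_apply, if_pos hij, mul_comm]
      · intro l _ hl
        rcases lt_or_gt_of_ne hl with h | h
        · have h0 := hV (i, l) (by
            simp only [if_pos hij, if_pos (h.trans hij)]
            exact h)
          rw [skewOf_apply, if_pos (h.trans hij), h0, zero_mul]
        · rw [hR l j h, mul_zero]
      · simp
    · have hlow : skewOf m V = 0 := by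
        ext k l
        rw [skewOf_apply, Matrix.zero_apply]
        split_ifs with h1 h2
        · exact hV (k, l) (by simp only [if_pos h1, if_neg hij]; omega)
        · rw [hV (l, k) (by simp only [if_pos h2, if_neg hij]; omega), neg_zero]
        · rfl
      simp [hlow, if_neg hij, upTri_apply, not_lt.1 hij]

/-- The transposition of matrices as a linear endomorphism. -/
def transposeLM (m : ℕ) : RMat m m →ₗ[ℝ] RMat m m where
  toFun Z := Zᵀ
  map_add' X Y := transpose_add X Y
  map_smul' c X := transpose_smul c X

theorem det_conj_involution {σ f : RMat m m →ₗ[ℝ] RMat m m} (hσ : ∀ V, σ (σ V) = V) :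
    LinearMap.det (σ ∘ₗ f ∘ₗ σ) = LinearMap.det f := by
  have h1 : LinearMap.det σ * LinearMap.det σ = 1 := by
    rw [← LinearMap.det_comp, show σ ∘ₗ σ = LinearMap.id from LinearMap.ext hσ, LinearMap.det_id]
  rw [LinearMap.det_comp, LinearMap.det_comp, mul_comm (LinearMap.det f), ← mul_assoc, h1, one_mul]

/-- Linearisation of `(h, D, k) ↦ h D kᵀ` at the identity in the orthogonal variables. -/
noncomputable def svdForm (α : Fin m → ℝ) : RMat m m →ₗ[ℝ] RMat m m :=
  mulRightLinearMap (Fin m) ℝ (diagonal α) ∘ₗ skewOf m + diagPart m -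
    mulLeftLinearMap (Fin m) ℝ (diagonal α) ∘ₗ skewOf m ∘ₗ transposeLM m

theorem svdForm_apply (α : Fin m → ℝ) (V : RMat m m) :
    svdForm α V = skewOf m V * diagonal α + diagPart m V - diagonal α * skewOf m Vᵀ := rfl

theorem abs_det_svdForm {α : Fin m → ℝ} :
    |LinearMap.det (svdForm α)| = |∏ i : Fin m, ∏ j ∈ Finset.Ioi i, (α i ^ 2 - α j ^ 2)| := by
  let σ : RMat m m →ₗ[ℝ] RMat m m := upTri m - strictLow m
  have hσ : ∀ (V : RMat m m) i j, σ V i j = if j < i then -V i j else V i j := by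
    intro V i j
    change upTri m V i j - strictLow m V i j = _
    rw [upTri_apply, strictLow_apply]
    split_ifs <;> first | (exfalso; omega) | simp
  have hσσ : ∀ V, σ (σ V) = V := by
    intro V; ext i j
    rw [hσ, hσ]
    split_ifs <;> simp
  have hK : ∀ (V : RMat m m) i j, svdForm α V i j =
      if j < i then V i j * α j - α i * V j i
      else if i < j then -V j i * α j + α i * V i j else V i j := by
    intro V i j
    rw [svdForm_apply, Matrix.sub_apply, Matrix.add_apply, mul_diagonal, diagonal_mul,
      skewOf_apply, skewOf_apply, diagPart_apply, diagonal_apply]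
    split_ifs with h1 h2 h3 h4 h5 <;> first | (exfalso; omega) | (simp [transpose_apply]; done) | skip
    subst h5; simp
  let u : Fin m × Fin m → ℝ := fun p => if p.1 < p.2 then α p.1 ^ 2 - α p.2 ^ 2 else 1
  have hu : ∏ p, u p = ∏ i : Fin m, ∏ j ∈ Finset.Ioi i, (α i ^ 2 - α j ^ 2) := by
    rw [Fintype.prod_prod_type]
    refine Finset.prod_congr rfl fun i _ => ?_
    have : (Finset.univ.filter fun j : Fin m => i < j) = Finset.Ioi i := by ext; simp
    rw [← this, Finset.prod_filter]
  have hprod : LinearMap.det (svdForm α) * LinearMap.det (svdForm α) =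
      (∏ i : Fin m, ∏ j ∈ Finset.Ioi i, (α i ^ 2 - α j ^ 2)) *
        ∏ i : Fin m, ∏ j ∈ Finset.Ioi i, (α i ^ 2 - α j ^ 2) := by
    have hdet : LinearMap.det (svdForm α) * LinearMap.det (svdForm α) =
        LinearMap.det (svdForm α ∘ₗ σ ∘ₗ svdForm α ∘ₗ σ) := by
      rw [LinearMap.det_comp, det_conj_involution hσσ]
    rw [hdet, det_of_triangular _ (fun _ => 0) (fun p => u p * u p.swap), Finset.prod_mul_distrib,
      show ∏ p : Fin m × Fin m, u p.swap = ∏ p, u p from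
        (Equiv.prodComm (Fin m) (Fin m)).prod_comp u, hu]
    rintro V ⟨i, j⟩ -
    change svdForm α (σ (svdForm α (σ V))) i j = _
    rw [hK, hσ, hσ, hK, hK]
    simp only [hσ, u, Prod.swap]
    split_ifs <;> first | (exfalso; omega) | ring
  rw [← sq_eq_sq₀ (abs_nonneg _) (abs_nonneg _), sq_abs, sq_abs, sq, sq, hprod]

end Determinants

/-! ### Matrix decompositions -/

section Decompositions

variable {n m : ℕ}

theorem antitone_eq_of_prod_X_sub_C_eq {f g : Fin m → ℝ} (hf : Antitone f) (hg : Antitone g)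
    (h : ∏ i, (Polynomial.X - Polynomial.C (f i)) = ∏ i, (Polynomial.X - Polynomial.C (g i))) :
    f = g := by
  have hr : ∀ e : Fin m → ℝ, (∏ i, (Polynomial.X - Polynomial.C (e i))).roots =
      (List.ofFn e : Multiset ℝ) := fun e => by
    have : ∏ i, (Polynomial.X - Polynomial.C (e i)) =
        ((Finset.univ.val.map e).map fun a => Polynomial.X - Polynomial.C a).prod := by
      rw [Multiset.map_map]; rfl
    rw [this, Polynomial.roots_multiset_prod_X_sub_C, List.ofFn_eq_map, ← Multiset.map_coe,
      Fin.univ_val_map, List.ofFn_eq_map]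
    rfl
  have hp : (List.ofFn f).Perm (List.ofFn g) := by
    rw [← Multiset.coe_eq_coe, ← hr, ← hr, h]
  exact List.ofFn_injective (hp.eq_of_sortedGE hf.sortedGE_ofFn hg.sortedGE_ofFn)

theorem sortedEigs_antitone (X : RMat n m) : Antitone (sortedEigs X) := fun _ _ hij =>
  Tuple.monotone_sort (Matrix.isHermitian_conjTranspose_mul_self X).eigenvalues
    (Fin.rev_le_rev.2 hij)

theorem sortedEigs_nonneg (X : RMat n m) (i : Fin m) : 0 ≤ sortedEigs X i :=
  (posSemidef_conjTranspose_mul_self X).eigenvalues_nonneg _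

theorem exists_orth_diagonal (X : RMat n m) :
    ∃ k : OrthGrp m, Xᵀ * X = (k : RMat m m) * diagonal (sortedEigs X) * (k : RMat m m)ᵀ := by
  let hS := Matrix.isHermitian_conjTranspose_mul_self X
  let e : Equiv.Perm (Fin m) := Fin.revPerm.trans (Tuple.sort hS.eigenvalues)
  let Q : RMat m m := (hS.eigenvectorUnitary : RMat m m)
  have hQ : Qᵀ * Q = 1 := mem_orthogonalGroup_iff_transpose_mul.1 hS.eigenvectorUnitary.2
  have hsp : Xᵀ * X = Q * diagonal hS.eigenvalues * Qᵀ := hS.spectral_theorem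
  refine ⟨⟨Q.submatrix id e, mem_orthogonalGroup_iff_transpose_mul.2 ?_⟩, ?_⟩
  · rw [transpose_submatrix, ← submatrix_mul _ _ _ _ _ Function.bijective_id, hQ, submatrix_one_equiv]
  · rw [hsp]
    have hd : diagonal (sortedEigs X) = (diagonal hS.eigenvalues).submatrix e e := by
      rw [submatrix_diagonal_equiv]; rfl
    change _ = Q.submatrix id e * diagonal (sortedEigs X) * (Q.submatrix id e)ᵀ
    rw [hd, transpose_submatrix, submatrix_mul_equiv, submatrix_mul_equiv, submatrix_id_id]

/-- Upper triangular with positive diagonal. -/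
def IsPosTri (R : RMat m m) : Prop := (∀ i j, j < i → R i j = 0) ∧ ∀ i, 0 < R i i

theorem IsPosTri.det_pos {R : RMat m m} (hR : IsPosTri R) : 0 < R.det := by
  rw [det_of_isUpperTriangular (fun i j h => hR.1 i j h)]
  exact Finset.prod_pos fun i _ => hR.2 i

theorem exists_qr {Y : RMat m m} (hY : Y.det ≠ 0) :
    ∃ (h : OrthGrp m) (R : RMat m m), IsPosTri R ∧ Y = (h : RMat m m) * R := by
  have hS : (Yᴴ * Y).PosDef := by
    refine PosDef.conjTranspose_mul_self _ ?_
    exact mulVec_injective_iff_isUnit.2 ((isUnit_iff_isUnit_det _).2 hY.isUnit)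
  let V : RMat m m := (LDL.lowerInv hS)ᵀ
  have hVu : IsUnit V := by
    rw [isUnit_iff_isUnit_det, det_transpose, ← isUnit_iff_isUnit_det]
    exact isUnit_of_invertible _
  have hVi : Invertible V := hVu.invertible
  have hVtri : V.IsUpperTriangular := fun i j hij => LDL.lowerInv_triangular hS hij
  have hVinv : (V⁻¹).IsUpperTriangular := blockTriangular_inv_of_blockTriangular hVtri
  let d : Fin m → ℝ := LDL.diagEntries hS
  have hD : diagonal d = Vᵀ * (Yᵀ * Y) * V := LDL.diag_eq_lowerInv_conj hS
  have hd : ∀ i, 0 < d i := by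
    have : (diagonal d).PosDef := by
      rw [hD]
      exact hS.conjTranspose_mul_mul_same (mulVec_injective_iff_isUnit.2 hVu)
    exact posDef_diagonal_iff.1 this
  let R₁ : RMat m m := diagonal (fun i => √(d i)) * V⁻¹
  have hR₁ : R₁.IsUpperTriangular := (blockTriangular_diagonal _).mul hVinv
  have hR₁diag : ∀ i, R₁ i i ≠ 0 := by
    have h0 : R₁.det ≠ 0 := by
      rw [det_mul, det_diagonal]
      exact mul_ne_zero (Finset.prod_ne_zero_iff.2 fun i _ => (Real.sqrt_pos.2 (hd i)).ne')
        ((isUnit_iff_isUnit_det _).1 (by simpa using hVu)).ne_zero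
    rw [det_of_isUpperTriangular hR₁] at h0
    exact fun i => Finset.prod_ne_zero_iff.1 h0 i (Finset.mem_univ i)
  let ε : Fin m → ℝ := fun i => SignType.sign (R₁ i i)
  have hε : ∀ i, ε i * ε i = 1 := fun i => by
    rcases lt_or_gt_of_ne (hR₁diag i) with h | h <;> simp [ε, h]
  let Q : RMat m m := Y * V * diagonal (fun i => (√(d i))⁻¹)
  have hQ : Qᵀ * Q = 1 := by
    have : Qᵀ * Q = diagonal (fun i => (√(d i))⁻¹) * (Vᵀ * (Yᵀ * Y) * V) *
        diagonal (fun i => (√(d i))⁻¹) := by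
      simp only [Q, transpose_mul, diagonal_transpose, mul_assoc]
    rw [this, ← hD, diagonal_mul_diagonal, diagonal_mul_diagonal, ← diagonal_one]
    congr 1; ext i
    have := (Real.sqrt_pos.2 (hd i)).ne'
    have h2 := Real.mul_self_sqrt (hd i).le
    field_simp
    rw [sq, h2]
  have hεε : diagonal ε * diagonal ε = (1 : RMat m m) := by
    rw [diagonal_mul_diagonal, ← diagonal_one]; congr 1; ext i; exact hε i
  refine ⟨⟨Q * diagonal ε, mem_orthogonalGroup_iff_transpose_mul.2 ?_⟩, diagonal ε * R₁, ⟨?_, ?_⟩, ?_⟩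
  · rw [transpose_mul, diagonal_transpose, mul_assoc, ← mul_assoc Qᵀ, hQ, one_mul, hεε]
  · intro i j hij
    rw [diagonal_mul, hR₁ hij, mul_zero]
  · intro i
    rw [diagonal_mul]
    rcases lt_or_gt_of_ne (hR₁diag i) with h | h <;> simp [ε, h]
  · have h1 : diagonal (fun i => (√(d i))⁻¹) * diagonal (fun i => √(d i)) = (1 : RMat m m) := by
      rw [diagonal_mul_diagonal, ← diagonal_one]; congr 1; ext i
      exact inv_mul_cancel₀ (Real.sqrt_pos.2 (hd i)).ne'
    calc Y = Y * (V * V⁻¹) := by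
          rw [mul_nonsing_inv _ ((isUnit_iff_isUnit_det _).1 hVu), mul_one]
      _ = Y * V * (diagonal (fun i => (√(d i))⁻¹) * diagonal (fun i => √(d i))) * V⁻¹ := by
          rw [h1, mul_one, mul_assoc]
      _ = Q * R₁ := by simp only [Q, R₁, mul_assoc]
      _ = Q * (diagonal ε * diagonal ε) * R₁ := by rw [hεε, mul_one]
      _ = Q * diagonal ε * (diagonal ε * R₁) := by simp only [mul_assoc]

theorem qr_unique {h h' : OrthGrp m} {R R' : RMat m m} (hR : IsPosTri R) (hR' : IsPosTri R')
    (e : (h : RMat m m) * R = (h' : RMat m m) * R') : h = h' ∧ R = R' := by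
  let g : RMat m m := (h' : RMat m m)ᵀ * (h : RMat m m)
  have hRi : Invertible R := ((isUnit_iff_isUnit_det _).2 hR.det_pos.ne'.isUnit).invertible
  have hR'i : Invertible R' := ((isUnit_iff_isUnit_det _).2 hR'.det_pos.ne'.isUnit).invertible
  have hgR : g * R = R' := by
    rw [mul_assoc, e, ← mul_assoc, h'.transpose_mul_self, one_mul]
  have hgR' : gᵀ * R' = R := by
    rw [transpose_mul, transpose_transpose, mul_assoc, ← e, ← mul_assoc, h.transpose_mul_self,
      one_mul]
  have hRt : R.IsUpperTriangular := fun i j hij => hR.1 i j hij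
  have hR't : R'.IsUpperTriangular := fun i j hij => hR'.1 i j hij
  have hg : g.IsUpperTriangular := by
    rw [show g = R' * R⁻¹ by rw [← hgR, mul_assoc, mul_inv_of_invertible, mul_one]]
    exact hR't.mul (blockTriangular_inv_of_blockTriangular hRt)
  have hg' : gᵀ.IsUpperTriangular := by
    rw [show gᵀ = R * R'⁻¹ by rw [← hgR', mul_assoc, mul_inv_of_invertible, mul_one]]
    exact hRt.mul (blockTriangular_inv_of_blockTriangular hR't)
  have hgd : g = diagonal fun i => g i i := by
    ext i j
    rw [diagonal_apply]
    split_ifs with hij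
    · rw [hij]
    · rcases lt_or_gt_of_ne hij with h | h
      · exact hg' (i := j) (j := i) h
      · exact hg h
  have hpos : ∀ i, 0 < g i i := fun i => by
    have h1 := congrFun (congrFun hgR i) i
    rw [hgd, diagonal_mul] at h1
    exact pos_of_mul_pos_left (h1 ▸ hR'.2 i) (hR.2 i).le
  have hgg : gᵀ * g = 1 := by
    rw [transpose_mul, transpose_transpose, mul_assoc, ← mul_assoc (h' : RMat m m),
      h'.mul_transpose_self, one_mul, h.transpose_mul_self]
  have hg1 : g = 1 := by
    rw [hgd, ← diagonal_one]
    congr 1; ext i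
    have h1 := congrFun (congrFun hgg i) i
    rw [hgd, diagonal_transpose, diagonal_mul_diagonal, diagonal_apply_eq, one_apply_eq] at h1
    nlinarith [hpos i]
  refine ⟨Subtype.ext ?_, by rw [← hgR, hg1, one_mul]⟩
  calc (h : RMat m m) = (h' : RMat m m) * g := by
        rw [← mul_assoc, h'.mul_transpose_self, one_mul]
    _ = h' := by rw [hg1, mul_one]

/-- The open Weyl chamber of singular values. -/
def chamber (m : ℕ) : Set (Fin m → ℝ) := {α | StrictAnti α ∧ ∀ i, 0 < α i}

theorem exists_svd {Y : RMat m m} (hY : Y.det ≠ 0) (hinj : Function.Injective (sortedEigs Y)) :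
    ∃ h k : OrthGrp m, ∃ α ∈ chamber m,
      Y = (h : RMat m m) * diagonal α * (k : RMat m m)ᵀ := by
  obtain ⟨k, hk⟩ := exists_orth_diagonal Y
  have hpos : ∀ i, 0 < sortedEigs Y i := by
    have h0 : (Yᵀ * Y).det ≠ 0 := by
      rw [det_mul, det_transpose]; exact mul_ne_zero hY hY
    rw [hk, det_mul, det_mul, det_diagonal] at h0
    have h1 := right_ne_zero_of_mul (left_ne_zero_of_mul h0)
    exact fun i => lt_of_le_of_ne (sortedEigs_nonneg Y i)
      (Finset.prod_ne_zero_iff.1 h1 i (Finset.mem_univ i)).symm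
  let α : Fin m → ℝ := fun i => √(sortedEigs Y i)
  have hα : ∀ i, 0 < α i := fun i => Real.sqrt_pos.2 (hpos i)
  have hanti : StrictAnti α := fun i j hij =>
    Real.sqrt_lt_sqrt (hpos j).le (((sortedEigs_antitone Y).strictAnti_of_injective hinj) hij)
  let Q : RMat m m := Y * (k : RMat m m) * diagonal (fun i => (α i)⁻¹)
  have hQ : Qᵀ * Q = 1 := by
    have : Qᵀ * Q = diagonal (fun i => (α i)⁻¹) * ((k : RMat m m)ᵀ * (Yᵀ * Y) * (k : RMat m m)) *
        diagonal (fun i => (α i)⁻¹) := by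
      simp only [Q, transpose_mul, diagonal_transpose, mul_assoc]
    have h2 : (k : RMat m m)ᵀ * (Yᵀ * Y) * (k : RMat m m) = diagonal (sortedEigs Y) := by
      rw [hk, mul_assoc, mul_assoc, mul_assoc, k.transpose_mul_self, mul_one, ← mul_assoc,
        k.transpose_mul_self, one_mul]
    rw [this, h2, diagonal_mul_diagonal, diagonal_mul_diagonal, ← diagonal_one]
    congr 1; ext i
    have := (hα i).ne'
    have h2 : α i * α i = sortedEigs Y i := Real.mul_self_sqrt (hpos i).le
    rw [← h2]
    field_simp
  refine ⟨⟨Q, mem_orthogonalGroup_iff_transpose_mul.2 hQ⟩, k, α, ⟨hanti, hα⟩, ?_⟩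
  have h1 : diagonal (fun i => (α i)⁻¹) * diagonal α = (1 : RMat m m) := by
    rw [diagonal_mul_diagonal, ← diagonal_one]; congr 1; ext i
    exact inv_mul_cancel₀ (hα i).ne'
  change Y = Y * (k : RMat m m) * diagonal (fun i => (α i)⁻¹) * diagonal α * (k : RMat m m)ᵀ
  rw [mul_assoc (Y * _), h1, mul_one, mul_assoc, k.mul_transpose_self, mul_one]

theorem chamber_eq_of_charpoly_eq {α β : Fin m → ℝ} (hα : Antitone α) (hα0 : ∀ i, 0 ≤ α i)
    (hβ : Antitone β) (hβ0 : ∀ i, 0 ≤ β i)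
    (h : ∏ i, (Polynomial.X - Polynomial.C (α i ^ 2)) =
      ∏ i, (Polynomial.X - Polynomial.C (β i ^ 2))) : α = β := by
  have := antitone_eq_of_prod_X_sub_C_eq (f := fun i => α i ^ 2) (g := fun i => β i ^ 2)
    (fun i j hij => pow_le_pow_left₀ (hα0 j) (hα hij) 2)
    (fun i j hij => pow_le_pow_left₀ (hβ0 j) (hβ hij) 2) h
  ext i
  exact (pow_left_inj₀ (hα0 i) (hβ0 i) two_ne_zero).1 (congrFun this i)

theorem charpoly_orth_conj (k : OrthGrp m) (S : RMat m m) :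
    ((k : RMat m m) * S * (k : RMat m m)ᵀ).charpoly = S.charpoly := by
  rw [charpoly_mul_comm, ← mul_assoc, k.transpose_mul_self, one_mul]

theorem svd_unique {h k h' k' : OrthGrp m} {α α' : Fin m → ℝ} (hα : α ∈ chamber m)
    (hα' : α' ∈ chamber m)
    (e : (h : RMat m m) * diagonal α * (k : RMat m m)ᵀ =
      (h' : RMat m m) * diagonal α' * (k' : RMat m m)ᵀ) :
    α = α' ∧ ∃ ε : Fin m → ℝ, (∀ i, ε i = 1 ∨ ε i = -1) ∧
      (h : RMat m m) = (h' : RMat m m) * diagonal ε ∧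
      (k : RMat m m) = (k' : RMat m m) * diagonal ε := by
  have hYY : ∀ (h k : OrthGrp m) (α : Fin m → ℝ),
      ((h : RMat m m) * diagonal α * (k : RMat m m)ᵀ)ᵀ *
        ((h : RMat m m) * diagonal α * (k : RMat m m)ᵀ) =
      (k : RMat m m) * diagonal (fun i => α i ^ 2) * (k : RMat m m)ᵀ := by
    intro h k α
    rw [transpose_mul, transpose_mul, transpose_transpose, diagonal_transpose,
      show (k : RMat m m) * (diagonal α * (h : RMat m m)ᵀ) *
        ((h : RMat m m) * diagonal α * (k : RMat m m)ᵀ) = (k : RMat m m) * (diagonal α *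
        ((h : RMat m m)ᵀ * (h : RMat m m)) * diagonal α) * (k : RMat m m)ᵀ by
        simp only [mul_assoc], h.transpose_mul_self, mul_one, diagonal_mul_diagonal]
    simp only [sq]
  have hk2 := (hYY h k α).symm.trans ((congrArg (fun Y => Yᵀ * Y) e).trans (hYY h' k' α'))
  have hαα : α = α' := by
    have := congrArg Matrix.charpoly hk2
    rw [charpoly_orth_conj, charpoly_orth_conj, charpoly_diagonal, charpoly_diagonal] at this
    exact chamber_eq_of_charpoly_eq hα.1.antitone (fun i => (hα.2 i).le) hα'.1.antitone
      (fun i => (hα'.2 i).le) this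
  subst hαα
  refine ⟨rfl, ?_⟩
  let v : RMat m m := (k' : RMat m m)ᵀ * (k : RMat m m)
  let u : RMat m m := (h' : RMat m m)ᵀ * (h : RMat m m)
  have hkv : (k : RMat m m) = (k' : RMat m m) * v := by
    rw [← mul_assoc, k'.mul_transpose_self, one_mul]
  have hhu : (h : RMat m m) = (h' : RMat m m) * u := by
    rw [← mul_assoc, h'.mul_transpose_self, one_mul]
  have hv : v * diagonal (fun i => α i ^ 2) = diagonal (fun i => α i ^ 2) * v := by
    have := congrArg (fun Z => (k' : RMat m m)ᵀ * Z * (k : RMat m m)) hk2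
    simp only [mul_assoc, k.transpose_mul_self, mul_one] at this
    rw [← mul_assoc (k' : RMat m m)ᵀ (k' : RMat m m), k'.transpose_mul_self, one_mul] at this
    rw [mul_assoc, this]
  have huv : u * diagonal α = diagonal α * v := by
    have := congrArg (fun Z => (h' : RMat m m)ᵀ * Z * (k : RMat m m)) e
    simp only [mul_assoc, k.transpose_mul_self, mul_one] at this
    rw [← mul_assoc (h' : RMat m m)ᵀ (h' : RMat m m), h'.transpose_mul_self, one_mul] at this
    rw [mul_assoc, this]
  have hsq : Function.Injective fun i => α i ^ 2 := fun i j hij =>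
    hα.1.injective ((pow_left_inj₀ (hα.2 i).le (hα.2 j).le two_ne_zero).1 hij)
  have hvd : v = diagonal fun i => v i i := by
    ext i j
    rw [diagonal_apply]
    split_ifs with hij
    · rw [hij]
    · have h1 := congrFun (congrFun hv i) j
      rw [mul_diagonal, diagonal_mul] at h1
      have h2 : v i j * (α j ^ 2 - α i ^ 2) = 0 := by linarith
      exact (mul_eq_zero.1 h2).resolve_right (sub_ne_zero.2 fun h => hij (hsq h.symm))
  have huv' : u = v := by
    ext i j
    have h1 := congrFun (congrFun huv i) j
    rw [mul_diagonal, diagonal_mul] at h1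
    by_cases hij : i = j
    · subst hij
      have := (hα.2 i).ne'
      rw [mul_comm] at h1
      exact mul_left_cancel₀ this h1
    · have h2 : v i j = 0 := by rw [hvd, diagonal_apply, if_neg hij]
      rw [h2, mul_zero] at h1
      rw [h2]
      exact (mul_eq_zero.1 h1).resolve_right (hα.2 j).ne'
  refine ⟨fun i => v i i, fun i => ?_, ?_, ?_⟩
  · have hvv : vᵀ * v = 1 := by
      rw [transpose_mul, transpose_transpose, mul_assoc, ← mul_assoc (k' : RMat m m),
        k'.mul_transpose_self, one_mul, k.transpose_mul_self]
    have h1 := congrFun (congrFun hvv i) i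
    rw [hvd, diagonal_transpose, diagonal_mul_diagonal, diagonal_apply_eq, one_apply_eq] at h1
    exact mul_self_eq_one_iff.1 h1
  · rw [← hvd, ← huv', ← hhu]
  · rw [← hvd, ← hkv]

end Decompositions

/-! ### Cayley charts for the QR and singular value decompositions -/

section Charts

variable {m : ℕ}

theorem measurable_matrix_inv : Measurable fun A : RMat m m => A⁻¹ := by
  have : (fun A : RMat m m => A⁻¹) = fun A => (A.det)⁻¹ • A.adjugate := by
    ext1 A; rw [inv_def, Ring.inverse_eq_inv']
  rw [this]
  exact (Continuous.matrix_det continuous_id).measurable.inv.smul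
    (Continuous.matrix_adjugate continuous_id).measurable

theorem measurable_cayley : Measurable (cayley (m := m)) := by
  have h1 : Measurable fun A : RMat m m => 1 - A :=
    (continuous_const.sub continuous_id).measurable
  exact ((measurable_matrix_inv.comp h1).const_smul (2 : ℝ)).sub_const 1

theorem continuous_skewOf : Continuous (skewOf m) :=
  LinearMap.continuous_of_finiteDimensional _

theorem continuous_matrix_linearMap (f : RMat m m →ₗ[ℝ] RMat m m) : Continuous f :=
  LinearMap.continuous_of_finiteDimensional _

theorem continuous_matrix_entry {n m : ℕ} (i : Fin n) (j : Fin m) :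
    Continuous fun Z : RMat n m => Z i j :=
  continuous_id.matrix_elem i j

theorem measurable_linearMap_det {X : Type*} [MeasurableSpace X]
    {f : X → RMat m m →ₗ[ℝ] RMat m m} (hf : ∀ V, Measurable fun x => f x V) :
    Measurable fun x => LinearMap.det (f x) := by
  simp_rw [← LinearMap.det_toMatrix (Matrix.stdBasis ℝ (Fin m) (Fin m))]
  simp_rw [det_apply]
  refine Finset.measurable_fun_sum _ fun σ _ => Measurable.const_smul ?_ _
  refine Finset.measurable_fun_prod _ fun q _ => ?_
  generalize σ q = p
  obtain ⟨i, j⟩ := p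
  obtain ⟨k, l⟩ := q
  have : (fun x => LinearMap.toMatrix (Matrix.stdBasis ℝ (Fin m) (Fin m))
      (Matrix.stdBasis ℝ (Fin m) (Fin m)) (f x) (i, j) (k, l)) =
      fun x => f x (Matrix.single k l 1) i j := by
    ext x
    simp only [LinearMap.toMatrix_apply, stdBasis_eq_single]
    simp [Matrix.stdBasis]
  rw [this]
  exact (continuous_matrix_entry i j).measurable.comp (hf _)

theorem measurable_det_cayleyLow : Measurable fun A : RMat m m => LinearMap.det (cayleyLow A) := by
  refine measurable_linearMap_det fun V => ?_
  have h1 : Measurable fun A : RMat m m => (1 - A)⁻¹ :=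
    measurable_matrix_inv.comp (continuous_const.sub continuous_id).measurable
  have h2 : Measurable fun A : RMat m m => cayleyForm A (skewOf m V) := by
    have hmul : ∀ H : RMat m m, Measurable fun P : RMat m m => (2 : ℝ) • (Pᵀ * H * P) := fun H =>
      Continuous.measurable (by fun_prop)
    exact (hmul _).comp h1
  exact (((continuous_matrix_linearMap (strictLow m)).measurable).comp h2).add_const _

/-- Orthogonal matrices without eigenvalue `-1` and with positive diagonal. -/
def orthPos (m : ℕ) : Set (OrthGrp m) :=
  {h | (1 + (h : RMat m m)).det ≠ 0 ∧ ∀ i, 0 < (h : RMat m m) i i}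

/-- Skew-symmetric matrices whose Cayley transform has positive diagonal. -/
def cayleyPos (m : ℕ) : Set (RMat m m) := {A | ∀ i, 0 < cayley A i i}

theorem isOpen_orthPos : IsOpen (orthPos m) := by
  have h1 : Continuous fun h : OrthGrp m => (h : RMat m m) := continuous_subtype_val
  have : orthPos m = {h : OrthGrp m | (1 + (h : RMat m m)).det ≠ 0} ∩
      ⋂ i, {h : OrthGrp m | 0 < (h : RMat m m) i i} := by
    ext h; simp [orthPos]
  rw [this]
  refine IsOpen.inter ?_ (isOpen_iInter_of_finite fun i => ?_)
  · exact isOpen_ne_fun (Continuous.matrix_det (continuous_const.add h1)) continuous_const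
  · exact isOpen_lt continuous_const (h1.matrix_elem i i)

theorem one_mem_orthPos : (1 : OrthGrp m) ∈ orthPos m := by
  refine ⟨?_, fun i => ?_⟩
  · have : (1 : RMat m m) + ((1 : OrthGrp m) : RMat m m) = (2 : ℝ) • 1 := by
      rw [two_smul]; rfl
    rw [this, det_smul, det_one, mul_one]
    positivity
  · change 0 < (1 : RMat m m) i i
    simp

theorem measurableSet_cayleyPos : MeasurableSet (cayleyPos m) := by
  have : cayleyPos m = ⋂ i, {A | 0 < cayley A i i} := by ext; simp [cayleyPos]
  rw [this]
  exact MeasurableSet.iInter fun i => measurableSet_lt measurable_const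
    ((continuous_matrix_entry i i).measurable.comp measurable_cayley)

/-- The Cayley transform of a skew-symmetric matrix, as an orthogonal matrix. -/
noncomputable def cayleyOrth (Z : RMat m m) : OrthGrp m :=
  ⟨cayley (skewOf m Z), mem_orthogonalGroup_iff_transpose_mul.2 (cayley_orth (skewOf_transpose Z))⟩

theorem coe_cayleyOrth (Z : RMat m m) : (cayleyOrth Z : RMat m m) = cayley (skewOf m Z) := rfl

theorem cayleyOrth_mem_orthPos {Z : RMat m m} (hZ : skewOf m Z ∈ cayleyPos m) :
    cayleyOrth Z ∈ orthPos m :=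
  ⟨det_one_add_cayley_ne_zero (skewOf_transpose Z), hZ⟩

theorem exists_cayleyOrth_eq {h : OrthGrp m} (hh : h ∈ orthPos m) :
    ∃ A : RMat m m, strictLow m A = A ∧ cayley (skewOf m A) = (h : RMat m m) ∧
      skewOf m A ∈ cayleyPos m := by
  obtain ⟨A, hA, hAh⟩ := exists_cayley_eq h.transpose_mul_self hh.1
  refine ⟨strictLow m A, ?_, ?_, ?_⟩
  · ext i j
    simp only [strictLow_apply]
    split_ifs <;> rfl
  · rw [skewOf_strictLow, skewOf_eq_self hA, hAh]
  · rw [skewOf_strictLow, skewOf_eq_self hA]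
    intro i
    rw [hAh]
    exact hh.2 i

theorem cayleyOrth_injective_iff {Z Z' : RMat m m} (h : cayleyOrth Z = cayleyOrth Z') :
    skewOf m Z = skewOf m Z' :=
  cayley_injOn (skewOf_transpose Z) (skewOf_transpose Z') (congrArg Subtype.val h)

theorem strictLow_eq_of_skewOf_eq {Z Z' : RMat m m} (h : skewOf m Z = skewOf m Z') :
    strictLow m Z = strictLow m Z' := by
  rw [← strictLow_skewOf, h, strictLow_skewOf]

theorem exists_hasFDerivAt_cayley_skewOf (Z : RMat m m) :
    ∃ L : RMat m m →L[ℝ] RMat m m,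
      (∀ V, L V = cayley (skewOf m Z) * cayleyForm (skewOf m Z) (skewOf m V)) ∧
      HasFDerivAt (fun Z => cayley (skewOf m Z)) L Z := by
  obtain ⟨L, hL, hD⟩ := exists_hasFDerivAt_cayley (skewOf_transpose Z)
  refine ⟨L.comp (LinearMap.toContinuousLinearMap (skewOf m)), fun V => hL _, ?_⟩
  have h1 := hasFDerivAt_matrix_linearMap (skewOf m) Z
  let _ := Matrix.linftyOpNormedRing (n := Fin m) (α := ℝ)
  let _ := Matrix.linftyOpNormedAlgebra (n := Fin m) (R := ℝ) (α := ℝ)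
  exact HasFDerivAt.comp (𝕜 := ℝ) Z hD h1

/-! #### The QR chart -/

noncomputable def qrChart (Z : RMat m m) : RMat m m := cayley (skewOf m Z) * upTri m Z

def qrDom (m : ℕ) : Set (RMat m m) := {Z | skewOf m Z ∈ cayleyPos m ∧ ∀ i, 0 < Z i i}

theorem isPosTri_upTri {Z : RMat m m} (hZ : ∀ i, 0 < Z i i) : IsPosTri (upTri m Z) :=
  ⟨fun i j h => by rw [upTri_apply, if_neg (not_le.2 h)], fun i => by
    rw [upTri_apply, if_pos le_rfl]; exact hZ i⟩

theorem measurableSet_qrDom : MeasurableSet (qrDom m) := by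
  have : qrDom m = skewOf m ⁻¹' cayleyPos m ∩ ⋂ i, {Z | 0 < Z i i} := by ext; simp [qrDom]
  rw [this]
  exact (measurableSet_cayleyPos.preimage continuous_skewOf.measurable).inter
    (MeasurableSet.iInter fun i => measurableSet_lt measurable_const
      (continuous_matrix_entry i i).measurable)

theorem injOn_qrChart : Set.InjOn (qrChart (m := m)) (qrDom m) := by
  intro Z hZ Z' hZ' h
  obtain ⟨h1, h2⟩ := qr_unique (h := cayleyOrth Z) (h' := cayleyOrth Z')
    (isPosTri_upTri hZ.2) (isPosTri_upTri hZ'.2) h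
  rw [← strictLow_add_upTri Z, ← strictLow_add_upTri Z',
    strictLow_eq_of_skewOf_eq (cayleyOrth_injective_iff h1), h2]

theorem exists_hasFDerivAt_qrChart (Z : RMat m m) :
    ∃ L : RMat m m →L[ℝ] RMat m m,
      (L : RMat m m →ₗ[ℝ] RMat m m) = mulLeftLinearMap (Fin m) ℝ (cayley (skewOf m Z)) ∘ₗ
        qrForm (upTri m Z) ∘ₗ cayleyLow (skewOf m Z) ∧
      HasFDerivAt qrChart L Z := by
  obtain ⟨L₁, hL₁, hD₁⟩ := exists_hasFDerivAt_cayley_skewOf Z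
  obtain ⟨L, hL, hD⟩ := exists_hasFDerivAt_matrix_mul hD₁
    (hasFDerivAt_matrix_linearMap (upTri m) Z)
  refine ⟨L, LinearMap.ext fun V => ?_, hD⟩
  change L V = cayley (skewOf m Z) * qrForm (upTri m Z) (cayleyLow (skewOf m Z) V)
  rw [hL, hL₁, qrForm_apply, skewOf_cayleyLow, upTri_cayleyLow, mul_add, mul_assoc, add_comm]
  rfl

theorem mem_image_qrChart {Y : RMat m m} : Y ∈ qrChart '' qrDom m ↔
    ∃ h ∈ orthPos m, ∃ R, IsPosTri R ∧ Y = (h : RMat m m) * R := by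
  constructor
  · rintro ⟨Z, hZ, rfl⟩
    exact ⟨cayleyOrth Z, cayleyOrth_mem_orthPos hZ.1, upTri m Z, isPosTri_upTri hZ.2, rfl⟩
  · rintro ⟨h, hh, R, hR, rfl⟩
    obtain ⟨A, hA, hAh, hAp⟩ := exists_cayleyOrth_eq hh
    have hRu : upTri m R = R := by
      ext i j
      rw [upTri_apply]
      split_ifs with hij
      · rfl
      · exact (hR.1 i j (not_le.1 hij)).symm
    have h1 : skewOf m (A + R) = skewOf m A := by
      rw [map_add, ← hRu, skewOf_upTri, add_zero]
    have h2 : upTri m (A + R) = R := by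
      rw [map_add, ← hA, upTri_strictLow, zero_add, hRu]
    refine ⟨A + R, ⟨by rwa [h1], fun i => ?_⟩, ?_⟩
    · have : A i i = 0 := by rw [← hA, strictLow_apply, if_neg (lt_irrefl _)]
      rw [Matrix.add_apply, this, zero_add]
      exact hR.2 i
    · rw [qrChart, h1, h2, hAh]

theorem qr_change_of_variables (F : RMat m m → ENNReal) :
    MeasurableSet (qrChart '' qrDom m) ∧
    ∫⁻ Y in qrChart '' qrDom m, F Y = ∫⁻ Z in qrDom m,
      ENNReal.ofReal |LinearMap.det (cayleyLow (skewOf m Z))| *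
        (ENNReal.ofReal (∏ j : Fin m, Z j j ^ (m - 1 - (j : ℕ))) * F (qrChart Z)) := by
  choose L hL hD using exists_hasFDerivAt_qrChart (m := m)
  refine ⟨measurableSet_image_matrix measurableSet_qrDom (fun Z _ => hD Z) injOn_qrChart, ?_⟩
  rw [lintegral_image_matrix measurableSet_qrDom (fun Z _ => hD Z) injOn_qrChart]
  refine setLIntegral_congr_fun measurableSet_qrDom fun Z hZ => ?_
  have h1 : |LinearMap.det (L Z : RMat m m →ₗ[ℝ] RMat m m)| =
      |LinearMap.det (cayleyLow (skewOf m Z))| * ∏ j : Fin m, Z j j ^ (m - 1 - (j : ℕ)) := by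
    rw [hL, LinearMap.det_comp, LinearMap.det_comp, det_mulLeftLinearMap,
      det_qrForm (isPosTri_upTri hZ.2).1, abs_mul, abs_mul, abs_pow, ← coe_cayleyOrth,
      OrthGrp.abs_det, one_pow, one_mul, mul_comm]
    simp only [upTri_apply, if_pos le_rfl]
    rw [abs_of_nonneg (a := ∏ j : Fin m, _)]
    exact Finset.prod_nonneg fun j _ => pow_nonneg (hZ.2 j).le _
  rw [h1, ENNReal.ofReal_mul (abs_nonneg _), mul_assoc]

/-! #### The singular value chart -/

noncomputable def svdChart (Z : RMat m m) : RMat m m :=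
  cayley (skewOf m Z) * diagPart m Z * (cayley (skewOf m Zᵀ))ᵀ

def svdDom (m : ℕ) : Set (RMat m m) :=
  {Z | (skewOf m Z ∈ cayleyPos m ∧ skewOf m Zᵀ ∈ cayleyPos m) ∧ (fun i => Z i i) ∈ chamber m}

theorem measurableSet_chamber : MeasurableSet (chamber m) := by
  have : chamber m = (⋂ i, ⋂ j, ⋂ (_ : i < j), {α : Fin m → ℝ | α j < α i}) ∩
      ⋂ i, {α | 0 < α i} := by
    ext; simp [chamber, StrictAnti]
  rw [this]
  refine MeasurableSet.inter ?_ ?_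
  · exact MeasurableSet.iInter fun i => MeasurableSet.iInter fun j => MeasurableSet.iInter fun _ =>
      measurableSet_lt (measurable_pi_apply j) (measurable_pi_apply i)
  · exact MeasurableSet.iInter fun i => measurableSet_lt measurable_const (measurable_pi_apply i)

theorem measurableSet_svdDom : MeasurableSet (svdDom m) := by
  refine MeasurableSet.inter (MeasurableSet.inter ?_ ?_) ?_
  · exact measurableSet_cayleyPos.preimage continuous_skewOf.measurable
  · exact measurableSet_cayleyPos.preimage
      (continuous_skewOf.comp (continuous_matrix_linearMap (transposeLM m))).measurable
  · exact measurableSet_chamber.preimage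
      (measurable_pi_lambda _ fun i => (continuous_matrix_entry i i).measurable)

theorem eq_of_parts_eq {Z Z' : RMat m m} (h1 : skewOf m Z = skewOf m Z')
    (h2 : skewOf m Zᵀ = skewOf m Z'ᵀ) (h3 : ∀ i, Z i i = Z' i i) : Z = Z' := by
  ext i j
  rcases lt_trichotomy i j with h | rfl | h
  · have := congrFun (congrFun h2 j) i
    simpa [skewOf_apply, h] using this
  · exact h3 i
  · have := congrFun (congrFun h1 i) j
    simpa [skewOf_apply, h] using this

theorem injOn_svdChart : Set.InjOn (svdChart (m := m)) (svdDom m) := by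
  intro Z hZ Z' hZ' h
  obtain ⟨h1, ε, hε, h2, h3⟩ := svd_unique (h := cayleyOrth Z) (h' := cayleyOrth Z')
    (k := cayleyOrth Zᵀ) (k' := cayleyOrth Z'ᵀ) hZ.2 hZ'.2 h
  have hε1 : ε = fun _ => 1 := by
    ext i
    have e1 := congrFun (congrFun h2 i) i
    rw [mul_diagonal] at e1
    have p1 : 0 < (cayleyOrth Z : RMat m m) i i := hZ.1.1 i
    have p2 : 0 < (cayleyOrth Z' : RMat m m) i i := hZ'.1.1 i
    rcases hε i with h | h
    · exact h
    · rw [h] at e1; linarith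
  rw [hε1, diagonal_one, mul_one] at h2 h3
  exact eq_of_parts_eq (cayleyOrth_injective_iff (Subtype.ext h2))
    (cayleyOrth_injective_iff (Subtype.ext h3)) (congrFun h1)

theorem exists_hasFDerivAt_svdChart (Z : RMat m m) :
    ∃ L : RMat m m →L[ℝ] RMat m m,
      (L : RMat m m →ₗ[ℝ] RMat m m) = mulLeftLinearMap (Fin m) ℝ (cayley (skewOf m Z)) ∘ₗ
        mulRightLinearMap (Fin m) ℝ (cayley (skewOf m Zᵀ))ᵀ ∘ₗ
        svdForm (fun i => Z i i) ∘ₗ cayleyLow (skewOf m Z) ∘ₗ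
        (transposeLM m ∘ₗ cayleyLow (skewOf m Zᵀ) ∘ₗ transposeLM m) ∧
      HasFDerivAt svdChart L Z := by
  obtain ⟨L₁, hL₁, hD₁⟩ := exists_hasFDerivAt_cayley_skewOf Z
  obtain ⟨L₂, hL₂, hD₂⟩ := exists_hasFDerivAt_cayley_skewOf Zᵀ
  have hT := hasFDerivAt_matrix_linearMap (transposeLM m) Z
  have hD₃ : HasFDerivAt (fun Z : RMat m m => (cayley (skewOf m Zᵀ))ᵀ)
      ((LinearMap.toContinuousLinearMap (transposeLM m)).comp
        (L₂.comp (LinearMap.toContinuousLinearMap (transposeLM m)))) Z := by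
    have hT' := hasFDerivAt_matrix_linearMap (transposeLM m) (cayley (skewOf m Zᵀ))
    let _ := Matrix.linftyOpNormedRing (n := Fin m) (α := ℝ)
    let _ := Matrix.linftyOpNormedAlgebra (n := Fin m) (R := ℝ) (α := ℝ)
    exact HasFDerivAt.comp (𝕜 := ℝ) (g := transposeLM m) (f := fun Z => cayley (skewOf m Zᵀ)) Z hT'
      (HasFDerivAt.comp (𝕜 := ℝ) (g := fun Z => cayley (skewOf m Z)) (f := transposeLM m) Z hD₂ hT)
  obtain ⟨L₄, hL₄, hD₄⟩ := exists_hasFDerivAt_matrix_mul hD₁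
    (hasFDerivAt_matrix_linearMap (diagPart m) Z)
  obtain ⟨L, hL, hD⟩ := exists_hasFDerivAt_matrix_mul hD₄ hD₃
  refine ⟨L, LinearMap.ext fun V => ?_, hD⟩
  let W : RMat m m := (cayleyLow (skewOf m Zᵀ) Vᵀ)ᵀ
  have hW1 : skewOf m W = skewOf m V := by
    ext i j
    have hup := upTri_cayleyLow (skewOf m Zᵀ) Vᵀ
    have : ∀ i j, i < j → W j i = V j i := fun i j hij => by
      have := congrFun (congrFun hup i) j
      rwa [upTri_apply, upTri_apply, if_pos hij.le, if_pos hij.le] at this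
    rw [skewOf_apply, skewOf_apply]
    split_ifs with h1 h2
    · exact this _ _ h1
    · rw [this _ _ h2]
    · rfl
  have hWd : ∀ i, W i i = V i i := fun i => by
    have := congrFun (congrFun (upTri_cayleyLow (skewOf m Zᵀ) Vᵀ) i) i
    rwa [upTri_apply, upTri_apply, if_pos le_rfl, if_pos le_rfl] at this
  have hW2 : skewOf m Wᵀ = cayleyForm (skewOf m Zᵀ) (skewOf m Vᵀ) := by
    rw [transpose_transpose, skewOf_cayleyLow]
  have hX : ∀ i j, i ≤ j → cayleyLow (skewOf m Z) W i j = W i j := fun i j hij => by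
    have := congrFun (congrFun (upTri_cayleyLow (skewOf m Z) W) i) j
    rwa [upTri_apply, upTri_apply, if_pos hij, if_pos hij] at this
  have hX2 : skewOf m (cayleyLow (skewOf m Z) W)ᵀ = skewOf m Wᵀ := by
    ext i j
    rw [skewOf_apply, skewOf_apply]
    split_ifs with h1 h2
    · exact hX _ _ h1.le
    · simp only [transpose_apply]; rw [hX _ _ h2.le]
    · rfl
  have hXd : diagPart m (cayleyLow (skewOf m Z) W) = diagPart m V := by
    rw [diagPart_apply, diagPart_apply]
    congr 1; ext i
    rw [hX i i le_rfl, hWd]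
  change L V = cayley (skewOf m Z) * (svdForm (fun i => Z i i) (cayleyLow (skewOf m Z) W) *
    (cayley (skewOf m Zᵀ))ᵀ)
  rw [svdForm_apply, skewOf_cayleyLow, hX2, hXd, hW1, hW2, hL, hL₄, hL₁]
  have e1 : ((LinearMap.toContinuousLinearMap (transposeLM m)).comp
        (L₂.comp (LinearMap.toContinuousLinearMap (transposeLM m)))) V =
      -(cayleyForm (skewOf m Zᵀ) (skewOf m Vᵀ) * (cayley (skewOf m Zᵀ))ᵀ) := by
    change (L₂ Vᵀ)ᵀ = _
    rw [hL₂, transpose_mul, cayleyForm_skew _ (skewOf_transpose _), neg_mul]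
  rw [e1]
  change cayley (skewOf m Z) * diagPart m Z * _ + (cayley (skewOf m Z) * diagPart m V + _ *
    diagPart m Z) * _ = _
  rw [diagPart_apply Z]
  noncomm_ring

theorem mem_image_svdChart {Y : RMat m m} : Y ∈ svdChart '' svdDom m ↔
    ∃ h ∈ orthPos m, ∃ k ∈ orthPos m, ∃ α ∈ chamber m,
      Y = (h : RMat m m) * diagonal α * (k : RMat m m)ᵀ := by
  constructor
  · rintro ⟨Z, hZ, rfl⟩
    exact ⟨cayleyOrth Z, cayleyOrth_mem_orthPos hZ.1.1, cayleyOrth Zᵀ,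
      cayleyOrth_mem_orthPos hZ.1.2, fun i => Z i i, hZ.2, rfl⟩
  · rintro ⟨h, hh, k, hk, α, hα, rfl⟩
    obtain ⟨A, hA, hAh, hAp⟩ := exists_cayleyOrth_eq hh
    obtain ⟨B, hB, hBk, hBp⟩ := exists_cayleyOrth_eq hk
    have hA0 : ∀ i j, i ≤ j → A i j = 0 := fun i j hij => by
      rw [← hA, strictLow_apply, if_neg (not_lt.2 hij)]
    have hB0 : ∀ i j, i ≤ j → B i j = 0 := fun i j hij => by
      rw [← hB, strictLow_apply, if_neg (not_lt.2 hij)]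
    have hs : ∀ A B : RMat m m, (∀ i j, i ≤ j → B i j = 0) →
        skewOf m (A + diagonal α + Bᵀ) = skewOf m A := by
      intro A B hB0
      ext i j
      simp only [skewOf_apply, Matrix.add_apply, transpose_apply]
      split_ifs with h1 h2
      · rw [diagonal_apply_ne _ h1.ne', hB0 _ _ h1.le]; simp
      · rw [diagonal_apply_ne _ h2.ne', hB0 _ _ h2.le]; simp
      · rfl
    have h1 := hs A B hB0
    have h2 : skewOf m (A + diagonal α + Bᵀ)ᵀ = skewOf m B := by
      rw [← hs B A hA0, transpose_add, transpose_add, transpose_transpose, diagonal_transpose]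
      congr 1; abel
    have h3 : ∀ i, (A + diagonal α + Bᵀ) i i = α i := fun i => by
      simp [hA0 i i le_rfl, hB0 i i le_rfl]
    refine ⟨A + diagonal α + Bᵀ, ⟨⟨by rwa [h1], by rwa [h2]⟩, ?_⟩, ?_⟩
    · simp only [h3]; exact hα
    · rw [svdChart, h1, h2, hAh, hBk, diagPart_apply]
      simp only [h3]

theorem svd_change_of_variables (F : RMat m m → ENNReal) :
    MeasurableSet (svdChart '' svdDom m) ∧
    ∫⁻ Y in svdChart '' svdDom m, F Y = ∫⁻ Z in svdDom m,
      ENNReal.ofReal |LinearMap.det (cayleyLow (skewOf m Z))| *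
        (ENNReal.ofReal |LinearMap.det (cayleyLow (skewOf m Zᵀ))| *
        (ENNReal.ofReal (∏ i : Fin m, ∏ j ∈ Finset.Ioi i, (Z i i ^ 2 - Z j j ^ 2)) *
          F (svdChart Z))) := by
  choose L hL hD using exists_hasFDerivAt_svdChart (m := m)
  refine ⟨measurableSet_image_matrix measurableSet_svdDom (fun Z _ => hD Z) injOn_svdChart, ?_⟩
  rw [lintegral_image_matrix measurableSet_svdDom (fun Z _ => hD Z) injOn_svdChart]
  refine setLIntegral_congr_fun measurableSet_svdDom fun Z hZ => ?_
  have h1 : |LinearMap.det (L Z : RMat m m →ₗ[ℝ] RMat m m)| =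
      |LinearMap.det (cayleyLow (skewOf m Z))| * (|LinearMap.det (cayleyLow (skewOf m Zᵀ))| *
        ∏ i : Fin m, ∏ j ∈ Finset.Ioi i, (Z i i ^ 2 - Z j j ^ 2)) := by
    rw [hL, LinearMap.det_comp, LinearMap.det_comp, LinearMap.det_comp, LinearMap.det_comp,
      det_mulLeftLinearMap, det_mulRightLinearMap, det_transpose,
      det_conj_involution fun V => transpose_transpose V, abs_mul, abs_mul, abs_mul, abs_mul,
      abs_pow, abs_pow, ← coe_cayleyOrth, ← coe_cayleyOrth,
      OrthGrp.abs_det, OrthGrp.abs_det, one_pow, one_mul, one_mul, abs_det_svdForm,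
      abs_of_nonneg (a := ∏ i : Fin m, _)]
    · ring
    · refine Finset.prod_nonneg fun i _ => Finset.prod_nonneg fun j hj => ?_
      have := pow_le_pow_left₀ (hZ.2.2 j).le (hZ.2.1 (Finset.mem_Ioi.1 hj)).le 2
      exact sub_nonneg.2 this
  rw [h1, ENNReal.ofReal_mul (abs_nonneg _), ENNReal.ofReal_mul (abs_nonneg _), mul_assoc,
    mul_assoc]

end Charts

/-! ### Splitting Lebesgue measure into triangular and diagonal coordinates -/

section Split

variable {m : ℕ}

/-- Index set of the strictly lower triangular entries. -/
abbrev LowIdx (m : ℕ) : Type := {p : Fin m × Fin m // p.2 < p.1}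

/-- The matrix with given strictly lower, diagonal and (transposed) strictly upper entries. -/
def matOf (x : LowIdx m → ℝ) (d : Fin m → ℝ) (y : LowIdx m → ℝ) : RMat m m :=
  Matrix.of fun i j =>
    if h : j < i then x ⟨(i, j), h⟩ else if h : i < j then y ⟨(j, i), h⟩ else d i

theorem matOf_low (x : LowIdx m → ℝ) (d : Fin m → ℝ) (y : LowIdx m → ℝ) {i j : Fin m}
    (h : j < i) : matOf x d y i j = x ⟨(i, j), h⟩ := by
  rw [matOf, of_apply, dif_pos h]

theorem matOf_up (x : LowIdx m → ℝ) (d : Fin m → ℝ) (y : LowIdx m → ℝ) {i j : Fin m}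
    (h : i < j) : matOf x d y i j = y ⟨(j, i), h⟩ := by
  rw [matOf, of_apply, dif_neg (not_lt.2 h.le), dif_pos h]

theorem matOf_diag (x : LowIdx m → ℝ) (d : Fin m → ℝ) (y : LowIdx m → ℝ) (i : Fin m) :
    matOf x d y i i = d i := by
  rw [matOf, of_apply, dif_neg (lt_irrefl i), dif_neg (lt_irrefl i)]

theorem measurable_matOf : Measurable fun p : (LowIdx m → ℝ) × (Fin m → ℝ) × (LowIdx m → ℝ) =>
    matOf p.1 p.2.1 p.2.2 := by
  refine measurable_pi_lambda _ fun i => measurable_pi_lambda _ fun j => ?_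
  rcases lt_trichotomy i j with h | rfl | h
  · simp_rw [matOf_up _ _ _ h]
    exact (measurable_pi_apply _).comp (measurable_snd.comp measurable_snd)
  · simp_rw [matOf_diag]
    exact (measurable_pi_apply _).comp (measurable_fst.comp measurable_snd)
  · simp_rw [matOf_low _ _ _ h]
    exact (measurable_pi_apply _).comp measurable_fst

/-- Matrix entries, indexed by their position relative to the diagonal. -/
def entryEquiv (m : ℕ) : LowIdx m ⊕ (Fin m ⊕ LowIdx m) ≃ Fin m × Fin m where
  toFun := Sum.elim (fun p => p.1) (Sum.elim (fun i => (i, i)) fun p => p.1.swap)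
  invFun q := if h : q.2 < q.1 then Sum.inl ⟨q, h⟩ else
    if h : q.1 < q.2 then Sum.inr (Sum.inr ⟨q.swap, h⟩) else Sum.inr (Sum.inl q.1)
  left_inv := by
    rintro (⟨⟨i, j⟩, h⟩ | i | ⟨⟨i, j⟩, h⟩)
    · exact dif_pos h
    · simp
    · exact (dif_neg (not_lt.2 (le_of_lt h))).trans (dif_pos h)
  right_inv := by
    rintro ⟨i, j⟩
    rcases lt_trichotomy i j with h | rfl | h
    · simp only [dif_neg (not_lt.2 h.le), dif_pos h, Sum.elim_inr, Prod.swap_prod_mk]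
    · simp
    · simp only [dif_pos h, Sum.elim_inl]

theorem measurePreserving_entries {κ : Type*} [Fintype κ] {n m : ℕ} (σ : κ ≃ Fin n × Fin m) :
    MeasurePreserving (fun (Z : RMat n m) (s : κ) => Z (σ s).1 (σ s).2) volume volume := by
  have hmeas : Measurable fun (Z : RMat n m) (s : κ) => Z (σ s).1 (σ s).2 :=
    measurable_pi_lambda _ fun s => (continuous_matrix_entry _ _).measurable
  refine ⟨hmeas, ?_⟩
  refine (Measure.pi_eq fun s hs => ?_).symm
  rw [Measure.map_apply hmeas (MeasurableSet.univ_pi hs)]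
  have : (fun (Z : RMat n m) (s : κ) => Z (σ s).1 (σ s).2) ⁻¹' (Set.univ.pi s) =
      Set.univ.pi fun i => Set.univ.pi fun j => s (σ.symm (i, j)) := by
    ext Z
    simp only [Set.mem_preimage, Set.mem_univ_pi]
    constructor
    · intro h i _ j _
      have := h (σ.symm (i, j))
      rwa [Equiv.apply_symm_apply] at this
    · intro h t
      have := h (σ t).1 trivial (σ t).2 trivial
      beta_reduce at this
      rwa [Prod.mk.eta, Equiv.symm_apply_apply] at this
  rw [this]
  have h1 := Measure.pi_pi (fun _ : Fin n => (volume : Measure (Fin m → ℝ)))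
    (fun i => Set.univ.pi fun j => s (σ.symm (i, j)))
  refine h1.trans ?_
  simp_rw [volume_pi, Measure.pi_pi]
  rw [← Fintype.prod_prod_type' fun i j => volume (s (σ.symm (i, j)))]
  exact Fintype.prod_equiv σ.symm _ _ fun _ => rfl

theorem lintegral_matOf {f : RMat m m → ENNReal} (hf : Measurable f) :
    ∫⁻ Z : RMat m m, f Z = ∫⁻ x, ∫⁻ d, ∫⁻ y, f (matOf x d y) := by
  have h1 := measurePreserving_entries (entryEquiv m)
  have h2 := volume_measurePreserving_sumPiEquivProdPi
    (fun _ : LowIdx m ⊕ (Fin m ⊕ LowIdx m) => ℝ)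
  have h3 := (MeasurePreserving.id (volume : Measure (LowIdx m → ℝ))).prod
    (volume_measurePreserving_sumPiEquivProdPi (fun _ : Fin m ⊕ LowIdx m => ℝ))
  have h4 := h3.comp (h2.comp h1)
  have hg : Measurable fun p : (LowIdx m → ℝ) × (Fin m → ℝ) × (LowIdx m → ℝ) =>
    f (matOf p.1 p.2.1 p.2.2) := hf.comp measurable_matOf
  have h5 := h4.lintegral_comp hg
  have h6 : ∀ Z : RMat m m, matOf (fun p => Z p.1.1 p.1.2) (fun i => Z i i)
      (fun p => Z p.1.2 p.1.1) = Z := by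
    intro Z
    ext i j
    rcases lt_trichotomy i j with h | rfl | h
    · rw [matOf_up _ _ _ h]
    · rw [matOf_diag]
    · rw [matOf_low _ _ _ h]
  have h7 : ∀ Z : RMat m m, f Z = f (matOf (fun p => Z p.1.1 p.1.2) (fun i => Z i i)
      (fun p => Z p.1.2 p.1.1)) := fun Z => by rw [h6]
  rw [lintegral_congr h7]
  refine Eq.trans h5 ?_
  refine (lintegral_prod _ hg.aemeasurable).trans ?_
  refine lintegral_congr fun x => ?_
  exact lintegral_prod _ (hg.comp measurable_prodMk_left).aemeasurable

end Split

/-! ### Averaging over the orthogonal group and the QR integration formula -/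

section QR

variable {m : ℕ}

/-- If every orbit meets `E` with probability `w`, then integrals over `E` of invariant functions
are `w` times integrals over the whole space. -/
theorem lintegral_average {X Ξ : Type*} [MeasurableSpace X] [MeasurableSpace Ξ] (μ : Measure X)
    [SFinite μ] (κ : Measure Ξ) [IsProbabilityMeasure κ] (φ : Ξ → X → X)
    (hφ : Measurable fun p : Ξ × X => φ p.1 p.2)
    (hφμ : ∀ ξ, ∀ G : X → ENNReal, Measurable G → ∫⁻ x, G (φ ξ x) ∂μ = ∫⁻ x, G x ∂μ)
    {F : X → ENNReal} (hF : Measurable F) (hFφ : ∀ ξ x, F (φ ξ x) = F x) {E : Set X}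
    (hE : MeasurableSet E) {w : ENNReal} (hw : ∀ᵐ x ∂μ, κ {ξ | φ ξ x ∈ E} = w) :
    w * ∫⁻ x, F x ∂μ = ∫⁻ x in E, F x ∂μ := by
  have hS : MeasurableSet {p : Ξ × X | φ p.1 p.2 ∈ E} := hφ hE
  have h1 : ∀ ξ, ∫⁻ x in E, F x ∂μ = ∫⁻ x, E.indicator 1 (φ ξ x) * F x ∂μ := by
    intro ξ
    rw [← lintegral_indicator hE, ← hφμ ξ _ (hF.indicator hE)]
    refine lintegral_congr fun x => ?_
    by_cases h : φ ξ x ∈ E <;> simp [h, hFφ]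
  have hm : Measurable fun p : Ξ × X => E.indicator (1 : X → ENNReal) (φ p.1 p.2) :=
    (measurable_one.indicator hE).comp hφ
  calc w * ∫⁻ x, F x ∂μ = ∫⁻ x, w * F x ∂μ := (lintegral_const_mul _ hF).symm
    _ = ∫⁻ x, (∫⁻ ξ, E.indicator 1 (φ ξ x) ∂κ) * F x ∂μ := by
        refine lintegral_congr_ae (hw.mono fun x hx => ?_)
        have : MeasurableSet {ξ | φ ξ x ∈ E} := (measurable_prodMk_right (y := x)) hS
        have h2 : ∫⁻ ξ, E.indicator (1 : X → ENNReal) (φ ξ x) ∂κ = κ {ξ | φ ξ x ∈ E} :=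
          lintegral_indicator_one this
        simp only
        rw [h2, hx]
    _ = ∫⁻ x, ∫⁻ ξ, E.indicator 1 (φ ξ x) * F x ∂κ ∂μ := by
        refine lintegral_congr fun x => ?_
        rw [lintegral_mul_const]
        exact hm.comp measurable_prodMk_right
    _ = ∫⁻ ξ, ∫⁻ x, E.indicator 1 (φ ξ x) * F x ∂μ ∂κ := by
        refine lintegral_lintegral_swap ?_
        exact ((hm.comp measurable_swap).mul (hF.comp measurable_fst)).aemeasurable
    _ = ∫⁻ x in E, F x ∂μ := by
        simp_rw [← h1]
        rw [lintegral_const, measure_univ, mul_one]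

theorem finite_setOf_det_add_smul_one (A : RMat m m) :
    {t : ℝ | (A + t • (1 : RMat m m)).det = 0}.Finite := by
  refine ((-A).charpoly.roots.toFinset.finite_toSet).subset fun t ht => ?_
  have h : (-A).charpoly.eval t = (A + t • (1 : RMat m m)).det := by
    rw [eval_charpoly, sub_neg_eq_add, add_comm, scalar_apply, smul_one_eq_diagonal]
  simp only [Finset.mem_coe, Multiset.mem_toFinset]
  rw [Polynomial.mem_roots (charpoly_monic _).ne_zero, Polynomial.IsRoot.def, h]
  exact ht

theorem measurableSet_det_eq_zero : MeasurableSet {Y : RMat m m | Y.det = 0} :=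
  (Continuous.matrix_det continuous_id).measurable (measurableSet_singleton 0)

theorem ae_det_ne_zero : ∀ᵐ Y : RMat m m, Y.det ≠ 0 := by
  rw [ae_iff]
  simp only [not_not]
  exact volume_eq_zero_of_countable_lines measurableSet_det_eq_zero 1
    fun Y => (finite_setOf_det_add_smul_one Y).countable

theorem ae_det_transpose_mul_self_ne_zero {n : ℕ} (hmn : m ≤ n) :
    ∀ᵐ X : RMat n m, (Xᵀ * X).det ≠ 0 := by
  have hc : Continuous fun X : RMat n m => (X.submatrix (Fin.castLE hmn) id).det :=
    Continuous.matrix_det (Continuous.matrix_submatrix continuous_id _ _)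
  have h0 : ∀ᵐ X : RMat n m, (X.submatrix (Fin.castLE hmn) id).det ≠ 0 := by
    rw [ae_iff]
    simp only [not_not]
    let v : RMat n m := Matrix.of fun i j => if i = Fin.castLE hmn j then 1 else 0
    refine volume_eq_zero_of_countable_lines (hc.measurable (measurableSet_singleton 0)) v
      fun Y => ?_
    refine ((finite_setOf_det_add_smul_one (Y.submatrix (Fin.castLE hmn) id)).subset ?_).countable
    intro t ht
    have h1 : v.submatrix (Fin.castLE hmn) id = 1 := by
      ext i j
      simp [v, one_apply]
    have ht' : ((Y + t • v).submatrix (Fin.castLE hmn) id).det = 0 := ht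
    rw [submatrix_add, Pi.add_apply, Pi.add_apply, submatrix_smul, Pi.smul_apply, Pi.smul_apply,
      h1] at ht'
    exact ht'
  filter_upwards [h0] with X hX hdet
  obtain ⟨v, hv0, hv⟩ := exists_mulVec_eq_zero_iff.2 hdet
  apply hX
  refine exists_mulVec_eq_zero_iff.1 ⟨v, hv0, ?_⟩
  have hXv : X *ᵥ v = 0 := by
    have : (Xᴴ * X) *ᵥ v = 0 := by rw [conjTranspose_eq_transpose_of_trivial]; exact hv
    rwa [conjTranspose_mul_self_mulVec_eq_zero] at this
  ext i
  exact congrFun hXv (Fin.castLE hmn i)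

theorem measurable_matrix_mul {X : Type*} [MeasurableSpace X] {a b c : ℕ} {f : X → RMat a b}
    {g : X → RMat b c} (hf : Measurable f) (hg : Measurable g) :
    Measurable fun x => f x * g x := by
  have : Continuous fun p : RMat a b × RMat b c => p.1 * p.2 :=
    continuous_fst.matrix_mul continuous_snd
  exact this.measurable.comp (hf.prodMk hg)

theorem measurable_coe_orthGrp : Measurable fun g : OrthGrp m => (g : RMat m m) :=
  measurable_subtype_coe

theorem measurable_transpose {a b : ℕ} : Measurable fun X : RMat a b => Xᵀ :=
  Continuous.measurable (Continuous.matrix_transpose continuous_id)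

theorem lintegral_orth_mul_left {n : ℕ} (g : OrthGrp n) {G : RMat n m → ENNReal}
    (hG : Measurable G) : ∫⁻ X : RMat n m, G ((g : RMat n n) * X) = ∫⁻ X, G X := by
  rw [← lintegral_mul_left (g : RMat n n) g.det_ne_zero hG, g.abs_det]
  simp

theorem lintegral_orth_mul_right {n : ℕ} (g : OrthGrp m) {G : RMat n m → ENNReal}
    (hG : Measurable G) : ∫⁻ X : RMat n m, G (X * (g : RMat m m)) = ∫⁻ X, G X := by
  rw [← lintegral_mul_right (g : RMat m m) g.det_ne_zero hG, g.abs_det]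
  simp

/-- Lebesgue integral over Cayley coordinates of `orthPos`. -/
noncomputable def cayleyVol (m : ℕ) : ENNReal :=
  ∫⁻ x : LowIdx m → ℝ, (cayleyPos m).indicator
    (fun A => ENNReal.ofReal |LinearMap.det (cayleyLow A)|) (skewOf m (matOf x 0 0))

/-- Haar measure of the inverse of `orthPos`. -/
noncomputable def haarVol (νH : Measure (OrthGrp m)) : ENNReal := νH (orthPos m)⁻¹

theorem haarVol_ne_zero (νH : Measure (OrthGrp m)) [νH.IsHaarMeasure] : haarVol νH ≠ 0 :=
  (isOpen_orthPos.inv.measure_pos νH ⟨1, by simpa using one_mem_orthPos⟩).ne'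

theorem haarVol_ne_top (νH : Measure (OrthGrp m)) [IsProbabilityMeasure νH] :
    haarVol νH ≠ ⊤ := measure_ne_top _ _

theorem measure_inv_mul_mem (νH : Measure (OrthGrp m)) [νH.IsHaarMeasure] (h : OrthGrp m) :
    νH {g | g⁻¹ * h ∈ orthPos m} = haarVol νH := by
  have : {g : OrthGrp m | g⁻¹ * h ∈ orthPos m} = (fun g => h⁻¹ * g) ⁻¹' (orthPos m)⁻¹ := by
    ext g
    simp [_root_.mul_inv_rev]
  rw [this, measure_preimage_mul, haarVol]

theorem skewOf_matOf (x : LowIdx m → ℝ) (d : Fin m → ℝ) (y : LowIdx m → ℝ) :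
    skewOf m (matOf x d y) = skewOf m (matOf x 0 0) := by
  ext i j
  simp only [skewOf_apply]
  split_ifs with h1 h2
  · rw [matOf_low _ _ _ h1, matOf_low _ _ _ h1]
  · rw [matOf_low _ _ _ h2, matOf_low _ _ _ h2]
  · rfl

theorem upTri_matOf (x : LowIdx m → ℝ) (d : Fin m → ℝ) (y : LowIdx m → ℝ) :
    upTri m (matOf x d y) = matOf 0 d y := by
  ext i j
  rw [upTri_apply]
  rcases lt_trichotomy i j with h | rfl | h
  · rw [if_pos h.le, matOf_up _ _ _ h, matOf_up _ _ _ h]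
  · rw [if_pos le_rfl, matOf_diag, matOf_diag]
  · rw [if_neg (not_le.2 h), matOf_low _ _ _ h]; rfl

theorem measurable_cayleyWeight : Measurable ((cayleyPos m).indicator
    fun A => ENNReal.ofReal |LinearMap.det (cayleyLow A)|) :=
  (measurable_det_cayleyLow.norm.ennreal_ofReal).indicator measurableSet_cayleyPos

theorem measurable_matOf_low : Measurable fun x : LowIdx m → ℝ => matOf x 0 0 :=
  measurable_matOf.comp (measurable_id.prodMk (measurable_const (a := ((0 : Fin m → ℝ), (0 : LowIdx m → ℝ)))))

theorem measurable_matOf_up : Measurable fun p : (Fin m → ℝ) × (LowIdx m → ℝ) =>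
    matOf 0 p.1 p.2 :=
  measurable_matOf.comp (measurable_const.prodMk measurable_id)

theorem measurableSet_posVec : MeasurableSet {d : Fin m → ℝ | ∀ i, 0 < d i} := by
  have : {d : Fin m → ℝ | ∀ i, 0 < d i} = ⋂ i, {d | 0 < d i} := by ext; simp
  rw [this]
  exact MeasurableSet.iInter fun i => measurableSet_lt measurable_const (measurable_pi_apply i)

theorem lintegral_image_qrChart {F : RMat m m → ENNReal} (hF : Measurable F)
    (hinv : ∀ (g : OrthGrp m) Y, F ((g : RMat m m) * Y) = F Y) :
    ∫⁻ Y in qrChart '' qrDom m, F Y = cayleyVol m *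
      ∫⁻ d in {d : Fin m → ℝ | ∀ i, 0 < d i}, ∫⁻ y,
        ENNReal.ofReal (∏ j : Fin m, d j ^ (m - 1 - (j : ℕ))) * F (matOf 0 d y) := by
  set P : Set (Fin m → ℝ) := {d | ∀ i, 0 < d i} with hP
  let wt : RMat m m → ENNReal := (cayleyPos m).indicator
    fun A => ENNReal.ofReal |LinearMap.det (cayleyLow A)|
  let G : (Fin m → ℝ) → (LowIdx m → ℝ) → ENNReal := fun d y =>
    P.indicator 1 d *
      (ENNReal.ofReal (∏ j : Fin m, d j ^ (m - 1 - (j : ℕ))) * F (matOf 0 d y))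
  have hGm : Measurable fun p : (Fin m → ℝ) × (LowIdx m → ℝ) => G p.1 p.2 := by
    refine ((measurable_one.indicator measurableSet_posVec).comp measurable_fst).mul
      (Measurable.mul ?_ (hF.comp measurable_matOf_up))
    refine Measurable.ennreal_ofReal (Finset.measurable_fun_prod _ fun j _ => ?_)
    exact ((measurable_pi_apply j).comp measurable_fst).pow_const _
  have hwt : Measurable wt := measurable_cayleyWeight
  let f : RMat m m → ENNReal := fun Z =>
    wt (skewOf m Z) * (P.indicator 1 (fun i => Z i i) *
      (ENNReal.ofReal (∏ j : Fin m, Z j j ^ (m - 1 - (j : ℕ))) * F (upTri m Z)))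
  have hfm : Measurable f := by
    have hdiag : Measurable fun (Z : RMat m m) (i : Fin m) => Z i i :=
      measurable_pi_lambda _ fun i => (continuous_matrix_entry i i).measurable
    refine (hwt.comp continuous_skewOf.measurable).mul
      (((measurable_one.indicator measurableSet_posVec).comp hdiag).mul (Measurable.mul ?_
        (hF.comp (continuous_matrix_linearMap _).measurable)))
    refine Measurable.ennreal_ofReal (Finset.measurable_fun_prod _ fun j _ => ?_)
    exact (continuous_matrix_entry j j).measurable.pow_const _
  have h1 : ∫⁻ Y in qrChart '' qrDom m, F Y = ∫⁻ Z : RMat m m, f Z := by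
    rw [(qr_change_of_variables F).2, ← lintegral_indicator measurableSet_qrDom]
    refine lintegral_congr fun Z => ?_
    simp only [f, wt]
    have hFZ : F (qrChart Z) = F (upTri m Z) := hinv (cayleyOrth Z) _
    by_cases h : Z ∈ qrDom m
    · rw [Set.indicator_of_mem h, Set.indicator_of_mem h.1, Set.indicator_of_mem (s := P) h.2, hFZ, Pi.one_apply, one_mul]
    · rw [Set.indicator_of_notMem h]
      by_cases h2 : skewOf m Z ∈ cayleyPos m
      · rw [Set.indicator_of_notMem (s := P) (fun h3 => h ⟨h2, h3⟩), zero_mul, mul_zero]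
      · rw [Set.indicator_of_notMem h2, zero_mul]
  have h2 : ∀ x d y, f (matOf x d y) = wt (skewOf m (matOf x 0 0)) * G d y := by
    intro x d y
    simp only [f, G]
    rw [skewOf_matOf, upTri_matOf]
    simp only [matOf_diag]
  rw [h1, lintegral_matOf hfm]
  simp_rw [h2]
  have h3 : ∀ x d, ∫⁻ y, wt (skewOf m (matOf x 0 0)) * G d y =
      wt (skewOf m (matOf x 0 0)) * ∫⁻ y, G d y := fun x d =>
    lintegral_const_mul _ (hGm.comp measurable_prodMk_left)
  simp_rw [h3]
  have h4 : Measurable fun d => ∫⁻ y, G d y := hGm.lintegral_prod_right'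
  have h5 : ∀ x, ∫⁻ d, wt (skewOf m (matOf x 0 0)) * ∫⁻ y, G d y =
      wt (skewOf m (matOf x 0 0)) * ∫⁻ d, ∫⁻ y, G d y := fun x => lintegral_const_mul _ h4
  simp_rw [h5]
  rw [lintegral_mul_const]
  · congr 1
    rw [← lintegral_indicator measurableSet_posVec]
    refine lintegral_congr fun d => ?_
    by_cases h : d ∈ P
    · rw [Set.indicator_of_mem h]
      refine lintegral_congr fun y => ?_
      simp only [G]
      rw [Set.indicator_of_mem h, Pi.one_apply, one_mul]
    · rw [Set.indicator_of_notMem h]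
      simp only [G]
      rw [Set.indicator_of_notMem h]
      simp
  · exact hwt.comp (continuous_skewOf.measurable.comp measurable_matOf_low)

theorem haarVol_mul_lintegral (νH : Measure (OrthGrp m)) [νH.IsHaarMeasure]
    [IsProbabilityMeasure νH] {F : RMat m m → ENNReal} (hF : Measurable F)
    (hinv : ∀ (g : OrthGrp m) Y, F ((g : RMat m m) * Y) = F Y) :
    haarVol νH * ∫⁻ Y : RMat m m, F Y = cayleyVol m *
      ∫⁻ d in {d : Fin m → ℝ | ∀ i, 0 < d i}, ∫⁻ y,
        ENNReal.ofReal (∏ j : Fin m, d j ^ (m - 1 - (j : ℕ))) * F (matOf 0 d y) := by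
  rw [← lintegral_image_qrChart hF hinv]
  refine lintegral_average volume νH (fun g Y => ((g⁻¹ : OrthGrp m) : RMat m m) * Y) ?_ ?_ hF ?_
    (qr_change_of_variables F).1 ?_
  · exact measurable_matrix_mul
      (measurable_coe_orthGrp.comp (continuous_inv.measurable.comp measurable_fst)) measurable_snd
  · exact fun g G hG => lintegral_orth_mul_left g⁻¹ hG
  · exact fun g Y => hinv g⁻¹ Y
  · filter_upwards [ae_det_ne_zero] with Y hY
    obtain ⟨h, R, hR, rfl⟩ := exists_qr hY
    rw [← measure_inv_mul_mem νH h]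
    congr 1
    ext g
    rw [Set.mem_ofPred_eq, Set.mem_ofPred_eq, mem_image_qrChart, ← mul_assoc]
    constructor
    · rintro ⟨h', hh', R', hR', e⟩
      have := (qr_unique (h := g⁻¹ * h) hR hR' e).1
      rwa [this]
    · intro hg
      exact ⟨_, hg, R, hR, rfl⟩

end QR

/-! ### Gaussian integrals -/

section Gaussian

variable {m : ℕ}

theorem lintegral_prod_ofReal {ι : Type*} [Fintype ι] (μ : Measure ℝ) [SigmaFinite μ]
    {f : ι → ℝ → ℝ} (hf : ∀ i, Integrable (f i) μ) (h0 : ∀ i x, 0 ≤ f i x) :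
    ∫⁻ z : ι → ℝ, ENNReal.ofReal (∏ i, f i (z i)) ∂(Measure.pi fun _ => μ) =
      ENNReal.ofReal (∏ i, ∫ x, f i x ∂μ) := by
  rw [← integral_fintype_prod_eq_prod, ofReal_integral_eq_lintegral_ofReal]
  · exact Integrable.fintype_prod hf
  · exact Filter.Eventually.of_forall fun z => Finset.prod_nonneg fun i _ => h0 i _

theorem lintegral_gaussian_pi (ι : Type*) [Fintype ι] :
    ∫⁻ z : ι → ℝ, ENNReal.ofReal (Real.exp (-∑ i, z i ^ 2)) =
      ENNReal.ofReal (√π ^ Fintype.card ι) := by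
  have hi : Integrable fun x : ℝ => Real.exp (-x ^ 2) := by
    simpa using integrable_exp_neg_mul_sq one_pos
  have hv : ∫ x : ℝ, Real.exp (-x ^ 2) = √π := by simpa using integral_gaussian 1
  have h := lintegral_prod_ofReal (ι := ι) (volume : Measure ℝ) (f := fun _ x => Real.exp (-x ^ 2))
    (fun _ => hi) fun _ _ => (Real.exp_pos _).le
  rw [hv, Finset.prod_const, Finset.card_univ] at h
  rw [← h, volume_pi]
  refine lintegral_congr fun z => ?_
  rw [← Real.exp_sum, Finset.sum_neg_distrib]

theorem trace_transpose_mul_self {n : ℕ} (X : RMat n m) :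
    (Xᵀ * X).trace = ∑ j, ∑ i, X i j ^ 2 := by
  simp only [trace, diag_apply, mul_apply, transpose_apply, pow_two]

theorem continuous_trace_transpose_mul_self {n : ℕ} :
    Continuous fun X : RMat n m => (Xᵀ * X).trace :=
  Continuous.matrix_trace ((Continuous.matrix_transpose continuous_id).matrix_mul continuous_id)

theorem lintegral_gaussian_matrix (n m : ℕ) :
    ∫⁻ X : RMat n m, ENNReal.ofReal (Real.exp (-(Xᵀ * X).trace)) =
      ENNReal.ofReal (√π ^ (n * m)) := by
  have h := measurePreserving_entries (Equiv.refl (Fin n × Fin m))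
  have hm : Measurable fun z : Fin n × Fin m → ℝ =>
      ENNReal.ofReal (Real.exp (-∑ i, z i ^ 2)) := by
    refine Measurable.ennreal_ofReal (Real.measurable_exp.comp (Measurable.neg ?_))
    exact Finset.measurable_fun_sum _ fun i _ => (measurable_pi_apply i).pow_const _
  have h1 := h.lintegral_comp hm
  rw [lintegral_gaussian_pi, Fintype.card_prod, Fintype.card_fin, Fintype.card_fin] at h1
  rw [← h1]
  refine lintegral_congr fun X => ?_
  rw [trace_transpose_mul_self, Fintype.sum_prod_type, Finset.sum_comm]
  rfl

theorem card_lowIdx (m : ℕ) : 2 * Fintype.card (LowIdx m) + m = m ^ 2 := by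
  have := Fintype.card_congr (entryEquiv m)
  simp only [Fintype.card_sum, Fintype.card_prod, Fintype.card_fin] at this
  rw [pow_two, ← this]
  ring

theorem integral_pow_mul_exp_neg_sq (q : ℕ) :
    IntegrableOn (fun x : ℝ => |x| ^ q * Real.exp (-x ^ 2)) (Set.Ioi 0) ∧
    ∫ x in Set.Ioi (0 : ℝ), |x| ^ q * Real.exp (-x ^ 2) = Real.Gamma (((q : ℝ) + 1) / 2) / 2 := by
  have hq : (-1 : ℝ) < q := by have := q.cast_nonneg (α := ℝ); linarith
  have e : ∀ x ∈ Set.Ioi (0 : ℝ), x ^ (q : ℝ) * Real.exp (-x ^ (2 : ℝ)) =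
      |x| ^ q * Real.exp (-x ^ 2) := fun x hx => by
    rw [abs_of_pos hx, rpow_natCast, rpow_two]
  constructor
  · exact (integrableOn_rpow_mul_exp_neg_rpow hq two_pos).congr_fun e measurableSet_Ioi
  · rw [← setIntegral_congr_fun measurableSet_Ioi e, integral_rpow_mul_exp_neg_rpow two_pos hq]
    ring

theorem trace_matOf_zero (d : Fin m → ℝ) (y : LowIdx m → ℝ) :
    ((matOf 0 d y)ᵀ * matOf 0 d y).trace = ∑ i, d i ^ 2 + ∑ p, y p ^ 2 := by
  rw [trace_transpose_mul_self, Finset.sum_comm,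
    ← Fintype.sum_prod_type' fun i j => matOf 0 d y i j ^ 2,
    ← (entryEquiv m).sum_comp, Fintype.sum_sum_type, Fintype.sum_sum_type]
  have h1 : ∀ p : LowIdx m, matOf 0 d y ((entryEquiv m) (Sum.inl p)).1
      ((entryEquiv m) (Sum.inl p)).2 = 0 := fun p => matOf_low _ _ _ p.2
  have h2 : ∀ i : Fin m, matOf 0 d y ((entryEquiv m) (Sum.inr (Sum.inl i))).1
      ((entryEquiv m) (Sum.inr (Sum.inl i))).2 = d i := fun i => matOf_diag _ _ _ i
  have h3 : ∀ p : LowIdx m, matOf 0 d y ((entryEquiv m) (Sum.inr (Sum.inr p))).1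
      ((entryEquiv m) (Sum.inr (Sum.inr p))).2 = y p := fun p => matOf_up _ _ _ p.2
  simp_rw [h1, h2, h3]
  simp

theorem det_matOf_zero (d : Fin m → ℝ) (y : LowIdx m → ℝ) : (matOf 0 d y).det = ∏ i, d i := by
  rw [det_of_isUpperTriangular (fun i j h => matOf_low _ _ _ h)]
  exact Finset.prod_congr rfl fun i _ => matOf_diag _ _ _ i

theorem haarVol_mul_gaussian (νH : Measure (OrthGrp m)) [νH.IsHaarMeasure]
    [IsProbabilityMeasure νH] (q : ℕ) :
    haarVol νH * ∫⁻ Y : RMat m m, ENNReal.ofReal (|Y.det| ^ q * Real.exp (-(Yᵀ * Y).trace)) =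
      cayleyVol m * ENNReal.ofReal (mvGamma m (((m : ℝ) + q) / 2) / 2 ^ m) := by
  rw [haarVol_mul_lintegral]
  · congr 1
    set P : Set (Fin m → ℝ) := {d | ∀ i, 0 < d i} with hP
    have h1 : ∀ d ∈ P, ∫⁻ y, ENNReal.ofReal (∏ j : Fin m, d j ^ (m - 1 - (j : ℕ))) *
        ENNReal.ofReal (|(matOf 0 d y).det| ^ q *
          Real.exp (-((matOf 0 d y)ᵀ * matOf 0 d y).trace)) =
        ENNReal.ofReal (∏ j : Fin m, |d j| ^ (m - 1 - (j : ℕ) + q) * Real.exp (-d j ^ 2)) *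
          ENNReal.ofReal (√π ^ Fintype.card (LowIdx m)) := by
      intro d hd
      rw [← lintegral_gaussian_pi, ← lintegral_const_mul']
      · refine lintegral_congr fun y => ?_
        rw [det_matOf_zero, trace_matOf_zero, ← ENNReal.ofReal_mul, ← ENNReal.ofReal_mul,
          neg_add, Real.exp_add, Finset.prod_mul_distrib, Finset.abs_prod, ← Finset.prod_pow,
          ← Real.exp_sum, Finset.sum_neg_distrib]
        · congr 1
          have : ∏ j : Fin m, |d j| ^ (m - 1 - (j : ℕ) + q) =
              (∏ j : Fin m, d j ^ (m - 1 - (j : ℕ))) * ∏ j, |d j| ^ q := by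
            rw [← Finset.prod_mul_distrib]
            refine Finset.prod_congr rfl fun j _ => ?_
            rw [pow_add, abs_of_pos (hd j)]
          rw [this]
          ring
        · exact Finset.prod_nonneg fun j _ => by positivity
        · exact Finset.prod_nonneg fun j _ => pow_nonneg (hd j).le _
      · exact ENNReal.ofReal_ne_top
    rw [setLIntegral_congr_fun measurableSet_posVec h1, lintegral_mul_const']
    · have hP' : P = Set.univ.pi fun _ => Set.Ioi 0 := by ext d; simp [hP]
      rw [← hP, hP', volume_pi, Measure.restrict_pi_pi,
        lintegral_prod_ofReal (ι := Fin m) (volume.restrict (Set.Ioi 0))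
          (f := fun j x => |x| ^ (m - 1 - (j : ℕ) + q) * Real.exp (-x ^ 2)), ← ENNReal.ofReal_mul]
      · congr 1
        simp_rw [(integral_pow_mul_exp_neg_sq _).2]
        rw [Finset.prod_div_distrib, Finset.prod_const, Finset.card_univ, Fintype.card_fin, mvGamma,
          mul_comm, mul_div_assoc, Real.sqrt_eq_rpow, ← rpow_natCast, ← rpow_mul pi_pos.le]
        have hexp : 1 / 2 * (Fintype.card (LowIdx m) : ℝ) = ((m * (m - 1) : ℕ) : ℝ) / 4 := by
          have h := card_lowIdx m
          have h' : m * (m - 1) + m = m ^ 2 := by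
            rcases Nat.eq_zero_or_pos m with rfl | hm
            · simp
            · rw [← Nat.mul_succ, Nat.succ_eq_add_one, Nat.sub_add_cancel hm, pow_two]
          have h2 : m * (m - 1) = 2 * Fintype.card (LowIdx m) := by omega
          rw [h2]
          push_cast
          ring
        rw [hexp]
        congr 2
        · refine Finset.prod_congr rfl fun j _ => ?_
          congr 1
          have : (j : ℕ) + 1 ≤ m := j.2
          rw [Nat.sub_sub, Nat.cast_add, Nat.cast_sub (by omega)]
          push_cast
          ring
      · exact Finset.prod_nonneg fun j _ => integral_nonneg fun x => by positivity
      · exact fun j => (integral_pow_mul_exp_neg_sq _).1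
      · intro j x; positivity
    · exact ENNReal.ofReal_ne_top
  · refine Measurable.ennreal_ofReal (Continuous.measurable ?_)
    exact ((Continuous.matrix_det continuous_id).abs.pow q).mul
      (Real.continuous_exp.comp continuous_trace_transpose_mul_self.neg)
  · intro g Y
    rw [det_mul, abs_mul, g.abs_det, one_mul, transpose_mul, mul_assoc, ← mul_assoc _ _ Y,
      g.transpose_mul_self, one_mul]

theorem mvGamma_half_pos (q : ℕ) : 0 < mvGamma m (((m : ℝ) + q) / 2) := by
  refine mul_pos (rpow_pos_of_pos pi_pos _) (Finset.prod_pos fun i _ => Gamma_pos_of_pos ?_)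
  have h1 : (i : ℝ) < m := by exact_mod_cast i.2
  have h2 := q.cast_nonneg (α := ℝ)
  linarith

theorem haarVol_mul_pi (νH : Measure (OrthGrp m)) [νH.IsHaarMeasure]
    [IsProbabilityMeasure νH] :
    haarVol νH * ENNReal.ofReal (√π ^ (m * m)) =
      cayleyVol m * ENNReal.ofReal (mvGamma m ((m : ℝ) / 2) / 2 ^ m) := by
  have := haarVol_mul_gaussian νH 0
  simp only [pow_zero, one_mul, Nat.cast_zero, add_zero] at this
  rw [← this, lintegral_gaussian_matrix]

theorem cayleyVol_eq (νH : Measure (OrthGrp m)) [νH.IsHaarMeasure]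
    [IsProbabilityMeasure νH] :
    cayleyVol m = haarVol νH *
      ENNReal.ofReal (2 ^ m * √π ^ (m * m) / mvGamma m ((m : ℝ) / 2)) := by
  have h := haarVol_mul_pi νH
  have hG : 0 < mvGamma m ((m : ℝ) / 2) := by simpa using mvGamma_half_pos (m := m) 0
  have h2 : ENNReal.ofReal (mvGamma m ((m : ℝ) / 2) / 2 ^ m) *
      ENNReal.ofReal (2 ^ m / mvGamma m ((m : ℝ) / 2)) = 1 := by
    rw [← ENNReal.ofReal_mul (by positivity), ← ENNReal.ofReal_one]
    congr 1
    field_simp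
  calc cayleyVol m = cayleyVol m * (ENNReal.ofReal (mvGamma m ((m : ℝ) / 2) / 2 ^ m) *
        ENNReal.ofReal (2 ^ m / mvGamma m ((m : ℝ) / 2))) := by rw [h2, mul_one]
    _ = _ := by
      rw [← mul_assoc, ← h, mul_assoc, ← ENNReal.ofReal_mul (by positivity)]
      congr 2
      ring

theorem lintegral_det_pow_gaussian (νH : Measure (OrthGrp m)) [νH.IsHaarMeasure]
    [IsProbabilityMeasure νH] (q : ℕ) :
    ∫⁻ Y : RMat m m, ENNReal.ofReal (|Y.det| ^ q * Real.exp (-(Yᵀ * Y).trace)) =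
      ENNReal.ofReal (√π ^ (m * m) * mvGamma m (((m : ℝ) + q) / 2) / mvGamma m ((m : ℝ) / 2)) := by
  have h := haarVol_mul_gaussian νH q
  rw [cayleyVol_eq νH, mul_assoc] at h
  have h' := (ENNReal.mul_right_inj (haarVol_ne_zero νH) (haarVol_ne_top νH)).1 h
  have hG : 0 < mvGamma m ((m : ℝ) / 2) := by simpa using mvGamma_half_pos (m := m) 0
  rw [h', ← ENNReal.ofReal_mul (by positivity)]
  congr 1
  field_simp

end Gaussian

/-! ### Almost every square matrix has distinct singular values -/

section Distinct

variable {m : ℕ}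

/-- The Hankel determinant of the power sums of the eigenvalues of `YᵀY`. -/
noncomputable def hankelDet {R : Type*} [CommRing R] (Y : Matrix (Fin m) (Fin m) R) : R :=
  (Matrix.of fun i j : Fin m => ((Yᵀ * Y) ^ ((i : ℕ) + (j : ℕ))).trace).det

theorem hankelDet_map {R S : Type*} [CommRing R] [CommRing S] (f : R →+* S)
    (Y : Matrix (Fin m) (Fin m) R) : f (hankelDet Y) = hankelDet (Y.map f) := by
  rw [hankelDet, RingHom.map_det, hankelDet]
  congr 1
  ext i j
  rw [RingHom.mapMatrix_apply, map_apply, of_apply, of_apply, AddMonoidHom.map_trace,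
    ← transpose_map, ← Matrix.map_mul]
  change ((f.mapMatrix _).trace) = _
  rw [map_pow]
  rfl

theorem hankelDet_eq_sq {Y : RMat m m} {k : OrthGrp m} {l : Fin m → ℝ}
    (h : Yᵀ * Y = (k : RMat m m) * diagonal l * (k : RMat m m)ᵀ) :
    hankelDet Y = (vandermonde l).det ^ 2 := by
  have hp : ∀ p : ℕ, (Yᵀ * Y) ^ p = (k : RMat m m) * diagonal (fun i => l i ^ p) *
      (k : RMat m m)ᵀ := by
    intro p
    induction p with
    | zero => simp [k.mul_transpose_self]
    | succ p ih =>
      rw [pow_succ, ih, h]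
      calc _ = (k : RMat m m) * diagonal (fun i => l i ^ p) * ((k : RMat m m)ᵀ * (k : RMat m m)) *
            diagonal l * (k : RMat m m)ᵀ := by noncomm_ring
        _ = _ := by
          rw [k.transpose_mul_self, mul_one, mul_assoc (k : RMat m m), diagonal_mul_diagonal]
          simp only [pow_succ]
  have : (Matrix.of fun i j : Fin m => ((Yᵀ * Y) ^ ((i : ℕ) + (j : ℕ))).trace) =
      (vandermonde l)ᵀ * vandermonde l := by
    ext i j
    rw [of_apply, hp, trace_mul_comm, ← mul_assoc, k.transpose_mul_self, one_mul, trace_diagonal,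
      mul_apply]
    simp only [transpose_apply, vandermonde_apply, pow_add]
  rw [hankelDet, this, det_mul, det_transpose, pow_two]

theorem hankelDet_ne_zero_iff {Y : RMat m m} {k : OrthGrp m} {l : Fin m → ℝ}
    (h : Yᵀ * Y = (k : RMat m m) * diagonal l * (k : RMat m m)ᵀ) :
    hankelDet Y ≠ 0 ↔ Function.Injective l := by
  rw [hankelDet_eq_sq h, pow_ne_zero_iff two_ne_zero, det_vandermonde_ne_zero_iff]

theorem hankelDet_smul_ne_zero {Y : RMat m m} {t : ℝ} (ht : t ≠ 0) :
    hankelDet (t • Y) ≠ 0 ↔ hankelDet Y ≠ 0 := by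
  obtain ⟨k, hk⟩ := exists_orth_diagonal Y
  have hk' : (t • Y)ᵀ * (t • Y) =
      (k : RMat m m) * diagonal (fun i => t ^ 2 * sortedEigs Y i) * (k : RMat m m)ᵀ := by
    have : (diagonal fun i => t ^ 2 * sortedEigs Y i) = t ^ 2 • diagonal (sortedEigs Y) := by
      rw [← diagonal_smul]; rfl
    rw [this, transpose_smul, smul_mul_smul_comm, hk, mul_smul_comm, smul_mul_assoc, pow_two]
  rw [hankelDet_ne_zero_iff hk, hankelDet_ne_zero_iff hk']
  have : Function.Injective fun x : ℝ => t ^ 2 * x := mul_right_injective₀ (pow_ne_zero 2 ht)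
  exact this.of_comp_iff _

theorem continuous_hankelDet : Continuous (hankelDet : RMat m m → ℝ) := by
  refine Continuous.matrix_det (continuous_matrix fun i j => ?_)
  change Continuous fun Y : RMat m m => ((Yᵀ * Y) ^ ((i : ℕ) + (j : ℕ))).trace
  refine Continuous.matrix_trace ?_
  exact Continuous.pow ((Continuous.matrix_transpose continuous_id).matrix_mul continuous_id) _

theorem finite_hankelDet_line (Y : RMat m m) (D : RMat m m) (hD : hankelDet D ≠ 0) :
    {s : ℝ | hankelDet (s • Y + D) = 0}.Finite := by
  let p : Polynomial ℝ :=
    hankelDet ((Polynomial.X : Polynomial ℝ) • Y.map Polynomial.C + D.map Polynomial.C)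
  have hp : ∀ s, p.eval s = hankelDet (s • Y + D) := fun s => by
    rw [← Polynomial.coe_evalRingHom, hankelDet_map]
    congr 1
    ext i j
    simpa using mul_comm _ _
  have hp0 : p ≠ 0 := fun h0 => hD (by rw [← zero_add D, ← zero_smul ℝ Y, ← hp, h0]; simp)
  refine (p.roots.toFinset.finite_toSet).subset fun s hs => ?_
  simp only [Finset.mem_coe, Multiset.mem_toFinset]
  rw [Polynomial.mem_roots hp0, Polynomial.IsRoot.def, hp]
  exact hs

theorem ae_injective_sortedEigs : ∀ᵐ Y : RMat m m, Function.Injective (sortedEigs Y) := by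
  have h : ∀ᵐ Y : RMat m m, hankelDet Y ≠ 0 := by
    rw [ae_iff]
    simp only [not_not]
    let D : RMat m m := diagonal fun i => (i : ℝ)
    have hD : hankelDet D ≠ 0 := by
      refine (hankelDet_ne_zero_iff (k := 1) (l := fun i => (i : ℝ) ^ 2) ?_).2 ?_
      · change Dᵀ * D = (1 : RMat m m) * _ * (1 : RMat m m)ᵀ
        rw [transpose_one, one_mul, mul_one, diagonal_transpose, diagonal_mul_diagonal]
        simp only [pow_two]
      · intro i j hij
        have := (pow_left_inj₀ (Nat.cast_nonneg (i : ℕ)) (Nat.cast_nonneg (j : ℕ))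
          two_ne_zero).1 hij
        exact Fin.ext (by exact_mod_cast this)
    refine volume_eq_zero_of_countable_lines
      (continuous_hankelDet.measurable (measurableSet_singleton 0)) D fun Y => ?_
    refine Set.Countable.mono ?_
      (((finite_hankelDet_line Y D hD).image fun s => s⁻¹).insert 0).countable
    intro t ht
    by_cases h0 : t = 0
    · exact Or.inl h0
    · refine Or.inr ⟨t⁻¹, ?_, inv_inv t⟩
      have ht' : hankelDet (Y + t • D) = 0 := ht
      by_contra hne
      have h1 : t • (t⁻¹ • Y + D) = Y + t • D := by
        rw [smul_add, smul_smul, mul_inv_cancel₀ h0, one_smul]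
      exact ((hankelDet_smul_ne_zero h0).2 hne) (by rw [h1, ht'])
  filter_upwards [h] with Y hY
  obtain ⟨k, hk⟩ := exists_orth_diagonal Y
  exact (hankelDet_ne_zero_iff hk).1 hY

end Distinct

/-! ### The singular value integration formula -/

section SVD

variable {m : ℕ}

/-- The orthogonal matrix `diag(ε)` of signs. -/
def signOrth (ε : Fin m → ℤˣ) : OrthGrp m :=
  ⟨diagonal fun i => ((ε i : ℤ) : ℝ), by
    rw [mem_orthogonalGroup_iff_transpose_mul, diagonal_transpose, diagonal_mul_diagonal,
      ← diagonal_one]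
    congr 1
    ext i
    rcases Int.units_eq_one_or (ε i) with h | h <;> simp [h]⟩

theorem coe_signOrth (ε : Fin m → ℤˣ) :
    (signOrth ε : RMat m m) = diagonal fun i => ((ε i : ℤ) : ℝ) := rfl

theorem signOrth_mul_self (ε : Fin m → ℤˣ) : signOrth ε * signOrth ε = 1 := by
  refine Subtype.ext ?_
  change (signOrth ε : RMat m m) * (signOrth ε : RMat m m) = 1
  rw [coe_signOrth, diagonal_mul_diagonal, ← diagonal_one]
  congr 1
  ext i
  rcases Int.units_eq_one_or (ε i) with h | h <;> simp [h]

theorem signOrth_eq_of_mem {h : OrthGrp m} {ε ε' : Fin m → ℤˣ} (h1 : h * signOrth ε ∈ orthPos m)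
    (h2 : h * signOrth ε' ∈ orthPos m) : ε = ε' := by
  ext1 i
  have e1 : 0 < ((h : RMat m m) * (signOrth ε : RMat m m)) i i := h1.2 i
  have e2 : 0 < ((h : RMat m m) * (signOrth ε' : RMat m m)) i i := h2.2 i
  rw [coe_signOrth, mul_diagonal] at e1 e2
  rcases Int.units_eq_one_or (ε i) with h | h <;> rcases Int.units_eq_one_or (ε' i) with h' | h' <;>
    rw [h, h'] <;> rw [h] at e1 <;> rw [h'] at e2 <;> push_cast at e1 e2 <;> linarith

theorem exists_signOrth {ε : Fin m → ℝ} (hε : ∀ i, ε i = 1 ∨ ε i = -1) :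
    ∃ η : Fin m → ℤˣ, (signOrth η : RMat m m) = diagonal ε := by
  refine ⟨fun i => if ε i = 1 then 1 else -1, ?_⟩
  rw [coe_signOrth]
  congr 1
  ext i
  rcases hε i with h | h
  · simp [h]
  · rw [h]; norm_num

theorem svd_orbit_iff {h k : OrthGrp m} {α : Fin m → ℝ} (hα : α ∈ chamber m) :
    (h : RMat m m) * diagonal α * (k : RMat m m)ᵀ ∈ svdChart '' svdDom m ↔
      ∃ ε : Fin m → ℤˣ, h * signOrth ε ∈ orthPos m ∧ k * signOrth ε ∈ orthPos m := by
  rw [mem_image_svdChart]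
  constructor
  · rintro ⟨h', hh', k', hk', α', hα', e⟩
    obtain ⟨-, ε, hε, e1, e2⟩ := svd_unique hα hα' e
    obtain ⟨η, hη⟩ := exists_signOrth hε
    have f1 : h = h' * signOrth η := Subtype.ext (e1.trans (by rw [← hη]; rfl))
    have f2 : k = k' * signOrth η := Subtype.ext (e2.trans (by rw [← hη]; rfl))
    refine ⟨η, ?_, ?_⟩
    · rwa [f1, mul_assoc, signOrth_mul_self, mul_one]
    · rwa [f2, mul_assoc, signOrth_mul_self, mul_one]
  · rintro ⟨ε, h1, h2⟩
    refine ⟨_, h1, _, h2, α, hα, ?_⟩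
    change _ = ((h : RMat m m) * (signOrth ε : RMat m m)) * diagonal α *
      ((k : RMat m m) * (signOrth ε : RMat m m))ᵀ
    rw [transpose_mul, coe_signOrth, diagonal_transpose]
    calc _ = (h : RMat m m) * diagonal α * 1 * (k : RMat m m)ᵀ := by rw [mul_one]
      _ = (h : RMat m m) * diagonal α * (diagonal (fun i => ((ε i : ℤ) : ℝ)) *
          diagonal (fun i => ((ε i : ℤ) : ℝ))) * (k : RMat m m)ᵀ := by
        rw [← coe_signOrth]
        congr 2
        exact (congrArg Subtype.val (signOrth_mul_self ε)).symm
      _ = (h : RMat m m) * (diagonal α * diagonal (fun i => ((ε i : ℤ) : ℝ))) *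
          diagonal (fun i => ((ε i : ℤ) : ℝ)) * (k : RMat m m)ᵀ := by noncomm_ring
      _ = _ := by
        rw [diagonal_mul_diagonal, show (fun i => α i * ((ε i : ℤ) : ℝ)) =
          fun i => ((ε i : ℤ) : ℝ) * α i from funext fun i => mul_comm _ _,
          ← diagonal_mul_diagonal]
        noncomm_ring

theorem measure_svd_orbit (νH : Measure (OrthGrp m)) [νH.IsHaarMeasure]
    [IsProbabilityMeasure νH] {h k : OrthGrp m} {α : Fin m → ℝ} (hα : α ∈ chamber m) :
    (νH.prod νH) {p | ((p.1⁻¹ : OrthGrp m) : RMat m m) *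
      ((h : RMat m m) * diagonal α * (k : RMat m m)ᵀ) * (p.2 : RMat m m) ∈
        svdChart '' svdDom m} = 2 ^ m * haarVol νH ^ 2 := by
  let A : OrthGrp m → (Fin m → ℤˣ) → Set (OrthGrp m) := fun h ε =>
    {g | g⁻¹ * (h * signOrth ε) ∈ orthPos m}
  have hA : ∀ h ε, MeasurableSet (A h ε) := fun h ε => by
    refine (isOpen_orthPos.preimage ?_).measurableSet
    exact continuous_inv.mul continuous_const
  have hset : {p : OrthGrp m × OrthGrp m | ((p.1⁻¹ : OrthGrp m) : RMat m m) *
      ((h : RMat m m) * diagonal α * (k : RMat m m)ᵀ) * (p.2 : RMat m m) ∈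
        svdChart '' svdDom m} = ⋃ ε : Fin m → ℤˣ, A h ε ×ˢ A k ε := by
    ext ⟨g, l⟩
    have e : ((g⁻¹ : OrthGrp m) : RMat m m) *
        ((h : RMat m m) * diagonal α * (k : RMat m m)ᵀ) * (l : RMat m m) =
        ((g⁻¹ * h : OrthGrp m) : RMat m m) * diagonal α * ((l⁻¹ * k : OrthGrp m) : RMat m m)ᵀ := by
      change _ = ((g⁻¹ : OrthGrp m) : RMat m m) * (h : RMat m m) * diagonal α *
        (((l⁻¹ : OrthGrp m) : RMat m m) * (k : RMat m m))ᵀ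
      rw [l.coe_inv, transpose_mul, transpose_transpose]
      noncomm_ring
    rw [Set.mem_ofPred_eq, e, svd_orbit_iff hα]
    simp only [Set.mem_iUnion, Set.mem_prod, A, Set.mem_ofPred_eq, mul_assoc]
  rw [hset, measure_iUnion, tsum_fintype]
  · simp_rw [Measure.prod_prod]
    have : ∀ h ε, νH (A h ε) = haarVol νH := fun h ε => measure_inv_mul_mem νH _
    simp_rw [this]
    rw [Finset.sum_const, Finset.card_univ, Fintype.card_pi, Finset.prod_const, Finset.card_univ,
      Fintype.card_fin, Fintype.card_units_int, nsmul_eq_mul, pow_two]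
    push_cast
    rfl
  · intro ε ε' hne
    refine Set.disjoint_left.2 ?_
    rintro ⟨g, l⟩ ⟨h1, -⟩ ⟨h2, -⟩
    refine hne (signOrth_eq_of_mem (h := g⁻¹ * h) ?_ ?_)
    · rw [mul_assoc]; exact h1
    · rw [mul_assoc]; exact h2
  · exact fun ε => (hA h ε).prod (hA k ε)

theorem skewOf_matOf_transpose (x : LowIdx m → ℝ) (d : Fin m → ℝ) (y : LowIdx m → ℝ) :
    skewOf m (matOf x d y)ᵀ = skewOf m (matOf y 0 0) := by
  have : (matOf x d y)ᵀ = matOf y d x := by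
    ext i j
    rw [transpose_apply]
    rcases lt_trichotomy i j with h | rfl | h
    · rw [matOf_up _ _ _ h, matOf_low _ _ _ h]
    · rw [matOf_diag, matOf_diag]
    · rw [matOf_up _ _ _ h, matOf_low _ _ _ h]
  rw [this, skewOf_matOf]

theorem lintegral_image_svdChart {F : RMat m m → ENNReal} (hF : Measurable F)
    (hl : ∀ (g : OrthGrp m) Y, F ((g : RMat m m) * Y) = F Y)
    (hr : ∀ (g : OrthGrp m) Y, F (Y * (g : RMat m m)) = F Y) :
    ∫⁻ Y in svdChart '' svdDom m, F Y = cayleyVol m ^ 2 *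
      ∫⁻ α in chamber m, ENNReal.ofReal (∏ i : Fin m, ∏ j ∈ Finset.Ioi i, (α i ^ 2 - α j ^ 2)) *
        F (diagonal α) := by
  let wt : RMat m m → ENNReal := (cayleyPos m).indicator
    fun A => ENNReal.ofReal |LinearMap.det (cayleyLow A)|
  have hwt : Measurable wt := measurable_cayleyWeight
  let G : (Fin m → ℝ) → ENNReal := fun d => (chamber m).indicator 1 d *
    (ENNReal.ofReal (∏ i : Fin m, ∏ j ∈ Finset.Ioi i, (d i ^ 2 - d j ^ 2)) * F (diagonal d))
  have hdiagc : Continuous fun d : Fin m → ℝ => (diagonal d : RMat m m) :=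
    Continuous.matrix_diagonal continuous_id
  have hGm : Measurable G := by
    refine (measurable_one.indicator measurableSet_chamber).mul
      (Measurable.mul ?_ (hF.comp hdiagc.measurable))
    refine Measurable.ennreal_ofReal (Continuous.measurable ?_)
    fun_prop
  let f : RMat m m → ENNReal := fun Z =>
    wt (skewOf m Z) * (wt (skewOf m Zᵀ) * G fun i => Z i i)
  have hfm : Measurable f := by
    have hdiag : Measurable fun (Z : RMat m m) (i : Fin m) => Z i i :=
      measurable_pi_lambda _ fun i => (continuous_matrix_entry i i).measurable
    exact (hwt.comp continuous_skewOf.measurable).mul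
      ((hwt.comp (continuous_skewOf.measurable.comp measurable_transpose)).mul (hGm.comp hdiag))
  have h1 : ∫⁻ Y in svdChart '' svdDom m, F Y = ∫⁻ Z : RMat m m, f Z := by
    rw [(svd_change_of_variables F).2, ← lintegral_indicator measurableSet_svdDom]
    refine lintegral_congr fun Z => ?_
    simp only [f, wt, G]
    have hFZ : F (svdChart Z) = F (diagonal fun i => Z i i) := by
      have e : svdChart Z = (cayleyOrth Z : RMat m m) * (diagonal fun i => Z i i) *
          ((cayleyOrth Zᵀ)⁻¹ : OrthGrp m) := by
        rw [OrthGrp.coe_inv]; rfl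
      rw [e, hr, hl]
    by_cases h : Z ∈ svdDom m
    · rw [Set.indicator_of_mem h, Set.indicator_of_mem h.1.1, Set.indicator_of_mem h.1.2,
        Set.indicator_of_mem h.2, hFZ, Pi.one_apply, one_mul]
    · rw [Set.indicator_of_notMem h]
      by_cases h2 : skewOf m Z ∈ cayleyPos m
      · by_cases h3 : skewOf m Zᵀ ∈ cayleyPos m
        · rw [Set.indicator_of_notMem (s := chamber m) (fun h4 => h ⟨⟨h2, h3⟩, h4⟩), zero_mul,
            mul_zero, mul_zero]
        · rw [Set.indicator_of_notMem h3, zero_mul, mul_zero]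
      · rw [Set.indicator_of_notMem h2, zero_mul]
  have h2 : ∀ x d y, f (matOf x d y) = wt (skewOf m (matOf x 0 0)) *
      (G d * wt (skewOf m (matOf y 0 0))) := by
    intro x d y
    simp only [f]
    rw [skewOf_matOf, skewOf_matOf_transpose]
    simp only [matOf_diag]
    rw [mul_comm (G d)]
  rw [h1, lintegral_matOf hfm]
  simp_rw [h2]
  have hJ : Measurable fun y : LowIdx m → ℝ => wt (skewOf m (matOf y 0 0)) :=
    hwt.comp (continuous_skewOf.measurable.comp measurable_matOf_low)
  have h3 : ∀ x d, ∫⁻ y, wt (skewOf m (matOf x 0 0)) * (G d * wt (skewOf m (matOf y 0 0))) =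
      wt (skewOf m (matOf x 0 0)) * (G d * cayleyVol m) := fun x d => by
    rw [lintegral_const_mul _ (hJ.const_mul _), lintegral_const_mul _ hJ]
    rfl
  simp_rw [h3]
  have h5 : ∀ x, ∫⁻ d, wt (skewOf m (matOf x 0 0)) * (G d * cayleyVol m) =
      wt (skewOf m (matOf x 0 0)) * ((∫⁻ d, G d) * cayleyVol m) := fun x => by
    rw [lintegral_const_mul _ (hGm.mul_const _), lintegral_mul_const _ hGm]
  simp_rw [h5]
  rw [lintegral_mul_const _ hJ, ← lintegral_indicator measurableSet_chamber]
  have h6 : ∫⁻ d, G d = ∫⁻ d, (chamber m).indicator (fun α =>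
      ENNReal.ofReal (∏ i : Fin m, ∏ j ∈ Finset.Ioi i, (α i ^ 2 - α j ^ 2)) *
        F (diagonal α)) d := by
    refine lintegral_congr fun d => ?_
    by_cases h : d ∈ chamber m
    · simp only [G]
      rw [Set.indicator_of_mem h, Set.indicator_of_mem h, Pi.one_apply, one_mul]
    · simp only [G]
      rw [Set.indicator_of_notMem h, Set.indicator_of_notMem h, zero_mul]
  rw [h6]
  change cayleyVol m * _ = _
  ring

theorem lintegral_svd (νH : Measure (OrthGrp m)) [νH.IsHaarMeasure]
    [IsProbabilityMeasure νH] {F : RMat m m → ENNReal} (hF : Measurable F)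
    (hl : ∀ (g : OrthGrp m) Y, F ((g : RMat m m) * Y) = F Y)
    (hr : ∀ (g : OrthGrp m) Y, F (Y * (g : RMat m m)) = F Y) :
    2 ^ m * haarVol νH ^ 2 * ∫⁻ Y : RMat m m, F Y = cayleyVol m ^ 2 *
      ∫⁻ α in chamber m, ENNReal.ofReal (∏ i : Fin m, ∏ j ∈ Finset.Ioi i, (α i ^ 2 - α j ^ 2)) *
        F (diagonal α) := by
  rw [← lintegral_image_svdChart hF hl hr]
  refine lintegral_average volume (νH.prod νH)
    (fun p Y => ((p.1⁻¹ : OrthGrp m) : RMat m m) * Y * (p.2 : RMat m m)) ?_ ?_ hF ?_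
    (svd_change_of_variables F).1 ?_
  · refine measurable_matrix_mul (measurable_matrix_mul (measurable_coe_orthGrp.comp
      (continuous_inv.measurable.comp (measurable_fst.comp measurable_fst))) measurable_snd) ?_
    exact measurable_coe_orthGrp.comp (measurable_snd.comp measurable_fst)
  · intro p G hG
    have h1 : Measurable fun Y : RMat m m => G (Y * (p.2 : RMat m m)) :=
      hG.comp (measurable_matrix_mul measurable_id measurable_const)
    rw [lintegral_orth_mul_left p.1⁻¹ h1, lintegral_orth_mul_right p.2 hG]
  · intro p Y
    rw [hr, hl]
  · filter_upwards [ae_det_ne_zero, ae_injective_sortedEigs] with Y hY hinj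
    obtain ⟨h, k, α, hα, rfl⟩ := exists_svd hY hinj
    exact measure_svd_orbit νH hα

end SVD

/-! ### Reduction from rectangular to square matrices -/

section Gram

variable {n m : ℕ}

theorem exists_symm_sqrt (X : RMat n m) : ∃ s : RMat m m, sᵀ = s ∧ s * s = Xᵀ * X := by
  obtain ⟨k, hk⟩ := exists_orth_diagonal X
  refine ⟨(k : RMat m m) * diagonal (fun i => √(sortedEigs X i)) * (k : RMat m m)ᵀ, ?_, ?_⟩
  · simp [transpose_mul, mul_assoc]
  · calc _ = (k : RMat m m) * diagonal (fun i => √(sortedEigs X i)) *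
          ((k : RMat m m)ᵀ * (k : RMat m m)) * diagonal (fun i => √(sortedEigs X i)) *
          (k : RMat m m)ᵀ := by noncomm_ring
      _ = _ := by
        rw [k.transpose_mul_self, mul_one, mul_assoc (k : RMat m m), diagonal_mul_diagonal, hk]
        simp only [Real.mul_self_sqrt (sortedEigs_nonneg X _)]

/-- The kernel relating Gaussian averages over square and rectangular matrices. -/
noncomputable def gramKernel (X : RMat n m) (Z : RMat m m) : ENNReal :=
  ENNReal.ofReal ((√(Xᵀ * X).det ^ (n + m))⁻¹ * Real.exp (-(Zᵀ * (Xᵀ * X)⁻¹ * Z).trace))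

theorem measurable_gramKernel :
    Measurable fun p : RMat n m × RMat m m => gramKernel p.1 p.2 := by
  have h1 : Measurable fun p : RMat n m × RMat m m => p.1ᵀ * p.1 :=
    measurable_matrix_mul (measurable_transpose.comp measurable_fst) measurable_fst
  have hdet : Measurable fun A : RMat m m => A.det :=
    (Continuous.matrix_det continuous_id).measurable
  have htr : Measurable fun A : RMat m m => A.trace :=
    (Continuous.matrix_trace continuous_id).measurable
  refine Measurable.ennreal_ofReal (Measurable.mul ?_ ?_)
  · exact (((hdet.comp h1).sqrt).pow_const _).inv
  · refine Real.measurable_exp.comp (Measurable.neg (htr.comp ?_))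
    exact measurable_matrix_mul (measurable_matrix_mul (measurable_transpose.comp measurable_snd)
      (measurable_matrix_inv.comp h1)) measurable_snd

theorem measurable_gramKernel_left (Z : RMat m m) :
    Measurable fun X : RMat n m => gramKernel X Z := by
  have h : Measurable fun X : RMat n m => (X, Z) := measurable_id.prodMk measurable_const
  have := (@measurable_gramKernel n m).comp h
  exact this

theorem lintegral_gramKernel_mul {φ : RMat m m → ENNReal} (hφ : Measurable φ) {X : RMat n m}
    (hX : (Xᵀ * X).det ≠ 0) :
    ∫⁻ Y : RMat m m, ENNReal.ofReal (|Y.det| ^ n * Real.exp (-(Yᵀ * Y).trace)) *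
        φ ((X * Y)ᵀ * (X * Y)) =
      ∫⁻ Z : RMat m m, gramKernel X Z * (ENNReal.ofReal (|Z.det| ^ n) * φ (Zᵀ * Z)) := by
  obtain ⟨s, hs, hsX⟩ := exists_symm_sqrt X
  have hdet : (Xᵀ * X).det = s.det ^ 2 := by rw [← hsX, det_mul, pow_two]
  have hs0 : s.det ≠ 0 := fun h => hX (by rw [hdet, h]; simp)
  have hsu : IsUnit s.det := hs0.isUnit
  have hsqrt : √(Xᵀ * X).det = |s.det| := by rw [hdet, Real.sqrt_sq_eq_abs]
  have hpos : 0 < |s.det| := abs_pos.2 hs0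
  have hm : Measurable fun Z : RMat m m =>
      gramKernel X Z * (ENNReal.ofReal (|Z.det| ^ n) * φ (Zᵀ * Z)) := by
    refine (measurable_gramKernel.comp measurable_prodMk_left).mul (Measurable.mul ?_ ?_)
    · exact (((Continuous.matrix_det continuous_id).measurable.norm).pow_const _).ennreal_ofReal
    · exact hφ.comp (measurable_matrix_mul measurable_transpose measurable_id)
  rw [← lintegral_mul_left s hs0 hm, ← ENNReal.ofReal_pow (abs_nonneg _),
    ← lintegral_const_mul' _ _ ENNReal.ofReal_ne_top]
  refine lintegral_congr fun Y => ?_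
  have e1 : (X * Y)ᵀ * (X * Y) = (s * Y)ᵀ * (s * Y) := by
    rw [transpose_mul, transpose_mul, hs]
    calc _ = Yᵀ * (Xᵀ * X) * Y := by simp only [Matrix.mul_assoc]
      _ = _ := by rw [← hsX]; simp only [Matrix.mul_assoc]
  have e2 : (s * Y)ᵀ * (Xᵀ * X)⁻¹ * (s * Y) = Yᵀ * Y := by
    rw [← hsX, transpose_mul, hs, Matrix.mul_inv_rev]
    calc _ = Yᵀ * ((s * s⁻¹) * (s⁻¹ * s)) * Y := by simp only [Matrix.mul_assoc]
      _ = _ := by rw [mul_nonsing_inv _ hsu, nonsing_inv_mul _ hsu]; simp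
  rw [e1, gramKernel, e2, hsqrt, ← mul_assoc (ENNReal.ofReal _), ← ENNReal.ofReal_mul (by positivity),
    ← mul_assoc _ _ (φ _), ← ENNReal.ofReal_mul (by positivity)]
  congr 2
  rw [det_mul, abs_mul, pow_add, mul_pow]
  field_simp

theorem lintegral_gramKernel {Z : RMat m m} (hZ : Z.det ≠ 0) :
    ENNReal.ofReal (|Z.det| ^ m) * ∫⁻ X : RMat n m, gramKernel X Z =
      ∫⁻ X : RMat n m, gramKernel X 1 := by
  have hZt : (Zᵀ).det ≠ 0 := by rwa [det_transpose]
  have hpos : 0 < |Z.det| := abs_pos.2 hZ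
  rw [← lintegral_mul_right Zᵀ hZt (measurable_gramKernel_left Z),
    ← ENNReal.ofReal_pow (abs_nonneg _), ← mul_assoc, ← ENNReal.ofReal_mul (by positivity),
    ← lintegral_const_mul' _ _ ENNReal.ofReal_ne_top]
  refine lintegral_congr fun X => ?_
  have e1 : (X * Zᵀ)ᵀ * (X * Zᵀ) = Z * (Xᵀ * X) * Zᵀ := by
    rw [transpose_mul, transpose_transpose]; simp only [Matrix.mul_assoc]
  have e2 : Zᵀ * (Z * (Xᵀ * X) * Zᵀ)⁻¹ * Z = 1ᵀ * (Xᵀ * X)⁻¹ * 1 := by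
    rw [Matrix.mul_inv_rev, Matrix.mul_inv_rev, transpose_one, one_mul, mul_one]
    calc _ = (Zᵀ * Zᵀ⁻¹) * (Xᵀ * X)⁻¹ * (Z⁻¹ * Z) := by simp only [Matrix.mul_assoc]
      _ = _ := by
        rw [mul_nonsing_inv _ hZt.isUnit, nonsing_inv_mul _ hZ.isUnit, one_mul, mul_one]
  have e3 : √(Z * (Xᵀ * X) * Zᵀ).det = |Z.det| * √(Xᵀ * X).det := by
    have : (Z * (Xᵀ * X) * Zᵀ).det = Z.det ^ 2 * (Xᵀ * X).det := by
      rw [det_mul, det_mul, det_transpose]; ring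
    rw [this, Real.sqrt_mul (sq_nonneg _), Real.sqrt_sq_eq_abs]
  rw [gramKernel, gramKernel, e1, e2, e3, ← ENNReal.ofReal_mul (by positivity), det_transpose]
  congr 1
  rw [mul_pow, mul_inv, pow_add]
  field_simp

theorem gaussian_mul_lintegral_gram (hmn : m ≤ n) {φ : RMat m m → ENNReal} (hφ : Measurable φ) :
    ENNReal.ofReal (√π ^ (m * m)) * ∫⁻ X : RMat n m, φ (Xᵀ * X) =
      (∫⁻ X : RMat n m, gramKernel X 1) *
        ∫⁻ Z : RMat m m, ENNReal.ofReal (|Z.det| ^ (n - m)) * φ (Zᵀ * Z) := by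
  have hgram : Measurable fun X : RMat n m => φ (Xᵀ * X) :=
    hφ.comp (measurable_matrix_mul measurable_transpose measurable_id)
  have hw : Measurable fun Y : RMat m m =>
      ENNReal.ofReal (|Y.det| ^ n * Real.exp (-(Yᵀ * Y).trace)) := by
    refine Measurable.ennreal_ofReal (Measurable.mul ?_ ?_)
    · exact ((Continuous.matrix_det continuous_id).measurable.norm).pow_const _
    · exact Real.measurable_exp.comp continuous_trace_transpose_mul_self.measurable.neg
  have hF : Measurable fun Z : RMat m m => ENNReal.ofReal (|Z.det| ^ n) * φ (Zᵀ * Z) :=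
    ((((Continuous.matrix_det continuous_id).measurable.norm).pow_const _).ennreal_ofReal).mul
      (hφ.comp (measurable_matrix_mul measurable_transpose measurable_id))
  have hcomm : ∫⁻ Y : RMat m m, ∫⁻ X : RMat n m,
        ENNReal.ofReal (|Y.det| ^ n * Real.exp (-(Yᵀ * Y).trace)) * φ ((X * Y)ᵀ * (X * Y)) =
      ∫⁻ X : RMat n m, ∫⁻ Y : RMat m m,
        ENNReal.ofReal (|Y.det| ^ n * Real.exp (-(Yᵀ * Y).trace)) * φ ((X * Y)ᵀ * (X * Y)) := by
    refine lintegral_lintegral_swap (Measurable.aemeasurable ?_)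
    exact (hw.comp measurable_fst).mul
      (hgram.comp (measurable_matrix_mul measurable_snd measurable_fst))
  calc _ = ∫⁻ Y : RMat m m, ENNReal.ofReal (Real.exp (-(Yᵀ * Y).trace)) *
          ∫⁻ X : RMat n m, φ (Xᵀ * X) := by
        rw [← lintegral_gaussian_matrix m m, lintegral_mul_const]
        exact (Real.measurable_exp.comp
          continuous_trace_transpose_mul_self.measurable.neg).ennreal_ofReal
    _ = ∫⁻ Y : RMat m m, ∫⁻ X : RMat n m,
          ENNReal.ofReal (|Y.det| ^ n * Real.exp (-(Yᵀ * Y).trace)) *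
            φ ((X * Y)ᵀ * (X * Y)) := by
        refine lintegral_congr_ae ?_
        filter_upwards [ae_det_ne_zero (m := m)] with Y hY
        rw [lintegral_const_mul' _ _ ENNReal.ofReal_ne_top, ← lintegral_mul_right Y hY hgram,
          ← ENNReal.ofReal_pow (abs_nonneg _), ← mul_assoc,
          ← ENNReal.ofReal_mul (Real.exp_pos _).le, mul_comm (Real.exp _)]
    _ = ∫⁻ X : RMat n m, ∫⁻ Z : RMat m m,
          gramKernel X Z * (ENNReal.ofReal (|Z.det| ^ n) * φ (Zᵀ * Z)) := by
        rw [hcomm]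
        refine lintegral_congr_ae ?_
        filter_upwards [ae_det_transpose_mul_self_ne_zero hmn] with X hX
        exact lintegral_gramKernel_mul hφ hX
    _ = ∫⁻ Z : RMat m m, ∫⁻ X : RMat n m,
          gramKernel X Z * (ENNReal.ofReal (|Z.det| ^ n) * φ (Zᵀ * Z)) := by
        refine lintegral_lintegral_swap (Measurable.aemeasurable ?_)
        exact measurable_gramKernel.mul (hF.comp measurable_snd)
    _ = ∫⁻ Z : RMat m m, (∫⁻ X : RMat n m, gramKernel X 1) *
          (ENNReal.ofReal (|Z.det| ^ (n - m)) * φ (Zᵀ * Z)) := by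
        refine lintegral_congr_ae ?_
        filter_upwards [ae_det_ne_zero (m := m)] with Z hZ
        rw [lintegral_mul_const _ (measurable_gramKernel_left Z), ← lintegral_gramKernel hZ]
        have : |Z.det| ^ n = |Z.det| ^ m * |Z.det| ^ (n - m) := by
          rw [← pow_add, Nat.add_sub_cancel' hmn]
        rw [this, ENNReal.ofReal_mul (by positivity)]
        ring
    _ = _ := by
        refine lintegral_const_mul _ ?_
        exact ((((Continuous.matrix_det continuous_id).measurable.norm).pow_const
          _).ennreal_ofReal).mul
            (hφ.comp (measurable_matrix_mul measurable_transpose measurable_id))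

/-- Integrals of functions of `XᵀX` over `n × m` matrices reduce to square matrices. -/
theorem lintegral_gram (νH : Measure (OrthGrp m)) [νH.IsHaarMeasure] [IsProbabilityMeasure νH]
    (hmn : m ≤ n) {φ : RMat m m → ENNReal} (hφ : Measurable φ) :
    ∫⁻ X : RMat n m, φ (Xᵀ * X) =
      ENNReal.ofReal (√π ^ (n * m) * mvGamma m ((m : ℝ) / 2) /
          (√π ^ (m * m) * mvGamma m ((n : ℝ) / 2))) *
        ∫⁻ Z : RMat m m, ENNReal.ofReal (|Z.det| ^ (n - m)) * φ (Zᵀ * Z) := by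
  have hA : 0 < √π ^ (m * m) := by positivity
  have hB : 0 < √π ^ (n * m) := by positivity
  have hG : 0 < mvGamma m ((m : ℝ) / 2) := by simpa using mvGamma_half_pos (m := m) 0
  have hGn : 0 < mvGamma m ((n : ℝ) / 2) := by
    have := mvGamma_half_pos (m := m) (n - m)
    rwa [Nat.cast_sub hmn, add_sub_cancel] at this
  have hA0 : ENNReal.ofReal (√π ^ (m * m)) ≠ 0 := (ENNReal.ofReal_pos.2 hA).ne'
  have h1 := gaussian_mul_lintegral_gram hmn
    (φ := fun S : RMat m m => ENNReal.ofReal (Real.exp (-S.trace)))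
    (Real.measurable_exp.comp
      (Continuous.matrix_trace continuous_id).measurable.neg).ennreal_ofReal
  rw [lintegral_gaussian_matrix n m] at h1
  have h2 : ∫⁻ Z : RMat m m, ENNReal.ofReal (|Z.det| ^ (n - m)) *
      ENNReal.ofReal (Real.exp (-(Zᵀ * Z).trace)) =
      ENNReal.ofReal (√π ^ (m * m) * mvGamma m ((n : ℝ) / 2) / mvGamma m ((m : ℝ) / 2)) := by
    have := lintegral_det_pow_gaussian νH (n - m)
    rw [Nat.cast_sub hmn, add_sub_cancel] at this
    rw [← this]
    refine lintegral_congr fun Z => ?_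
    rw [ENNReal.ofReal_mul (by positivity)]
  rw [h2] at h1
  have hK : ∫⁻ X : RMat n m, gramKernel X 1 = ENNReal.ofReal (√π ^ (m * m)) *
      ENNReal.ofReal (√π ^ (n * m) * mvGamma m ((m : ℝ) / 2) /
        (√π ^ (m * m) * mvGamma m ((n : ℝ) / 2))) := by
    have hC : 0 < √π ^ (m * m) * mvGamma m ((n : ℝ) / 2) / mvGamma m ((m : ℝ) / 2) := by
      positivity
    rw [← ENNReal.mul_left_inj (ENNReal.ofReal_pos.2 hC).ne' ENNReal.ofReal_ne_top, ← h1,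
      ← ENNReal.ofReal_mul (by positivity), ← ENNReal.ofReal_mul (by positivity),
      ← ENNReal.ofReal_mul (by positivity)]
    congr 1
    field_simp
  rw [← ENNReal.mul_right_inj hA0 ENNReal.ofReal_ne_top, gaussian_mul_lintegral_gram hmn hφ, hK,
    mul_assoc]

end Gram

/-! ### Measurability of singular values -/

section SingularValues

variable {n m : ℕ}

theorem charpoly_transpose_mul_self (X : RMat n m) :
    (Xᵀ * X).charpoly = ∏ i, (Polynomial.X - Polynomial.C (sortedEigs X i)) := by
  obtain ⟨k, hk⟩ := exists_orth_diagonal X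
  rw [hk, charpoly_orth_conj, charpoly_diagonal]

theorem svalues_antitone (X : RMat n m) : Antitone (svalues X) := fun _ _ h =>
  Real.sqrt_le_sqrt (sortedEigs_antitone X h)

theorem svalues_sq (X : RMat n m) (i : Fin m) : svalues X i ^ 2 = sortedEigs X i :=
  Real.sq_sqrt (sortedEigs_nonneg X i)

theorem svalues_eq_of_charpoly {X : RMat n m} {α : Fin m → ℝ} (hα : α ∈ chamber m)
    (h : (Xᵀ * X).charpoly = ∏ i, (Polynomial.X - Polynomial.C (α i ^ 2))) : svalues X = α := by
  refine chamber_eq_of_charpoly_eq (svalues_antitone X) (fun i => Real.sqrt_nonneg _)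
    hα.1.antitone (fun i => (hα.2 i).le) ?_
  simp only [svalues_sq]
  rw [← h, charpoly_transpose_mul_self]

/-- Values of `∏ (t - l i)` at `t = 0, …, m`. -/
noncomputable def evalProd (l : Fin m → ℝ) : Fin (m + 1) → ℝ := fun j => ∏ i, ((j : ℝ) - l i)

theorem continuous_evalProd : Continuous (evalProd (m := m)) :=
  continuous_pi fun _ => continuous_finsetProd _ fun i _ =>
    continuous_const.sub (continuous_apply i)

theorem evalProd_injOn : Set.InjOn (evalProd (m := m)) {l | Antitone l} := by
  intro l hl l' hl' h
  refine antitone_eq_of_prod_X_sub_C_eq hl hl' ?_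
  have hdeg : ∀ l : Fin m → ℝ,
      (∏ i, (Polynomial.X - Polynomial.C (l i))).natDegree = m := fun l => by
    rw [Polynomial.natDegree_finsetProd_X_sub_C_eq_card]; simp
  have hne : ∀ l : Fin m → ℝ, (∏ i, (Polynomial.X - Polynomial.C (l i))) ≠ 0 := fun l =>
    (Polynomial.monic_prod_of_monic _ _ fun i _ => Polynomial.monic_X_sub_C _).ne_zero
  have hinj : Function.Injective fun j : Fin (m + 1) => ((j : ℕ) : ℝ) := fun a b hab =>
    Fin.ext (Nat.cast_injective hab)
  refine Polynomial.eq_of_degrees_lt_of_eval_index_eq (s := Finset.univ)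
    (v := fun j : Fin (m + 1) => ((j : ℕ) : ℝ)) hinj.injOn ?_ ?_ fun j _ => ?_
  · rw [Polynomial.degree_eq_natDegree (hne l), hdeg]; simp; exact_mod_cast Nat.lt_succ_self m
  · rw [Polynomial.degree_eq_natDegree (hne l'), hdeg]; simp; exact_mod_cast Nat.lt_succ_self m
  · simpa [evalProd, Polynomial.eval_prod] using congrFun h j

/-- The singular values of `X` are a measurable function of `XᵀX`. -/
theorem exists_measurable_svalues (m : ℕ) : ∃ f : RMat m m → Fin m → ℝ, Measurable f ∧
    ∀ (n : ℕ) (X : RMat n m), f (Xᵀ * X) = svalues X := by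
  have : PolishSpace {l : Fin m → ℝ | Antitone l} := isClosed_antitone.polishSpace
  have he : MeasurableEmbedding fun l : {l : Fin m → ℝ | Antitone l} => evalProd l.1 :=
    (continuous_evalProd.comp continuous_subtype_val).measurableEmbedding
      (Set.injOn_iff_injective.1 evalProd_injOn)
  obtain ⟨g, hg, hge⟩ := he.exists_measurable_extend
    (g := fun l : {l : Fin m → ℝ | Antitone l} => fun i => √(l.1 i))
    (measurable_pi_lambda _ fun i =>
      ((measurable_pi_apply i).comp measurable_subtype_coe).sqrt) fun _ => inferInstance
  refine ⟨fun S => g fun j : Fin (m + 1) => (scalar (Fin m) ((j : ℕ) : ℝ) - S).det,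
    hg.comp (measurable_pi_lambda _ fun j => ?_), fun n X => ?_⟩
  · exact (Continuous.matrix_det (continuous_const.sub continuous_id)).measurable
  · have h := congrFun hge ⟨sortedEigs X, sortedEigs_antitone X⟩
    rw [Function.comp_apply] at h
    refine Eq.trans ?_ h
    refine congrArg g (funext fun j => ?_)
    rw [← eval_charpoly, charpoly_transpose_mul_self, Polynomial.eval_prod]
    simp [evalProd]

end SingularValues

/-! ### Integration of functions of `XᵀX` in singular value coordinates -/

section Spherical

variable {n m : ℕ}

/-- The average of `φ` over the orthogonal conjugates of `S`. -/
noncomputable def orthAverage (νH : Measure (OrthGrp m)) (φ : RMat m m → ENNReal)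
    (S : RMat m m) : ENNReal :=
  ∫⁻ H : OrthGrp m, φ ((H : RMat m m) * S * (H : RMat m m)ᵀ) ∂νH

theorem measurable_orth_conj : Measurable fun p : RMat m m × OrthGrp m =>
    (p.2 : RMat m m) * p.1 * (p.2 : RMat m m)ᵀ :=
  measurable_matrix_mul
    (measurable_matrix_mul (measurable_coe_orthGrp.comp measurable_snd) measurable_fst)
    (measurable_transpose.comp (measurable_coe_orthGrp.comp measurable_snd))

theorem measurable_orthAverage (νH : Measure (OrthGrp m)) [IsProbabilityMeasure νH]
    {φ : RMat m m → ENNReal} (hφ : Measurable φ) : Measurable (orthAverage νH φ) :=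
  Measurable.lintegral_prod_right' (hφ.comp measurable_orth_conj)

theorem orthAverage_conj (νH : Measure (OrthGrp m)) [νH.IsHaarMeasure] [IsProbabilityMeasure νH]
    (φ : RMat m m → ENNReal) (g : OrthGrp m) (S : RMat m m) :
    orthAverage νH φ ((g : RMat m m)ᵀ * S * (g : RMat m m)) = orthAverage νH φ S := by
  have := isMulRightInvariant_orthGrp νH
  rw [orthAverage, orthAverage, ← lintegral_mul_right_eq_self
    (fun H : OrthGrp m => φ ((H : RMat m m) * S * (H : RMat m m)ᵀ)) g⁻¹]
  refine lintegral_congr fun H => ?_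
  have : ((H * g⁻¹ : OrthGrp m) : RMat m m) = (H : RMat m m) * (g : RMat m m)ᵀ := by
    rw [← OrthGrp.coe_inv]; rfl
  rw [this, transpose_mul, transpose_transpose]
  simp only [Matrix.mul_assoc]

theorem measurable_det_pow_mul_gram {φ : RMat m m → ENNReal} (hφ : Measurable φ) (q : ℕ) :
    Measurable fun Z : RMat m m => ENNReal.ofReal (|Z.det| ^ q) * φ (Zᵀ * Z) :=
  ((((Continuous.matrix_det continuous_id).measurable.norm).pow_const _).ennreal_ofReal).mul
    (hφ.comp (measurable_matrix_mul measurable_transpose measurable_id))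

theorem lintegral_det_pow_mul_orthAverage (νH : Measure (OrthGrp m)) [IsProbabilityMeasure νH]
    {φ : RMat m m → ENNReal} (hφ : Measurable φ) (q : ℕ) :
    ∫⁻ Z : RMat m m, ENNReal.ofReal (|Z.det| ^ q) * orthAverage νH φ (Zᵀ * Z) =
      ∫⁻ Z : RMat m m, ENNReal.ofReal (|Z.det| ^ q) * φ (Zᵀ * Z) := by
  have hG := measurable_det_pow_mul_gram hφ q
  have hgram : Measurable fun Z : RMat m m => Zᵀ * Z :=
    measurable_matrix_mul measurable_transpose measurable_id
  have hpair : Measurable fun p : RMat m m × OrthGrp m => (p.1ᵀ * p.1, p.2) :=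
    (hgram.comp measurable_fst).prodMk measurable_snd
  have hconj : Measurable fun p : RMat m m × OrthGrp m =>
      φ ((p.2 : RMat m m) * (p.1ᵀ * p.1) * (p.2 : RMat m m)ᵀ) := by
    have h := (hφ.comp measurable_orth_conj).comp hpair
    exact h
  calc _ = ∫⁻ Z : RMat m m, ∫⁻ H : OrthGrp m, ENNReal.ofReal (|Z.det| ^ q) *
          φ ((H : RMat m m) * (Zᵀ * Z) * (H : RMat m m)ᵀ) ∂νH := by
        refine lintegral_congr fun Z => ?_
        rw [orthAverage, lintegral_const_mul' _ _ ENNReal.ofReal_ne_top]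
    _ = ∫⁻ H : OrthGrp m, (∫⁻ Z : RMat m m, ENNReal.ofReal (|Z.det| ^ q) *
          φ ((H : RMat m m) * (Zᵀ * Z) * (H : RMat m m)ᵀ)) ∂νH := by
        refine lintegral_lintegral_swap (Measurable.aemeasurable (Measurable.mul ?_ ?_))
        · exact ((((Continuous.matrix_det continuous_id).measurable.norm).pow_const
            _).ennreal_ofReal).comp measurable_fst
        · exact hconj
    _ = ∫⁻ _ : OrthGrp m, (∫⁻ Z : RMat m m, ENNReal.ofReal (|Z.det| ^ q) * φ (Zᵀ * Z)) ∂νH := by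
        refine lintegral_congr fun H => ?_
        rw [← lintegral_orth_mul_right H⁻¹ hG]
        refine lintegral_congr fun Z => ?_
        have h1 : |(Z * ((H⁻¹ : OrthGrp m) : RMat m m)).det| = |Z.det| := by
          rw [det_mul, abs_mul, OrthGrp.abs_det, mul_one]
        rw [h1, OrthGrp.coe_inv, transpose_mul, transpose_transpose]
        simp only [Matrix.mul_assoc]
    _ = _ := by simp

theorem lintegral_gram_eq_chamber (νH : Measure (OrthGrp m)) [νH.IsHaarMeasure]
    [IsProbabilityMeasure νH] (hmn : m ≤ n) {φ : RMat m m → ENNReal} (hφ : Measurable φ) :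
    ∫⁻ X : RMat n m, φ (Xᵀ * X) =
      ENNReal.ofReal (2 ^ m * √π ^ (m * m) * √π ^ (n * m) /
          (mvGamma m ((m : ℝ) / 2) * mvGamma m ((n : ℝ) / 2))) *
        ∫⁻ α in chamber m, ENNReal.ofReal ((∏ i, α i ^ (n - m)) *
            ∏ i : Fin m, ∏ j ∈ Finset.Ioi i, (α i ^ 2 - α j ^ 2)) *
          orthAverage νH φ (diagonal fun i => α i ^ 2) := by
  have hG : 0 < mvGamma m ((m : ℝ) / 2) := by simpa using mvGamma_half_pos (m := m) 0
  have hGn : 0 < mvGamma m ((n : ℝ) / 2) := by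
    have := mvGamma_half_pos (m := m) (n - m)
    rwa [Nat.cast_sub hmn, add_sub_cancel] at this
  have hA : 0 < √π ^ (m * m) := by positivity
  let F : RMat m m → ENNReal := fun Z =>
    ENNReal.ofReal (|Z.det| ^ (n - m)) * orthAverage νH φ (Zᵀ * Z)
  have hF : Measurable F := measurable_det_pow_mul_gram (measurable_orthAverage νH hφ) _
  have hl : ∀ (g : OrthGrp m) Y, F ((g : RMat m m) * Y) = F Y := fun g Y => by
    have : ((g : RMat m m) * Y)ᵀ * ((g : RMat m m) * Y) = Yᵀ * Y := by
      rw [transpose_mul]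
      calc _ = Yᵀ * ((g : RMat m m)ᵀ * (g : RMat m m)) * Y := by simp only [Matrix.mul_assoc]
        _ = _ := by rw [g.transpose_mul_self, mul_one]
    simp only [F]
    rw [this, det_mul, abs_mul, g.abs_det, one_mul]
  have hr : ∀ (g : OrthGrp m) Y, F (Y * (g : RMat m m)) = F Y := fun g Y => by
    have : (Y * (g : RMat m m))ᵀ * (Y * (g : RMat m m)) =
        (g : RMat m m)ᵀ * (Yᵀ * Y) * (g : RMat m m) := by
      rw [transpose_mul]; simp only [Matrix.mul_assoc]
    simp only [F]
    rw [this, orthAverage_conj, det_mul, abs_mul, g.abs_det, mul_one]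
  have hD : ∫⁻ α in chamber m, ENNReal.ofReal (∏ i : Fin m, ∏ j ∈ Finset.Ioi i,
        (α i ^ 2 - α j ^ 2)) * F (diagonal α) =
      ∫⁻ α in chamber m, ENNReal.ofReal ((∏ i, α i ^ (n - m)) *
            ∏ i : Fin m, ∏ j ∈ Finset.Ioi i, (α i ^ 2 - α j ^ 2)) *
          orthAverage νH φ (diagonal fun i => α i ^ 2) := by
    refine setLIntegral_congr_fun measurableSet_chamber fun α hα => ?_
    have h0 : 0 ≤ ∏ i, α i := Finset.prod_nonneg fun i _ => (hα.2 i).le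
    simp only [F]
    rw [det_diagonal, diagonal_transpose, diagonal_mul_diagonal, abs_of_nonneg h0,
      ← Finset.prod_pow, mul_comm (∏ i, α i ^ (n - m)),
      ENNReal.ofReal_mul' (Finset.prod_nonneg fun i _ => pow_nonneg (hα.2 i).le _), mul_assoc]
    simp only [pow_two]
  have hw0 : haarVol νH ^ 2 ≠ 0 := pow_ne_zero _ (haarVol_ne_zero νH)
  have hwt : haarVol νH ^ 2 ≠ ⊤ := ENNReal.pow_ne_top (haarVol_ne_top νH)
  have h := lintegral_svd νH hF hl hr
  rw [hD, cayleyVol_eq νH, mul_pow, mul_comm (2 ^ m) (haarVol νH ^ 2), mul_assoc, mul_assoc] at h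
  have h1 := (ENNReal.mul_right_inj hw0 hwt).1 h
  rw [lintegral_gram νH hmn hφ, ← lintegral_det_pow_mul_orthAverage νH hφ]
  set I := ∫⁻ α in chamber m, ENNReal.ofReal ((∏ i, α i ^ (n - m)) *
            ∏ i : Fin m, ∏ j ∈ Finset.Ioi i, (α i ^ 2 - α j ^ 2)) *
          orthAverage νH φ (diagonal fun i => α i ^ 2)
  have h2 : (2 : ENNReal) ^ m = ENNReal.ofReal (2 ^ m) := by
    rw [ENNReal.ofReal_pow zero_le_two]; simp
  rw [h2, ← ENNReal.ofReal_pow (by positivity)] at h1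
  have h20 : ENNReal.ofReal (2 ^ m) ≠ 0 := by
    rw [← h2]; exact pow_ne_zero _ two_ne_zero
  rw [← ENNReal.mul_right_inj h20 ENNReal.ofReal_ne_top]
  change _ * (_ * ∫⁻ Z : RMat m m, F Z) = _
  rw [mul_left_comm, h1, ← mul_assoc, ← mul_assoc, ← ENNReal.ofReal_mul (by positivity),
    ← ENNReal.ofReal_mul (by positivity)]
  congr 2
  field_simp

end Spherical

/-! ### The highest weight vector on positive definite matrices -/

section Density

variable {n m : ℕ}

theorem continuous_princMinor (i : Fin m) : Continuous fun A : RMat m m => princMinor A i :=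
  Continuous.matrix_det (Continuous.matrix_submatrix continuous_id _ _)

theorem princMinor_pos {A : RMat m m} (hA : A.PosDef) (i : Fin m) : 0 < princMinor A i :=
  (hA.submatrix (Fin.castLE_injective _)).det_pos

theorem hwv_pos (τ : Fin m → ℝ) {A : RMat m m} (hA : A.PosDef) : 0 < hwv τ A :=
  Finset.prod_pos fun i _ => rpow_pos_of_pos (princMinor_pos hA i) _

theorem measurable_hwv (τ : Fin m → ℝ) : Measurable (hwv τ) :=
  Finset.measurable_fun_prod _ fun i _ => (continuous_princMinor i).measurable.pow_const _

theorem continuous_hwv_comp (τ : Fin m → ℝ) {X : Type*} [TopologicalSpace X] {f : X → RMat m m}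
    (hf : Continuous f) (hpos : ∀ x, (f x).PosDef) : Continuous fun x => hwv τ (f x) :=
  continuous_finsetProd _ fun i _ => ((continuous_princMinor i).comp hf).rpow_const fun x =>
    Or.inl (princMinor_pos (hpos x) i).ne'

theorem posDef_gram {X : RMat n m} (hX : (Xᵀ * X).det ≠ 0) : (Xᵀ * X).PosDef := by
  have h : (Xᵀ * X).PosSemidef := posSemidef_conjTranspose_mul_self X
  exact h.posDef_iff_isUnit.2 ((isUnit_iff_isUnit_det _).2 hX.isUnit)

theorem orth_conj_eq_gram (H : OrthGrp m) (α : Fin m → ℝ) :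
    (H : RMat m m) * diagonal (fun i => α i ^ 2) * (H : RMat m m)ᵀ =
      (diagonal α * (H : RMat m m)ᵀ)ᵀ * (diagonal α * (H : RMat m m)ᵀ) := by
  rw [transpose_mul, transpose_transpose, diagonal_transpose]
  simp only [Matrix.mul_assoc, pow_two]
  rw [← Matrix.mul_assoc (diagonal α), diagonal_mul_diagonal]

theorem det_orth_conj_ne_zero (H : OrthGrp m) {α : Fin m → ℝ} (hα : α ∈ chamber m) :
    ((H : RMat m m) * diagonal (fun i => α i ^ 2) * (H : RMat m m)ᵀ).det ≠ 0 := by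
  rw [det_mul, det_mul, det_transpose, det_diagonal]
  exact mul_ne_zero (mul_ne_zero H.det_ne_zero
    (Finset.prod_ne_zero_iff.2 fun i _ => pow_ne_zero _ (hα.2 i).ne')) H.det_ne_zero

theorem posDef_orth_conj (H : OrthGrp m) {α : Fin m → ℝ} (hα : α ∈ chamber m) :
    ((H : RMat m m) * diagonal (fun i => α i ^ 2) * (H : RMat m m)ᵀ).PosDef := by
  have h := det_orth_conj_ne_zero H hα
  rw [orth_conj_eq_gram] at h ⊢
  exact posDef_gram h

theorem trace_orth_conj (H : OrthGrp m) (S : RMat m m) :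
    ((H : RMat m m) * S * (H : RMat m m)ᵀ).trace = S.trace := by
  rw [trace_mul_comm, ← Matrix.mul_assoc, H.transpose_mul_self, one_mul]

theorem svalues_diagonal_mul_orth (H : OrthGrp m) {α : Fin m → ℝ} (hα : α ∈ chamber m) :
    svalues (diagonal α * (H : RMat m m)ᵀ) = α := by
  refine svalues_eq_of_charpoly hα ?_
  rw [← orth_conj_eq_gram, charpoly_orth_conj, charpoly_diagonal]

theorem inv_orth_conj (H : OrthGrp m) (α : Fin m → ℝ) (hα : α ∈ chamber m) :
    ((H : RMat m m) * diagonal (fun i => α i ^ 2) * (H : RMat m m)ᵀ)⁻¹ =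
      (H : RMat m m) * diagonal (fun i => (α i ^ 2)⁻¹) * (H : RMat m m)ᵀ := by
  refine inv_eq_right_inv ?_
  calc _ = (H : RMat m m) * diagonal (fun i => α i ^ 2) * ((H : RMat m m)ᵀ * (H : RMat m m)) *
        diagonal (fun i => (α i ^ 2)⁻¹) * (H : RMat m m)ᵀ := by simp only [Matrix.mul_assoc]
    _ = (H : RMat m m) * 1 * (H : RMat m m)ᵀ := by
      rw [H.transpose_mul_self, mul_one, mul_assoc (H : RMat m m), diagonal_mul_diagonal,
        ← diagonal_one]
      congr 3
      ext i
      exact mul_inv_cancel₀ (pow_ne_zero 2 (hα.2 i).ne')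
    _ = 1 := by rw [mul_one, H.mul_transpose_self]

theorem integrable_hwv_orth_conj (νH : Measure (OrthGrp m)) [IsProbabilityMeasure νH]
    (τ : Fin m → ℝ) {α : Fin m → ℝ} (hα : α ∈ chamber m) :
    Integrable (fun H : OrthGrp m => hwv τ
      ((H : RMat m m) * diagonal (fun i => α i ^ 2) * (H : RMat m m)ᵀ)⁻¹) νH := by
  have hc : Continuous fun H : OrthGrp m =>
      ((H : RMat m m) * diagonal (fun i => α i ^ 2) * (H : RMat m m)ᵀ)⁻¹ := by
    simp only [inv_orth_conj _ α hα]
    have h1 : Continuous fun H : OrthGrp m => (H : RMat m m) := continuous_subtype_val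
    exact (h1.matrix_mul continuous_const).matrix_mul h1.matrix_transpose
  exact (continuous_hwv_comp τ hc fun H => (posDef_orth_conj H hα).inv
    ).integrable_of_hasCompactSupport (HasCompactSupport.of_compactSpace _)

theorem sqrt_pi_pow (q : ℕ) : √π ^ q = π ^ ((q : ℝ) / 2) := by
  rw [Real.sqrt_eq_rpow, ← rpow_natCast, ← rpow_mul pi_pos.le]
  congr 1
  ring

theorem measurable_svalues : Measurable (svalues : RMat n m → Fin m → ℝ) := by
  obtain ⟨f, hf, hfs⟩ := exists_measurable_svalues m
  have h : Measurable fun X : RMat n m => f (Xᵀ * X) :=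
    hf.comp (measurable_matrix_mul measurable_transpose measurable_id)
  simpa only [hfs] using h

/-- The law of the singular values of a random matrix whose density is a function of `XᵀX`. -/
theorem map_svalues_withDensity (νH : Measure (OrthGrp m)) [νH.IsHaarMeasure]
    [IsProbabilityMeasure νH] (hmn : m ≤ n) {φ : RMat m m → ENNReal} (hφ : Measurable φ) :
    Measure.map svalues ((volume : Measure (RMat n m)).withDensity fun X => φ (Xᵀ * X)) =
      (volume.restrict (chamber m)).withDensity fun α =>
        ENNReal.ofReal (2 ^ m * √π ^ (m * m) * √π ^ (n * m) /
          (mvGamma m ((m : ℝ) / 2) * mvGamma m ((n : ℝ) / 2))) *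
        (ENNReal.ofReal ((∏ i, α i ^ (n - m)) *
            ∏ i : Fin m, ∏ j ∈ Finset.Ioi i, (α i ^ 2 - α j ^ 2)) *
          orthAverage νH φ (diagonal fun i => α i ^ 2)) := by
  obtain ⟨f, hf, hfs⟩ := exists_measurable_svalues m
  ext B hB
  have hψ : Measurable fun S : RMat m m => B.indicator 1 (f S) * φ S :=
    ((measurable_one.indicator hB).comp hf).mul hφ
  have hL : Measure.map svalues ((volume : Measure (RMat n m)).withDensity
      fun X => φ (Xᵀ * X)) B =
      ∫⁻ X : RMat n m, B.indicator 1 (f (Xᵀ * X)) * φ (Xᵀ * X) := by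
    have hB' : MeasurableSet ((svalues : RMat n m → Fin m → ℝ) ⁻¹' B) := measurable_svalues hB
    rw [Measure.map_apply measurable_svalues hB, withDensity_apply _ hB',
      ← lintegral_indicator hB']
    refine lintegral_congr fun X => ?_
    rw [hfs]
    by_cases h : svalues X ∈ B
    · rw [Set.indicator_of_mem (by exact h), Set.indicator_of_mem h, Pi.one_apply, one_mul]
    · rw [Set.indicator_of_notMem (by exact h), Set.indicator_of_notMem h, zero_mul]
  rw [hL, lintegral_gram_eq_chamber νH hmn hψ, withDensity_apply _ hB,
    ← lintegral_indicator hB, ← lintegral_const_mul' _ _ ENNReal.ofReal_ne_top]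
  refine setLIntegral_congr_fun measurableSet_chamber fun α hα => ?_
  have hfα : ∀ H : OrthGrp m, f ((H : RMat m m) * diagonal (fun i => α i ^ 2) *
      (H : RMat m m)ᵀ) = α := fun H => by
    rw [orth_conj_eq_gram, hfs, svalues_diagonal_mul_orth H hα]
  simp only [orthAverage, hfα]
  by_cases h : α ∈ B
  · simp [h]
  · simp [h]

end Density

/-! ### The T-Riesz distribution of type II -/

section TRiesz

variable {n m : ℕ}

/-- The normalizing constant of the T-Riesz density of type II. -/
noncomputable def tRieszIIConst (n m : ℕ) (ν k ρ : ℝ) (τ : Fin m → ℝ) : ℝ :=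
  mvGamma m ((n : ℝ) / 2) * Real.Gamma ((ν + (m * n : ℕ)) / 2 - k - ∑ i, τ i) *
      ρ ^ (((m * n : ℕ) : ℝ) / 2 - ∑ i, τ i) /
      (Real.pi ^ (((m * n : ℕ) : ℝ) / 2) * mvGammaII m ((n : ℝ) / 2) τ *
        Real.Gamma (ν / 2 - k))

/-- The T-Riesz density of type II as a function of the Gram matrix. -/
noncomputable def tRieszIIGram (n m : ℕ) (ν k ρ : ℝ) (τ : Fin m → ℝ) (S : RMat m m) : ℝ :=
  tRieszIIConst n m ν k ρ τ *
    (1 + ρ * S.trace) ^ (-((ν + (m * n : ℕ)) / 2 - k - ∑ i, τ i)) * hwv τ S⁻¹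

theorem tRieszIIDen_eq_gram (ν k ρ : ℝ) (τ : Fin m → ℝ) (X : RMat n m) :
    tRieszIIDen n m ν k ρ τ 0 1 1 1 X = tRieszIIGram n m ν k ρ τ (Xᵀ * X) := by
  simp [tRieszIIDen, tRieszIIGram, tRieszIIConst]

theorem mvGamma_natCast_half_pos (hmn : m ≤ n) : 0 < mvGamma m ((n : ℝ) / 2) := by
  have := mvGamma_half_pos (m := m) (n - m)
  rwa [Nat.cast_sub hmn, add_sub_cancel] at this

theorem mvGammaII_pos {τ : Fin m → ℝ}
    (hτ : ∀ i : Fin m, 0 < (n : ℝ) / 2 - τ i - ((m : ℝ) - 1 - (i : ℝ)) / 2) :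
    0 < mvGammaII m ((n : ℝ) / 2) τ :=
  mul_pos (rpow_pos_of_pos pi_pos _) (Finset.prod_pos fun i _ => Gamma_pos_of_pos (hτ i))

theorem tRieszII_exponent_pos {ν k : ℝ} (hνk : 0 < ν / 2 - k) {τ : Fin m → ℝ}
    (hτ : ∀ i : Fin m, 0 < (n : ℝ) / 2 - τ i - ((m : ℝ) - 1 - (i : ℝ)) / 2) :
    0 < (ν + (m * n : ℕ)) / 2 - k - ∑ i, τ i := by
  have h : ∑ i, τ i ≤ ∑ _i : Fin m, (n : ℝ) / 2 := Finset.sum_le_sum fun i _ => by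
    have h1 := hτ i
    have h2 : ((i : ℕ) : ℝ) + 1 ≤ m := by exact_mod_cast i.2
    linarith
  rw [Finset.sum_const, Finset.card_univ, Fintype.card_fin, nsmul_eq_mul] at h
  push_cast
  linarith

theorem tRieszIIConst_pos (hmn : m ≤ n) {ρ k ν : ℝ} (hρ : 0 < ρ) (hνk : 0 < ν / 2 - k)
    {τ : Fin m → ℝ}
    (hτ : ∀ i : Fin m, 0 < (n : ℝ) / 2 - τ i - ((m : ℝ) - 1 - (i : ℝ)) / 2) :
    0 < tRieszIIConst n m ν k ρ τ := by
  have h1 := mvGamma_natCast_half_pos hmn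
  have h2 := mvGammaII_pos hτ
  have h3 := Gamma_pos_of_pos hνk
  have h4 := Gamma_pos_of_pos (tRieszII_exponent_pos hνk hτ)
  unfold tRieszIIConst
  positivity

theorem tRieszIIGram_pos (hmn : m ≤ n) {ρ k ν : ℝ} (hρ : 0 < ρ) (hνk : 0 < ν / 2 - k)
    {τ : Fin m → ℝ}
    (hτ : ∀ i : Fin m, 0 < (n : ℝ) / 2 - τ i - ((m : ℝ) - 1 - (i : ℝ)) / 2) {X : RMat n m}
    (hX : (Xᵀ * X).det ≠ 0) : 0 < tRieszIIGram n m ν k ρ τ (Xᵀ * X) := by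
  have h1 : 0 ≤ (Xᵀ * X).trace := by
    rw [trace_transpose_mul_self]; positivity
  exact mul_pos (mul_pos (tRieszIIConst_pos hmn hρ hνk hτ)
    (rpow_pos_of_pos (by positivity) _)) (hwv_pos τ (posDef_gram hX).inv)

theorem measurable_tRieszIIGram (ν k ρ : ℝ) (τ : Fin m → ℝ) :
    Measurable (tRieszIIGram n m ν k ρ τ) := by
  have htr : Measurable fun S : RMat m m => S.trace :=
    (Continuous.matrix_trace continuous_id).measurable
  exact ((((htr.const_mul ρ).const_add 1).pow_const _).const_mul _).mul
    ((measurable_hwv τ).comp measurable_matrix_inv)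

theorem aemeasurable_of_map_eq_withDensity {Ω X : Type*} [MeasurableSpace Ω] [MeasurableSpace X]
    {P : Measure Ω} {μ : Measure X} (hμ : μ ≠ 0) {T : Ω → X} {f : X → ENNReal}
    (hf : AEMeasurable f μ) (hpos : ∀ᵐ x ∂μ, f x ≠ 0) (h : Measure.map T P = μ.withDensity f) :
    AEMeasurable T P := by
  by_contra hT
  rw [Measure.map_of_not_aemeasurable hT] at h
  have h0 := withDensity_eq_zero hf h.symm
  refine hμ (ae_eq_bot.1 (Filter.eventually_false_iff_eq_bot.1 ?_))
  filter_upwards [h0, hpos] with x h1 h2 using h2 h1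

theorem orthAverage_tRieszIIGram (νH : Measure (OrthGrp m)) [IsProbabilityMeasure νH]
    {ρ k ν : ℝ} {τ : Fin m → ℝ} (hρ : 0 ≤ ρ) (hC : 0 ≤ tRieszIIConst n m ν k ρ τ)
    {α : Fin m → ℝ} (hα : α ∈ chamber m) :
    orthAverage νH (fun S => ENNReal.ofReal (tRieszIIGram n m ν k ρ τ S))
        (diagonal fun i => α i ^ 2) =
      ENNReal.ofReal (tRieszIIConst n m ν k ρ τ *
        (1 + ρ * ∑ i, α i ^ 2) ^ (-((ν + (m * n : ℕ)) / 2 - k - ∑ i, τ i)) *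
        ∫ H : OrthGrp m, hwv τ
          ((H : RMat m m) * diagonal (fun i => α i ^ 2) * (H : RMat m m)ᵀ)⁻¹ ∂νH) := by
  have h1 : 0 ≤ tRieszIIConst n m ν k ρ τ *
      (1 + ρ * ∑ i, α i ^ 2) ^ (-((ν + (m * n : ℕ)) / 2 - k - ∑ i, τ i)) := by positivity
  rw [ENNReal.ofReal_mul h1, ofReal_integral_eq_lintegral_ofReal
    (integrable_hwv_orth_conj νH τ hα)
    (Filter.Eventually.of_forall fun H => (hwv_pos τ (posDef_orth_conj H hα).inv).le),
    ← lintegral_const_mul' _ _ ENNReal.ofReal_ne_top, orthAverage]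
  refine lintegral_congr fun H => ?_
  rw [tRieszIIGram, trace_orth_conj, trace_diagonal, ENNReal.ofReal_mul h1]

theorem tRieszII_svalues_const (hmn : m ≤ n) (ν k ρ : ℝ) (τ : Fin m → ℝ) :
    2 ^ m * √π ^ (m * m) * √π ^ (n * m) /
        (mvGamma m ((m : ℝ) / 2) * mvGamma m ((n : ℝ) / 2)) * tRieszIIConst n m ν k ρ τ =
      (2 : ℝ) ^ m * Real.pi ^ (((m ^ 2 : ℕ) : ℝ) / 2) *
        Real.Gamma ((ν + (m * n : ℕ)) / 2 - k - ∑ i, τ i) *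
        ρ ^ (((m * n : ℕ) : ℝ) / 2 - ∑ i, τ i) /
        (mvGamma m ((m : ℝ) / 2) * mvGammaII m ((n : ℝ) / 2) τ * Real.Gamma (ν / 2 - k)) := by
  have h1 := (mvGamma_natCast_half_pos hmn).ne'
  rw [tRieszIIConst, sqrt_pi_pow, sqrt_pi_pow, mul_comm n m, ← pow_two]
  have h2 : π ^ (((m * n : ℕ) : ℝ) / 2) ≠ 0 := (rpow_pos_of_pos pi_pos _).ne'
  generalize π ^ (((m * n : ℕ) : ℝ) / 2) = a at h2 ⊢
  generalize mvGamma m ((n : ℝ) / 2) = b at h1 ⊢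
  symm
  rw [div_mul_div_comm, ← mul_div_mul_left _ _ (mul_ne_zero h1 h2)]
  congr 1 <;> ring

end TRiesz

/-- joint density of the singular values of
`T ~ MTR^{II}(ν, k, τ, ρ, 0, I_n, I_m)`. -/
theorem stmt_15 (n m : ℕ) (hm : 1 ≤ m) (hmn : m ≤ n)
    (ρ k ν : ℝ) (hρ : 0 < ρ) (hν : 0 < ν) (hνk : 0 < ν / 2 - k)
    (τ : Fin m → ℝ)
    (hτ : ∀ i : Fin m, 0 < (n : ℝ) / 2 - τ i - ((m : ℝ) - 1 - (i : ℝ)) / 2)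
    {Ω : Type*} [MeasurableSpace Ω] (P : Measure Ω) [IsProbabilityMeasure P]
    (T : Ω → Matrix (Fin n) (Fin m) ℝ)
    (hT : Measure.map T P =
      volume.withDensity fun t => ENNReal.ofReal (tRieszIIDen n m ν k ρ τ 0 1 1 1 t))
    (νH : Measure (Matrix.orthogonalGroup (Fin m) ℝ))
    [νH.IsHaarMeasure] [IsProbabilityMeasure νH] :
    Measure.map (fun ω => svalues (T ω)) P =
      (volume.restrict {α : Fin m → ℝ | StrictAnti α ∧ ∀ i, 0 < α i}).withDensity
        fun α => ENNReal.ofReal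
          ((2 : ℝ) ^ m * Real.pi ^ (((m ^ 2 : ℕ) : ℝ) / 2) *
              Real.Gamma ((ν + (m * n : ℕ)) / 2 - k - ∑ i, τ i) *
              ρ ^ (((m * n : ℕ) : ℝ) / 2 - ∑ i, τ i) /
              (mvGamma m ((m : ℝ) / 2) * mvGammaII m ((n : ℝ) / 2) τ *
                Real.Gamma (ν / 2 - k)) *
            (∏ i : Fin m, α i ^ (n - m)) *
            (1 + ρ * ∑ i : Fin m, α i ^ 2) ^
              (-((ν + (m * n : ℕ)) / 2 - k - ∑ i, τ i)) *
            (∏ i : Fin m, ∏ j ∈ Finset.Ioi i, (α i ^ 2 - α j ^ 2)) *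
            ∫ H : Matrix.orthogonalGroup (Fin m) ℝ,
              hwv τ (((H : Matrix (Fin m) (Fin m) ℝ) *
                Matrix.diagonal (fun i => α i ^ 2) *
                (H : Matrix (Fin m) (Fin m) ℝ)ᵀ)⁻¹) ∂νH) := by
  have hC := tRieszIIConst_pos hmn hρ hνk hτ
  have hden : (fun X : RMat n m => ENNReal.ofReal (tRieszIIDen n m ν k ρ τ 0 1 1 1 X)) =
      fun X => ENNReal.ofReal (tRieszIIGram n m ν k ρ τ (Xᵀ * X)) :=
    funext fun X => by rw [tRieszIIDen_eq_gram]
  have hφ : Measurable fun S : RMat m m => ENNReal.ofReal (tRieszIIGram n m ν k ρ τ S) :=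
    (measurable_tRieszIIGram ν k ρ τ).ennreal_ofReal
  have hφg : Measurable fun X : RMat n m =>
      ENNReal.ofReal (tRieszIIGram n m ν k ρ τ (Xᵀ * X)) :=
    hφ.comp (measurable_matrix_mul measurable_transpose measurable_id)
  rw [hden] at hT
  have hTm : AEMeasurable T P := by
    refine aemeasurable_of_map_eq_withDensity (NeZero.ne _) hφg.aemeasurable ?_ hT
    filter_upwards [ae_det_transpose_mul_self_ne_zero hmn] with X hX
    exact (ENNReal.ofReal_pos.2 (tRieszIIGram_pos hmn hρ hνk hτ hX)).ne'
  have hmap : Measure.map (fun ω => svalues (T ω)) P = Measure.map svalues (Measure.map T P) :=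
    (AEMeasurable.map_map_of_aemeasurable measurable_svalues.aemeasurable hTm).symm
  rw [hmap, hT, map_svalues_withDensity νH hmn hφ]
  refine withDensity_congr_ae ?_
  filter_upwards [ae_restrict_mem measurableSet_chamber] with α hα
  have hG : 0 < mvGamma m ((m : ℝ) / 2) := mvGamma_natCast_half_pos le_rfl
  have hGn := mvGamma_natCast_half_pos hmn
  have h0 : 0 ≤ (∏ i, α i ^ (n - m)) *
      ∏ i : Fin m, ∏ j ∈ Finset.Ioi i, (α i ^ 2 - α j ^ 2) :=
    mul_nonneg (Finset.prod_nonneg fun i _ => pow_nonneg (hα.2 i).le _)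
      (Finset.prod_nonneg fun i _ => Finset.prod_nonneg fun j hj => sub_nonneg.2
        (pow_le_pow_left₀ (hα.2 j).le (hα.1 (Finset.mem_Ioi.1 hj)).le 2))
  rw [orthAverage_tRieszIIGram νH hρ.le hC.le hα, ← ENNReal.ofReal_mul h0,
    ← ENNReal.ofReal_mul (by positivity), ← tRieszII_svalues_const hmn]
  congr 1
  ring
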